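/- arXiv:2410.08293 — 9 statements merged into one kernel-verified Lean document; each statement's English description precedes it below -/
import Mathlib

section
/- Let d ≥ 2, p ∈ [1,∞), α ∈ ℝ and β ∈ ℝ with β > (1+α)p − 1. Let u : ℝ^{d-1} × (0,∞) → ℝ be measurable such that for every x' ∈ ℝ^{d-1} the map x_d ↦ u(x', x_d) is differentiable on (0,∞), and set g(x', x_d) = ∂_{x_d} u(x', x_d) + (α/x_d) u(x', x_d). Assume ∫_{ℝ^d_+} |u(x)|^p x_d^β dx < ∞ and ∫_{ℝ^d_+} |g(x)|^p x_d^β dx < ∞. Then ∫_{ℝ^d_+} |u(x)/x_d|^p x_d^β dx < ∞, and (∫_{ℝ^d_+} |u(x)/x_d|^p x_d^β dx)^{1/p} ≤ ((β − αp + 1)/p − 1)^{−1} (∫_{ℝ^d_+} |g(x)|^p x_d^β dx)^{1/p}. -/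
open MeasureTheory Set ENNReal Filter

theorem lintegral_Ioi_rpow_neg_sub_one {k y : ℝ} (hk : 0 < k) (hy : 0 < y) :
    ∫⁻ s in Ioi y, ENNReal.ofReal (s ^ (-k - 1)) = ENNReal.ofReal (y ^ (-k) / k) := by
  have hlt : -k - 1 < -1 := by linarith
  rw [← ofReal_integral_eq_lintegral_ofReal (integrableOn_Ioi_rpow_of_lt hlt hy)]
  · rw [integral_Ioi_rpow_of_lt hlt hy, sub_add_cancel, neg_div_neg_eq]
  · filter_upwards [ae_restrict_mem measurableSet_Ioi] with s hs
    exact Real.rpow_nonneg (hy.trans hs).le _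

theorem lintegral_Ioo_zero_rpow_sub_one {k s : ℝ} (hk : 0 < k) (hs : 0 < s) :
    ∫⁻ y in Ioo 0 s, ENNReal.ofReal (y ^ (k - 1)) = ENNReal.ofReal (s ^ k / k) := by
  have hlt : -1 < k - 1 := by linarith
  have h_int : IntegrableOn (fun y : ℝ ↦ y ^ (k - 1)) (Ioo 0 s) :=
    ((intervalIntegrable_iff_integrableOn_Ioc_of_le hs.le).1
      (intervalIntegral.intervalIntegrable_rpow' hlt)).mono_set Ioo_subset_Ioc_self
  rw [← ofReal_integral_eq_lintegral_ofReal h_int]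
  · rw [← integral_Ioc_eq_integral_Ioo, ← intervalIntegral.integral_of_le hs.le,
      integral_rpow (Or.inl hlt), sub_add_cancel, Real.zero_rpow hk.ne', sub_zero]
  · filter_upwards [ae_restrict_mem measurableSet_Ioo] with y hy
    exact Real.rpow_nonneg hy.1.le _

/-- Jensen's inequality for the tail integral of `f`, with respect to the weight `s ^ (-k - 1)`. -/
theorem lintegral_Ioi_rpow_le {f : ℝ → ℝ≥0∞} (hf : Measurable f) {k p y : ℝ} (hk : 0 < k)
    (hp : 1 ≤ p) (hy : 0 < y) :
    (∫⁻ s in Ioi y, f s) ^ p ≤ ENNReal.ofReal (y ^ (-k) / k) ^ (p - 1) *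
      ∫⁻ s in Ioi y, f s ^ p * ENNReal.ofReal (s ^ ((k + 1) * (p - 1))) := by
  have hp0 : 0 < p := by linarith
  set w : ℝ → ℝ≥0∞ := fun s ↦ ENNReal.ofReal (s ^ (-k - 1)) with hw
  have hwm : Measurable w := by fun_prop
  set h : ℝ → ℝ≥0∞ := fun s ↦ f s * ENNReal.ofReal (s ^ (k + 1)) with hh
  have hhm : Measurable h := by fun_prop
  set μ := (volume.restrict (Ioi y)).withDensity w with hμ
  have hμu : μ univ = ENNReal.ofReal (y ^ (-k) / k) := by
    rw [hμ, withDensity_apply _ MeasurableSet.univ, Measure.restrict_univ,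
      lintegral_Ioi_rpow_neg_sub_one hk hy]
  have key := eLpNorm'_le_eLpNorm'_mul_rpow_measure_univ (μ := μ) one_pos hp
    hhm.aestronglyMeasurable
  simp only [eLpNorm', enorm_eq_self, ENNReal.rpow_one, div_one] at key
  have h1 : ∫⁻ s, h s ∂μ = ∫⁻ s in Ioi y, f s := by
    rw [hμ, lintegral_withDensity_eq_lintegral_mul _ hwm hhm]
    refine setLIntegral_congr_fun measurableSet_Ioi fun s hs ↦ ?_
    have hs0 : 0 < s := hy.trans hs
    simp only [Pi.mul_apply, hw, hh]
    rw [mul_left_comm, ← ENNReal.ofReal_mul (by positivity), ← Real.rpow_add hs0]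
    norm_num
  have h2 : ∫⁻ s, h s ^ p ∂μ =
      ∫⁻ s in Ioi y, f s ^ p * ENNReal.ofReal (s ^ ((k + 1) * (p - 1))) := by
    rw [hμ, lintegral_withDensity_eq_lintegral_mul _ hwm (by fun_prop)]
    refine setLIntegral_congr_fun measurableSet_Ioi fun s hs ↦ ?_
    have hs0 : 0 < s := hy.trans hs
    simp only [Pi.mul_apply, hw, hh]
    rw [ENNReal.mul_rpow_of_nonneg _ _ hp0.le, mul_left_comm,
      ENNReal.ofReal_rpow_of_pos (by positivity), ← Real.rpow_mul hs0.le,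
      ← ENNReal.ofReal_mul (by positivity), ← Real.rpow_add hs0]
    ring_nf
  rw [h1, h2, hμu] at key
  calc (∫⁻ s in Ioi y, f s) ^ p ≤ _ := ENNReal.rpow_le_rpow key hp0.le
    _ = _ := by
      rw [ENNReal.mul_rpow_of_nonneg _ _ hp0.le, ← ENNReal.rpow_mul, ← ENNReal.rpow_mul, mul_comm,
        one_div_mul_cancel hp0.ne', ENNReal.rpow_one]
      congr 2
      field_simp

/-- Hardy's inequality for tail integrals, with a power weight and the sharp constant. -/
theorem lintegral_rpow_lintegral_Ioi_le {f : ℝ → ℝ≥0∞} (hf : Measurable f) {k p : ℝ}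
    (hk : 0 < k) (hp : 1 ≤ p) :
    ∫⁻ y in Ioi 0, (∫⁻ s in Ioi y, f s) ^ p * ENNReal.ofReal (y ^ (k * p - 1)) ≤
      ENNReal.ofReal k⁻¹ ^ p *
        ∫⁻ s in Ioi 0, f s ^ p * ENNReal.ofReal (s ^ ((k + 1) * p - 1)) := by
  set F : ℝ → ℝ≥0∞ := fun s ↦ f s ^ p * ENNReal.ofReal (s ^ ((k + 1) * (p - 1))) with hF
  have hFm : Measurable F := by fun_prop
  set c := ENNReal.ofReal k⁻¹ ^ (p - 1) with hc
  have hstep : ∀ y ∈ Ioi (0 : ℝ),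
      (∫⁻ s in Ioi y, f s) ^ p * ENNReal.ofReal (y ^ (k * p - 1)) ≤
        c * ∫⁻ s in Ioi 0, (Ioi y).indicator F s * ENNReal.ofReal (y ^ (k - 1)) := by
    intro y hy
    have hy0 : 0 < y := hy
    rw [lintegral_mul_const _ (hFm.indicator measurableSet_Ioi),
      setLIntegral_indicator measurableSet_Ioi,
      inter_eq_self_of_subset_left (Ioi_subset_Ioi hy0.le)]
    refine (mul_le_mul_left (lintegral_Ioi_rpow_le hf hk hp hy) _).trans_eq ?_
    rw [hc, div_eq_inv_mul, ENNReal.ofReal_mul (by positivity),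
      ENNReal.mul_rpow_of_nonneg _ _ (by linarith), ENNReal.ofReal_rpow_of_pos (p := p - 1)
        (Real.rpow_pos_of_pos hy0 _), ← Real.rpow_mul hy0.le, mul_assoc, mul_assoc,
      mul_left_comm (ENNReal.ofReal (y ^ _)), ← ENNReal.ofReal_mul (by positivity),
      ← Real.rpow_add hy0, show -k * (p - 1) + (k * p - 1) = k - 1 by ring]
  have hjm : Measurable (Function.uncurry fun y s : ℝ ↦
      (Ioi y).indicator F s * ENNReal.ofReal (y ^ (k - 1))) := by
    have : (Function.uncurry fun y s : ℝ ↦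
        (Ioi y).indicator F s * ENNReal.ofReal (y ^ (k - 1))) =
        fun z : ℝ × ℝ ↦ {z : ℝ × ℝ | z.1 < z.2}.indicator (fun z ↦ F z.2) z *
          ENNReal.ofReal (z.1 ^ (k - 1)) := by
      ext ⟨y, s⟩
      simp [indicator]
    rw [this]
    exact ((hFm.comp measurable_snd).indicator
      (measurableSet_lt measurable_fst measurable_snd)).mul (by fun_prop)
  refine (setLIntegral_mono' measurableSet_Ioi hstep).trans ?_
  rw [lintegral_const_mul' _ _ (ENNReal.rpow_ne_top_of_nonneg (by linarith) ofReal_ne_top),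
    lintegral_lintegral_swap hjm.aemeasurable]
  have hinner : ∀ s ∈ Ioi (0 : ℝ),
      ∫⁻ y in Ioi 0, (Ioi y).indicator F s * ENNReal.ofReal (y ^ (k - 1)) =
        ENNReal.ofReal k⁻¹ * (f s ^ p * ENNReal.ofReal (s ^ ((k + 1) * p - 1))) := by
    intro s hs
    have hs0 : 0 < s := hs
    have : ∀ y, (Ioi y).indicator F s * ENNReal.ofReal (y ^ (k - 1)) =
        F s * (Iio s).indicator (fun y ↦ ENNReal.ofReal (y ^ (k - 1))) y := by
      intro y
      by_cases h : y < s <;> simp [indicator, h]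
    simp only [this]
    rw [lintegral_const_mul _ (Measurable.indicator (by fun_prop) measurableSet_Iio),
      setLIntegral_indicator measurableSet_Iio, inter_comm, Ioi_inter_Iio,
      lintegral_Ioo_zero_rpow_sub_one hk hs0, div_eq_inv_mul,
      ENNReal.ofReal_mul (by positivity), mul_left_comm, hF, mul_assoc,
      ← ENNReal.ofReal_mul (by positivity), ← Real.rpow_add hs0]
    ring_nf
  rw [setLIntegral_congr_fun measurableSet_Ioi hinner, lintegral_const_mul' _ _ ofReal_ne_top,
    ← mul_assoc]
  refine mul_le_mul_left (le_of_eq ?_) _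
  have hk' : ENNReal.ofReal k⁻¹ ≠ 0 := by simpa using hk
  simpa using (ENNReal.rpow_add (p - 1) 1 hk' ofReal_ne_top).symm

/-- A function in a weighted `L^p` space near infinity is dominated by the tail integral of its
derivative. -/
theorem ofReal_abs_le_lintegral_Ioi_deriv {v v' : ℝ → ℝ} {p γ y : ℝ} (hp : 0 ≤ p) (hγ : -1 ≤ γ)
    (hy : 0 < y) (hv : ∀ z ∈ Ici y, HasDerivAt v (v' z) z) (hv' : Measurable v')
    (h_int : ∫⁻ z in Ioi y, ENNReal.ofReal (|v z| ^ p * z ^ γ) ≠ ∞) :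
    ENNReal.ofReal |v y| ≤ ∫⁻ s in Ioi y, ENNReal.ofReal |v' s| := by
  by_contra! hlt
  have hI : IntegrableOn v' (Ioi y) := by
    refine ⟨hv'.aestronglyMeasurable, ?_⟩
    simp only [HasFiniteIntegral, Real.enorm_eq_ofReal_abs]
    exact hlt.trans_le le_top
  have hIabs : ∫⁻ s in Ioi y, ENNReal.ofReal |v' s| = ENNReal.ofReal (∫ s in Ioi y, |v' s|) :=
    (ofReal_integral_eq_lintegral_ofReal hI.abs (ae_of_all _ fun _ ↦ abs_nonneg _)).symm
  rw [hIabs] at hlt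
  have hlt' : ∫ s in Ioi y, |v' s| < |v y| := lt_of_not_ge fun h ↦
    hlt.not_ge (ENNReal.ofReal_le_ofReal h)
  set c := |v y| - ∫ s in Ioi y, |v' s| with hc
  have hc0 : 0 < c := sub_pos.2 hlt'
  have hlow : ∀ z ∈ Ioi y, c ≤ |v z| := by
    intro z hz
    have hyz : y ≤ z := le_of_lt hz
    have hIz : IntegrableOn v' (Ioc y z) := hI.mono_set Ioc_subset_Ioi_self
    have hftc := intervalIntegral.integral_eq_sub_of_hasDerivAt (a := y) (b := z) (f := v)
      (f' := v') (fun x hx ↦ hv x (by rw [uIcc_of_le hyz] at hx; exact hx.1))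
      ((intervalIntegrable_iff_integrableOn_Ioc_of_le hyz).2 hIz)
    rw [intervalIntegral.integral_of_le hyz] at hftc
    have hle : |v z - v y| ≤ ∫ s in Ioi y, |v' s| := by
      rw [← hftc]
      exact (abs_integral_le_integral_abs).trans (setIntegral_mono_set hI.abs
        (ae_of_all _ fun _ ↦ abs_nonneg _) Ioc_subset_Ioi_self.eventuallyLE)
    have := abs_sub_abs_le_abs_sub (v y) (v z)
    rw [abs_sub_comm] at this
    linarith
  have hfin : ∫⁻ z in Ioi y, ENNReal.ofReal (c ^ p * z ^ γ) < ∞ := by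
    refine (setLIntegral_mono' measurableSet_Ioi fun z hz ↦ ?_).trans_lt h_int.lt_top
    have hz0 : 0 < z := hy.trans hz
    have := hlow z hz
    gcongr
  have hcont : IntegrableOn (fun z : ℝ ↦ c ^ p * z ^ γ) (Ioi y) := by
    refine ⟨(by fun_prop : Measurable fun z : ℝ ↦ c ^ p * z ^ γ).aestronglyMeasurable, ?_⟩
    rw [hasFiniteIntegral_iff_ofReal]
    · exact hfin
    · filter_upwards [ae_restrict_mem measurableSet_Ioi] with z hz
      have hz0 : 0 < z := hy.trans hz
      simp only [Pi.zero_apply]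
      positivity
  have hcp : c ^ p ≠ 0 := (Real.rpow_pos_of_pos hc0 p).ne'
  have : IntegrableOn (fun z : ℝ ↦ z ^ γ) (Ioi y) := by
    simpa [IntegrableOn, integrable_const_mul_iff hcp.isUnit] using hcont
  rw [integrableOn_Ioi_rpow_iff hy] at this
  linarith

/-- One-dimensional Hardy inequality for the operator `d/dy + α / y` with a power weight. -/
theorem lintegral_abs_div_rpow_le {p α β : ℝ} (hp : 1 ≤ p) (hβ : (1 + α) * p - 1 < β) {u : ℝ → ℝ}
    (hu : ∀ y ∈ Ioi (0 : ℝ), DifferentiableAt ℝ u y) (hum : Measurable u)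
    (h_int : ∫⁻ y in Ioi (0 : ℝ), ENNReal.ofReal (|u y| ^ p * y ^ β) ≠ ∞) :
    ∫⁻ y in Ioi (0 : ℝ), ENNReal.ofReal (|u y / y| ^ p * y ^ β) ≤
      ENNReal.ofReal (((β - α * p + 1) / p - 1)⁻¹) ^ p *
        ∫⁻ y in Ioi (0 : ℝ), ENNReal.ofReal (|deriv u y + α / y * u y| ^ p * y ^ β) := by
  have hp0 : 0 < p := by linarith
  set k := (β - α * p + 1) / p - 1 with hkdef
  have hkp : k * p = β - α * p + 1 - p := by rw [hkdef]; field_simp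
  have hk : 0 < k := by
    refine pos_of_mul_pos_left (b := p) ?_ hp0.le
    rw [hkp]
    linarith
  set v' : ℝ → ℝ := fun y ↦ y ^ α * (deriv u y + α / y * u y) with hv'
  have hv'm : Measurable v' := by
    have := measurable_deriv u
    fun_prop
  have hderiv : ∀ y ∈ Ioi (0 : ℝ), HasDerivAt (fun y ↦ y ^ α * u y) (v' y) y := by
    intro y hy
    have hy0 : 0 < y := hy
    refine ((Real.hasDerivAt_rpow_const (Or.inl hy0.ne')).mul (hu y hy).hasDerivAt).congr_deriv ?_
    rw [hv', Real.rpow_sub_one hy0.ne']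
    field_simp
    ring
  have habs : ∀ {y : ℝ} (_ : 0 < y) (a q : ℝ),
      |y ^ α * a| ^ p * y ^ q = |a| ^ p * y ^ (α * p + q) := by
    intro y hy a q
    rw [abs_mul, abs_of_pos (Real.rpow_pos_of_pos hy α), Real.mul_rpow (by positivity)
      (abs_nonneg _), ← Real.rpow_mul hy.le, Real.rpow_add hy]
    ring
  have hbound : ∀ y ∈ Ioi (0 : ℝ),
      ENNReal.ofReal |y ^ α * u y| ≤ ∫⁻ s in Ioi y, ENNReal.ofReal |v' s| := by
    intro y hy
    refine ofReal_abs_le_lintegral_Ioi_deriv (v := fun y ↦ y ^ α * u y) hp0.le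
      (γ := β - α * p) (by linarith) hy (fun z hz ↦ hderiv z (lt_of_lt_of_le (mem_Ioi.1 hy) hz)) hv'm ?_
    refine ne_top_of_le_ne_top h_int (le_trans (le_of_eq ?_)
      (lintegral_mono_set (Ioi_subset_Ioi (le_of_lt hy))))
    refine setLIntegral_congr_fun measurableSet_Ioi fun z hz ↦ ?_
    simp only [habs (lt_trans hy hz), add_sub_cancel]
  have hleft : ∀ y ∈ Ioi (0 : ℝ), ENNReal.ofReal (|u y / y| ^ p * y ^ β) ≤
      (∫⁻ s in Ioi y, ENNReal.ofReal |v' s|) ^ p * ENNReal.ofReal (y ^ (k * p - 1)) := by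
    intro y hy
    have hy0 : 0 < y := hy
    refine le_trans (le_of_eq ?_)
      (mul_le_mul_left (ENNReal.rpow_le_rpow (hbound y hy) hp0.le) _)
    rw [ENNReal.ofReal_rpow_of_nonneg (abs_nonneg _) hp0.le, ← ENNReal.ofReal_mul (by positivity),
      habs hy0, hkp, abs_div, abs_of_pos hy0, Real.div_rpow (abs_nonneg _) hy0.le,
      show α * p + (β - α * p + 1 - p - 1) = β - p by ring, Real.rpow_sub hy0]
    congr 1
    ring
  refine (setLIntegral_mono' measurableSet_Ioi hleft).trans
    ((lintegral_rpow_lintegral_Ioi_le (by fun_prop) hk hp).trans_eq ?_)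
  congr 1
  refine setLIntegral_congr_fun measurableSet_Ioi fun y hy ↦ ?_
  have hy0 : 0 < y := hy
  rw [ENNReal.ofReal_rpow_of_nonneg (abs_nonneg _) hp0.le, ← ENNReal.ofReal_mul (by positivity),
    habs hy0, add_mul, hkp]
  ring_nf

/-- Hardy's inequality in the regime `β > (1+α)p − 1` (no boundary condition needed). -/
theorem hardy_inequality_above (d : ℕ) (hd : 2 ≤ d) (p α β : ℝ) (hp : 1 ≤ p)
    (hβ : (1 + α) * p - 1 < β)
    (u : (Fin (d - 1) → ℝ) → ℝ → ℝ)
    (hu_meas : Measurable (Function.uncurry u))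
    (hu_diff : ∀ x' : Fin (d - 1) → ℝ, ∀ y ∈ Ioi (0 : ℝ), DifferentiableAt ℝ (u x') y)
    (hu_int : (∫⁻ x' : Fin (d - 1) → ℝ, ∫⁻ y in Ioi (0 : ℝ),
        ENNReal.ofReal (|u x' y| ^ p * y ^ β)) < ⊤)
    (hg_int : (∫⁻ x' : Fin (d - 1) → ℝ, ∫⁻ y in Ioi (0 : ℝ),
        ENNReal.ofReal (|deriv (u x') y + α / y * u x' y| ^ p * y ^ β)) < ⊤) :
    (∫⁻ x' : Fin (d - 1) → ℝ, ∫⁻ y in Ioi (0 : ℝ),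
        ENNReal.ofReal (|u x' y / y| ^ p * y ^ β)) < ⊤ ∧
    (∫⁻ x' : Fin (d - 1) → ℝ, ∫⁻ y in Ioi (0 : ℝ),
        ENNReal.ofReal (|u x' y / y| ^ p * y ^ β)) ^ (1 / p)
      ≤ ENNReal.ofReal (((β - α * p + 1) / p - 1)⁻¹) *
        (∫⁻ x' : Fin (d - 1) → ℝ, ∫⁻ y in Ioi (0 : ℝ),
            ENNReal.ofReal (|deriv (u x') y + α / y * u x' y| ^ p * y ^ β)) ^ (1 / p) := by
  have hp0 : 0 < p := by linarith
  have hfin : ∀ᵐ x' : Fin (d - 1) → ℝ,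
      ∫⁻ y in Ioi (0 : ℝ), ENNReal.ofReal (|u x' y| ^ p * y ^ β) < ∞ := by
    refine ae_lt_top (Measurable.lintegral_prod_right'
      (f := fun z : (Fin (d - 1) → ℝ) × ℝ ↦ ENNReal.ofReal (|u z.1 z.2| ^ p * z.2 ^ β)) ?_)
      hu_int.ne
    have : Measurable fun z : (Fin (d - 1) → ℝ) × ℝ ↦ |u z.1 z.2| := hu_meas.abs
    fun_prop
  have hmain := lintegral_mono_ae (hfin.mono fun x' hx' ↦
    lintegral_abs_div_rpow_le hp hβ (hu_diff x') (hu_meas.of_uncurry_left) hx'.ne)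
  have hC : ENNReal.ofReal (((β - α * p + 1) / p - 1)⁻¹) ^ p ≠ ∞ :=
    ENNReal.rpow_ne_top_of_nonneg hp0.le ofReal_ne_top
  rw [lintegral_const_mul' _ _ hC] at hmain
  refine ⟨hmain.trans_lt (ENNReal.mul_lt_top hC.lt_top hg_int), ?_⟩
  refine (ENNReal.rpow_le_rpow hmain (by positivity)).trans_eq ?_
  rw [ENNReal.mul_rpow_of_nonneg _ _ (by positivity), ← ENNReal.rpow_mul,
    mul_one_div_cancel hp0.ne', ENNReal.rpow_one]
end

section
/- Let d ≥ 2, p ∈ [1,∞), α ∈ ℝ and β ∈ ℝ with β < (1+α)p − 1. Let u : ℝ^{d-1} × (0,∞) → ℝ be measurable such that for every x' ∈ ℝ^{d-1} the map x_d ↦ u(x', x_d) is differentiable on (0,∞), and set g(x', x_d) = ∂_{x_d} u(x', x_d) + (α/x_d) u(x', x_d). Assume ∫_{ℝ^d_+} |u(x)|^p x_d^β dx < ∞, ∫_{ℝ^d_+} |g(x)|^p x_d^β dx < ∞, and that for almost every x' ∈ ℝ^{d-1} one has lim_{x_d → 0⁺} x_d^α u(x', x_d) = 0. Then ∫_{ℝ^d_+}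 |u(x)/x_d|^p x_d^β dx < ∞, and (∫_{ℝ^d_+} |u(x)/x_d|^p x_d^β dx)^{1/p} ≤ (1 − (β − αp + 1)/p)^{−1} (∫_{ℝ^d_+} |g(x)|^p x_d^β dx)^{1/p}. -/
open MeasureTheory Set ENNReal Filter

theorem lintegral_Ioo_zero_ofReal_rpow {r y : ℝ} (hr : -1 < r) (hy : 0 < y) :
    ∫⁻ t in Ioo 0 y, ENNReal.ofReal (t ^ r) = ENNReal.ofReal (y ^ (r + 1) / (r + 1)) := by
  have hint : IntegrableOn (fun t : ℝ => t ^ r) (Ioo 0 y) :=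
    ((intervalIntegrable_iff_integrableOn_Ioo_of_le hy.le).1
      (intervalIntegral.intervalIntegrable_rpow' hr))
  rw [← ofReal_integral_eq_lintegral_ofReal hint
    ((ae_restrict_mem measurableSet_Ioo).mono fun t ht => Real.rpow_nonneg ht.1.le r),
    ← integral_Ioc_eq_integral_Ioo, ← intervalIntegral.integral_of_le hy.le,
    integral_rpow (Or.inl hr), Real.zero_rpow (by linarith), sub_zero]

theorem lintegral_Ioi_ofReal_rpow {a t : ℝ} (ha : a < -1) (ht : 0 < t) :
    ∫⁻ y in Ioi t, ENNReal.ofReal (y ^ a) = ENNReal.ofReal (t ^ (a + 1) / -(a + 1)) := by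
  rw [← ofReal_integral_eq_lintegral_ofReal (integrableOn_Ioi_rpow_of_lt ha ht)
    ((ae_restrict_mem measurableSet_Ioi).mono fun y hy => Real.rpow_nonneg (ht.trans hy).le a),
    integral_Ioi_rpow_of_lt ha ht, neg_div, div_neg]

theorem lintegral_rpow_le_weighted {X : Type*} [MeasurableSpace X] {μ : Measure X} {p : ℝ}
    (hp : 1 ≤ p) {w h : X → ℝ≥0∞} (hw : Measurable w) (hh : Measurable h)
    (hw0 : ∀ᵐ x ∂μ, w x ≠ 0) (hwt : ∀ᵐ x ∂μ, w x ≠ ∞) :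
    (∫⁻ x, h x ∂μ) ^ p ≤ (∫⁻ x, w x ∂μ) ^ (p - 1) * ∫⁻ x, h x ^ p * w x ^ (1 - p) ∂μ := by
  have hp0 : 0 < p := by linarith
  have hq : Measurable fun x => h x / w x := hh.div hw
  have key := eLpNorm'_le_eLpNorm'_mul_rpow_measure_univ (μ := μ.withDensity w)
    (f := fun x => h x / w x) one_pos hp hq.aestronglyMeasurable
  simp only [eLpNorm', enorm_eq_self, ENNReal.rpow_one, div_one, one_div] at key
  rw [lintegral_withDensity_eq_lintegral_mul _ hw hq,
    lintegral_withDensity_eq_lintegral_mul _ hw (hq.pow_const p),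
    withDensity_apply _ MeasurableSet.univ, Measure.restrict_univ] at key
  have h1 : ∫⁻ x, (w * fun x => h x / w x) x ∂μ = ∫⁻ x, h x ∂μ := by
    refine lintegral_congr_ae ?_
    filter_upwards [hw0, hwt] with x h0 ht
    exact ENNReal.mul_div_cancel h0 ht
  have h2 : ∫⁻ x, (w * fun x => (h x / w x) ^ p) x ∂μ = ∫⁻ x, h x ^ p * w x ^ (1 - p) ∂μ := by
    refine lintegral_congr_ae ?_
    filter_upwards [hw0, hwt] with x h0 ht
    simp only [Pi.mul_apply]
    rw [ENNReal.div_rpow_of_nonneg _ _ hp0.le, ENNReal.rpow_sub _ _ h0 ht, ENNReal.rpow_one,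
      div_eq_mul_inv, div_eq_mul_inv]
    ring
  rw [h1, h2] at key
  calc _ ≤ _ := ENNReal.rpow_le_rpow key hp0.le
    _ = _ := by
      rw [ENNReal.mul_rpow_of_nonneg _ _ hp0.le, ← ENNReal.rpow_mul, ← ENNReal.rpow_mul,
        inv_mul_cancel₀ hp0.ne', ENNReal.rpow_one, mul_comm, sub_mul, one_mul,
        inv_mul_cancel₀ hp0.ne']

theorem lintegral_hardy {p γ : ℝ} (hp : 1 ≤ p) (hγ : γ + 1 < p) {h : ℝ → ℝ≥0∞}
    (hh : Measurable h) :
    ∫⁻ y in Ioi (0 : ℝ), (∫⁻ t in Ioo 0 y, h t) ^ p * ENNReal.ofReal (y ^ (γ - p)) ≤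
      ENNReal.ofReal ((1 - (γ + 1) / p)⁻¹) ^ p *
        ∫⁻ y in Ioi (0 : ℝ), h y ^ p * ENNReal.ofReal (y ^ γ) := by
  have hp0 : 0 < p := by linarith
  obtain ⟨c, hc⟩ : ∃ c, c = (γ + 1) / p := ⟨_, rfl⟩
  have hcp : c * p = γ + 1 := by rw [hc]; field_simp
  have hc1 : 0 < 1 - c := by rw [hc, sub_pos, div_lt_one hp0]; exact hγ
  rw [← hc]
  set C : ℝ := (1 - c)⁻¹ with hC
  have hC0 : 0 < C := inv_pos.2 hc1
  set K : ℝ → ℝ≥0∞ := fun t => h t ^ p * ENNReal.ofReal (t ^ (c * (p - 1))) with hK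
  have hKm : Measurable K := by fun_prop
  have inner : ∀ y ∈ Ioi (0 : ℝ), (∫⁻ t in Ioo 0 y, h t) ^ p * ENNReal.ofReal (y ^ (γ - p)) ≤
      ENNReal.ofReal C ^ (p - 1) *
        ∫⁻ t in Ioi (0 : ℝ), (Ioi t).indicator (fun y => ENNReal.ofReal (y ^ (c - 2))) y * K t := by
    intro y hy
    have hy0 : 0 < y := hy
    have hmem : ∀ᵐ t ∂(volume.restrict (Ioo 0 y)), t ∈ Ioo 0 y := ae_restrict_mem measurableSet_Ioo
    have h1 := lintegral_rpow_le_weighted (μ := volume.restrict (Ioo 0 y)) hp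
      (w := fun t => ENNReal.ofReal (t ^ (-c))) (by fun_prop) hh
      (hmem.mono fun t ht => by simpa using Real.rpow_pos_of_pos ht.1 _)
      (ae_of_all _ fun t => ENNReal.ofReal_ne_top)
    have h2 : ∫⁻ t in Ioo 0 y, h t ^ p * ENNReal.ofReal (t ^ (-c)) ^ (1 - p) =
        ∫⁻ t in Ioo 0 y, K t := by
      refine setLIntegral_congr_fun measurableSet_Ioo fun t ht => ?_
      simp only [hK]
      rw [ENNReal.ofReal_rpow_of_pos (Real.rpow_pos_of_pos ht.1 _), ← Real.rpow_mul ht.1.le]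
      congr 3; ring
    rw [h2, lintegral_Ioo_zero_ofReal_rpow (by linarith) hy0] at h1
    have h3 : ∫⁻ t in Ioi (0 : ℝ), (Ioi t).indicator (fun y => ENNReal.ofReal (y ^ (c - 2))) y * K t
        = ENNReal.ofReal (y ^ (c - 2)) * ∫⁻ t in Ioo 0 y, K t := by
      have : Ioo 0 y = Iio y ∩ Ioi 0 := by ext t; simp [and_comm]
      rw [← lintegral_const_mul _ hKm, this, ← Measure.restrict_restrict measurableSet_Iio,
        ← lintegral_indicator measurableSet_Iio]
      refine lintegral_congr fun t => ?_
      by_cases hty : t < y <;> simp [indicator, hty]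
    rw [h3]
    calc _ ≤ _ := mul_le_mul_left h1 _
      _ = (ENNReal.ofReal (y ^ (-c + 1) / (-c + 1)) ^ (p - 1) * ENNReal.ofReal (y ^ (γ - p))) *
          ∫⁻ t in Ioo 0 y, K t := by ring
      _ = (ENNReal.ofReal C ^ (p - 1) * ENNReal.ofReal (y ^ (c - 2))) *
          ∫⁻ t in Ioo 0 y, K t := by
        congr 1
        rw [show -c + 1 = 1 - c by ring,
          ENNReal.ofReal_rpow_of_nonneg (by positivity) (by linarith),
          ENNReal.ofReal_rpow_of_nonneg hC0.le (by linarith), ← ENNReal.ofReal_mul (by positivity),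
          ← ENNReal.ofReal_mul (by positivity), div_eq_mul_inv, ← hC,
          Real.mul_rpow (by positivity) hC0.le, ← Real.rpow_mul hy0.le,
          mul_right_comm, ← Real.rpow_add hy0, mul_comm]
        congr 3
        linear_combination -hcp
      _ = _ := by ring
  have swap : ∫⁻ y in Ioi (0 : ℝ), ∫⁻ t in Ioi (0 : ℝ),
        (Ioi t).indicator (fun y => ENNReal.ofReal (y ^ (c - 2))) y * K t =
      ENNReal.ofReal C * ∫⁻ t in Ioi (0 : ℝ), h t ^ p * ENNReal.ofReal (t ^ γ) := by
    rw [lintegral_lintegral_swap, ← lintegral_const_mul _ (by fun_prop)]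
    · refine setLIntegral_congr_fun measurableSet_Ioi fun t ht => ?_
      have ht0 : 0 < t := ht
      simp only [hK]
      rw [lintegral_mul_const _ (Measurable.indicator (by fun_prop) measurableSet_Ioi),
        lintegral_indicator measurableSet_Ioi, Measure.restrict_restrict measurableSet_Ioi,
        inter_eq_left.2 (Ioi_subset_Ioi ht0.le), lintegral_Ioi_ofReal_rpow (by linarith) ht0,
        show -(c - 2 + 1) = 1 - c by ring, div_eq_mul_inv, ← hC,
        mul_left_comm, mul_left_comm (ENNReal.ofReal C), ← ENNReal.ofReal_mul (by positivity),
        ← ENNReal.ofReal_mul hC0.le,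
        mul_right_comm, ← Real.rpow_add ht0, mul_comm C]
      congr 4
      linear_combination hcp
    · refine Measurable.aemeasurable ?_
      have : (Function.uncurry fun y t : ℝ =>
          (Ioi t).indicator (fun y => ENNReal.ofReal (y ^ (c - 2))) y * K t) =
          fun z : ℝ × ℝ => {z : ℝ × ℝ | z.2 < z.1}.indicator
            (fun z => ENNReal.ofReal (z.1 ^ (c - 2))) z * K z.2 := by
        ext z; simp [Function.uncurry, indicator]
      rw [this]
      exact (Measurable.indicator (by fun_prop)
        (measurableSet_lt measurable_snd measurable_fst)).mul (hKm.comp measurable_snd)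
  calc _ ≤ _ := setLIntegral_mono' measurableSet_Ioi inner
    _ = _ := by
      rw [lintegral_const_mul' _ _ (by finiteness), swap, ← mul_assoc]
      congr 1
      nth_rewrite 2 [← ENNReal.rpow_one (ENNReal.ofReal C)]
      rw [← ENNReal.rpow_add _ _ (by simpa using hC0) ENNReal.ofReal_ne_top, sub_add_cancel]

theorem enorm_le_lintegral_enorm_of_tendsto_zero {f f' : ℝ → ℝ}
    (hf : ∀ y ∈ Ioi (0 : ℝ), HasDerivAt f (f' y) y)
    (hm : Measurable f') (h0 : Tendsto f (nhdsWithin 0 (Ioi 0)) (nhds 0)) {y : ℝ} (hy : 0 < y) :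
    ‖f y‖ₑ ≤ ∫⁻ t in Ioo 0 y, ‖f' t‖ₑ := by
  rcases eq_or_ne (∫⁻ t in Ioo 0 y, ‖f' t‖ₑ) ∞ with h | h
  · rw [h]; exact le_top
  have hint : IntervalIntegrable f' volume 0 y :=
    (intervalIntegrable_iff_integrableOn_Ioo_of_le hy.le).2
      ⟨hm.aestronglyMeasurable, h.lt_top⟩
  have := intervalIntegral.integral_eq_sub_of_hasDerivAt_of_tendsto hy
    (fun x hx => hf x hx.1) hint h0 ((hf y hy).continuousAt.tendsto.mono_left nhdsWithin_le_nhds)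
  rw [sub_zero, intervalIntegral.integral_of_le hy.le, integral_Ioc_eq_integral_Ioo] at this
  rw [← this]
  exact enorm_integral_le_lintegral_enorm _

theorem lintegral_hardy_of_tendsto_zero {p α β : ℝ} (hp : 1 ≤ p) (hβ : β < (1 + α) * p - 1)
    {f : ℝ → ℝ} (hm : Measurable f) (hf : ∀ y ∈ Ioi (0 : ℝ), DifferentiableAt ℝ f y)
    (h0 : Tendsto (fun y => y ^ α * f y) (nhdsWithin 0 (Ioi 0)) (nhds 0)) :
    ∫⁻ y in Ioi (0 : ℝ), ENNReal.ofReal (|f y / y| ^ p * y ^ β) ≤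
      ENNReal.ofReal ((1 - (β - α * p + 1) / p)⁻¹) ^ p *
        ∫⁻ y in Ioi (0 : ℝ), ENNReal.ofReal (|deriv f y + α / y * f y| ^ p * y ^ β) := by
  have hp0 : 0 < p := by linarith
  set w' : ℝ → ℝ := fun y => y ^ α * (deriv f y + α / y * f y) with hw'
  have hw'm : Measurable w' := by
    have := measurable_deriv f
    fun_prop
  have hd : ∀ y ∈ Ioi (0 : ℝ), HasDerivAt (fun y => y ^ α * f y) (w' y) y := by
    intro y hy
    have hy0 : 0 < y := hy
    refine ((Real.hasDerivAt_rpow_const (p := α) (Or.inl hy0.ne')).mul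
      (hf y hy).hasDerivAt).congr_deriv ?_
    rw [hw', Real.rpow_sub_one hy0.ne']
    ring
  have conv : ∀ {a y : ℝ} (s : ℝ), 0 < y → ‖y ^ α * a‖ₑ ^ p * ENNReal.ofReal (y ^ s) =
      ENNReal.ofReal (|a| ^ p * y ^ (s + α * p)) := by
    intro a y s hy
    rw [Real.enorm_eq_ofReal_abs, ENNReal.ofReal_rpow_of_nonneg (abs_nonneg _) hp0.le,
      ← ENNReal.ofReal_mul (by positivity), abs_mul, abs_of_pos (Real.rpow_pos_of_pos hy α),
      Real.mul_rpow (by positivity) (abs_nonneg _), ← Real.rpow_mul hy.le, Real.rpow_add hy]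
    congr 1; ring
  calc _ ≤ ∫⁻ y in Ioi (0 : ℝ), (∫⁻ t in Ioo 0 y, ‖w' t‖ₑ) ^ p *
        ENNReal.ofReal (y ^ (β - α * p - p)) := by
        refine setLIntegral_mono' measurableSet_Ioi fun y hy => ?_
        have hy0 : 0 < y := hy
        have e : |f y / y| ^ p * y ^ β = |f y| ^ p * y ^ (β - α * p - p + α * p) := by
          rw [abs_div, abs_of_pos hy0, Real.div_rpow (abs_nonneg _) hy0.le,
            show β - α * p - p + α * p = β - p by ring, Real.rpow_sub hy0]
          ring
        rw [e, ← conv _ hy0]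
        gcongr
        exact enorm_le_lintegral_enorm_of_tendsto_zero hd hw'm h0 hy0
    _ ≤ _ := lintegral_hardy hp (by linarith) hw'm.enorm
    _ = _ := by
        congr 1
        refine setLIntegral_congr_fun measurableSet_Ioi fun y hy => ?_
        simp only [hw']
        rw [conv _ hy, sub_add_cancel]

/-- Hardy's inequality in the regime `β < (1+α)p − 1`, under the vanishing-boundary
condition on `x_d^α u`. -/
theorem hardy_inequality_below (d : ℕ) (hd : 2 ≤ d) (p α β : ℝ) (hp : 1 ≤ p)
    (hβ : β < (1 + α) * p - 1)
    (u : (Fin (d - 1) → ℝ) → ℝ → ℝ)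
    (hu_meas : Measurable (Function.uncurry u))
    (hu_diff : ∀ x' : Fin (d - 1) → ℝ, ∀ y ∈ Ioi (0 : ℝ), DifferentiableAt ℝ (u x') y)
    (hu_int : (∫⁻ x' : Fin (d - 1) → ℝ, ∫⁻ y in Ioi (0 : ℝ),
        ENNReal.ofReal (|u x' y| ^ p * y ^ β)) < ⊤)
    (hg_int : (∫⁻ x' : Fin (d - 1) → ℝ, ∫⁻ y in Ioi (0 : ℝ),
        ENNReal.ofReal (|deriv (u x') y + α / y * u x' y| ^ p * y ^ β)) < ⊤)
    (hbc : ∀ᵐ x' : Fin (d - 1) → ℝ,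
        Tendsto (fun y => y ^ α * u x' y) (nhdsWithin 0 (Ioi 0)) (nhds 0)) :
    (∫⁻ x' : Fin (d - 1) → ℝ, ∫⁻ y in Ioi (0 : ℝ),
        ENNReal.ofReal (|u x' y / y| ^ p * y ^ β)) < ⊤ ∧
    (∫⁻ x' : Fin (d - 1) → ℝ, ∫⁻ y in Ioi (0 : ℝ),
        ENNReal.ofReal (|u x' y / y| ^ p * y ^ β)) ^ (1 / p)
      ≤ ENNReal.ofReal ((1 - (β - α * p + 1) / p)⁻¹) *
        (∫⁻ x' : Fin (d - 1) → ℝ, ∫⁻ y in Ioi (0 : ℝ),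
            ENNReal.ofReal (|deriv (u x') y + α / y * u x' y| ^ p * y ^ β)) ^ (1 / p) := by
  have hp0 : 0 < p := by linarith
  have hC : 0 ≤ (1 - (β - α * p + 1) / p)⁻¹ := by
    rw [inv_nonneg, sub_nonneg, div_le_one hp0]
    linarith
  have key := calc
    (∫⁻ x' : Fin (d - 1) → ℝ, ∫⁻ y in Ioi (0 : ℝ), ENNReal.ofReal (|u x' y / y| ^ p * y ^ β)) ≤ _ :=
        lintegral_mono_ae (hbc.mono fun x' hx' => lintegral_hardy_of_tendsto_zero hp hβ
          (hu_meas.comp measurable_prodMk_left) (hu_diff x') hx')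
    _ = _ := lintegral_const_mul' _ _ (ENNReal.rpow_ne_top_of_nonneg hp0.le ENNReal.ofReal_ne_top)
  refine ⟨key.trans_lt (ENNReal.mul_lt_top
    (ENNReal.rpow_lt_top_of_nonneg hp0.le ENNReal.ofReal_ne_top) hg_int), ?_⟩
  calc _ ≤ _ := ENNReal.rpow_le_rpow key (one_div_nonneg.2 hp0.le)
    _ = _ := by
      rw [ENNReal.mul_rpow_of_nonneg _ _ (one_div_nonneg.2 hp0.le), ← ENNReal.rpow_mul,
        mul_one_div_cancel hp0.ne', ENNReal.rpow_one]
end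

section
/- Let d ≥ 2, p ∈ [1,∞), α ∈ ℝ and β ∈ ℝ with β ≤ αp − 1. Let u : ℝ^{d-1} × (0,∞) → ℝ be measurable such that for every x' ∈ ℝ^{d-1} the map x_d ↦ u(x', x_d) is differentiable on (0,∞), and set g(x', x_d) = ∂_{x_d} u(x', x_d) + (α/x_d) u(x', x_d). If ∫_{ℝ^d_+} |u(x)|^p x_d^β dx < ∞ and ∫_{ℝ^d_+} |g(x)|^p x_d^β dx < ∞, then for almost every x' ∈ ℝ^{d-1} one has lim_{x_d → 0⁺} x_d^α u(x', x_d) = 0. -/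
open MeasureTheory Set ENNReal Filter

/-- A measurable function dominated on `s` by a function with finite lower integral on `t ⊇ s` is
integrable on `s`. -/
lemma integrableOn_of_abs_le_of_lintegral_lt_top {s t : Set ℝ} {f h : ℝ → ℝ}
    (hs : MeasurableSet s) (hst : s ⊆ t) (hf : Measurable f)
    (hle : ∀ y ∈ s, |f y| ≤ h y)
    (hh : (∫⁻ y in t, ENNReal.ofReal (h y)) < ⊤) : IntegrableOn f s := by
  refine ⟨hf.aestronglyMeasurable, ?_⟩
  rw [hasFiniteIntegral_iff_norm]
  calc (∫⁻ y in s, ENNReal.ofReal ‖f y‖) ≤ ∫⁻ y in s, ENNReal.ofReal (h y) :=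
        setLIntegral_mono' hs fun y hy => ENNReal.ofReal_le_ofReal (hle y hy)
    _ ≤ ∫⁻ y in t, ENNReal.ofReal (h y) := lintegral_mono_set hst
    _ < ⊤ := hh

/-- If `f` is differentiable on `(0, ∞)` and `|f'|` is integrable near `0`, then `f` has a limit at
`0` from the right. -/
lemma exists_tendsto_nhdsGT_zero_of_integrableOn_deriv {f : ℝ → ℝ}
    (hf : ∀ y, 0 < y → DifferentiableAt ℝ f y) (hint : IntegrableOn (deriv f) (Ioc 0 1)) :
    ∃ L, Tendsto f (nhdsWithin 0 (Ioi 0)) (nhds L) := by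
  have hcont : ContinuousOn (fun y => ∫ t in y..1, deriv f t) (uIcc 0 1) := by
    apply intervalIntegral.continuousOn_primitive_interval_left
    rw [uIcc_of_le zero_le_one, integrableOn_Icc_iff_integrableOn_Ioc]
    exact hint
  have hlim : Tendsto (fun y => f 1 - ∫ t in y..1, deriv f t) (nhdsWithin 0 (Ioc 0 1))
      (nhds (f 1 - ∫ t in (0 : ℝ)..1, deriv f t)) := by
    refine tendsto_const_nhds.sub ((hcont 0 left_mem_uIcc).mono ?_)
    rw [uIcc_of_le zero_le_one]
    exact Ioc_subset_Icc_self
  rw [nhdsWithin_Ioc_eq_nhdsGT zero_lt_one] at hlim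
  refine ⟨_, hlim.congr' ?_⟩
  filter_upwards [Ioc_mem_nhdsGT (zero_lt_one' ℝ)] with y hy
  rw [intervalIntegral.integral_eq_sub_of_hasDerivAt (f := f)]
  · ring
  · intro t ht
    rw [uIcc_of_le hy.2] at ht
    exact (hf t (hy.1.trans_le ht.1)).hasDerivAt
  · rw [intervalIntegrable_iff_integrableOn_Ioc_of_le hy.2]
    exact hint.mono_set (Ioc_subset_Ioc_left hy.1.le)

/-- A function on the half line that lies, with its derivative, in `L_p` with a weight `y ^ γ`,
`γ ≤ -1`, vanishes at the origin. -/
lemma tendsto_zero_of_weighted_lintegral_lt_top {p γ : ℝ} (hp : 1 ≤ p) (hγ : γ ≤ -1)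
    {f : ℝ → ℝ} (hf : ∀ y, 0 < y → DifferentiableAt ℝ f y)
    (hint : (∫⁻ y in Ioi (0 : ℝ), ENNReal.ofReal (|f y| ^ p * y ^ γ)) < ⊤)
    (hint' : (∫⁻ y in Ioi (0 : ℝ), ENNReal.ofReal (|deriv f y| ^ p * y ^ γ)) < ⊤) :
    Tendsto f (nhdsWithin 0 (Ioi 0)) (nhds 0) := by
  have hderiv : IntegrableOn (deriv f) (Ioc 0 1) := by
    refine integrableOn_of_abs_le_of_lintegral_lt_top (t := Ioc 0 1)
      (h := fun y => 1 + |deriv f y| ^ p * y ^ γ) measurableSet_Ioc Subset.rfl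
      (measurable_deriv f) (fun y hy => ?_) ?_
    · have hw : 1 ≤ y ^ γ := Real.one_le_rpow_of_pos_of_le_one_of_nonpos hy.1 hy.2 (by linarith)
      have hq : 0 ≤ |deriv f y| ^ p := by positivity
      rcases le_total |deriv f y| 1 with h | h
      · nlinarith
      · have := Real.self_le_rpow_of_one_le h hp
        nlinarith
    · calc (∫⁻ y in Ioc (0 : ℝ) 1, ENNReal.ofReal (1 + |deriv f y| ^ p * y ^ γ))
          ≤ ∫⁻ y in Ioc (0 : ℝ) 1, (1 + ENNReal.ofReal (|deriv f y| ^ p * y ^ γ)) :=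
            lintegral_mono fun y => by
              simpa using ENNReal.ofReal_add_le (p := 1) (q := |deriv f y| ^ p * y ^ γ)
        _ = (∫⁻ y in Ioc (0 : ℝ) 1, 1) +
              ∫⁻ y in Ioc (0 : ℝ) 1, ENNReal.ofReal (|deriv f y| ^ p * y ^ γ) :=
            lintegral_add_left measurable_const _
        _ < ⊤ := ENNReal.add_lt_top.2
            ⟨by simp, (lintegral_mono_set Ioc_subset_Ioi_self).trans_lt hint'⟩
  obtain ⟨L, hL⟩ := exists_tendsto_nhdsGT_zero_of_integrableOn_deriv hf hderiv
  suffices L = 0 by rwa [this] at hL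
  by_contra hne
  have hpos : 0 < |L| / 2 := by positivity
  have hev : ∀ᶠ y in nhdsWithin 0 (Ioi 0), |L| / 2 < |f y| :=
    hL.abs.eventually (lt_mem_nhds (half_lt_self (abs_pos.2 hne)))
  obtain ⟨δ, hδ, hsub⟩ := mem_nhdsGT_iff_exists_Ioc_subset.1
    (inter_mem hev (Ioc_mem_nhdsGT (zero_lt_one' ℝ)))
  have hδ0 : (0 : ℝ) < δ := hδ
  have hinv : IntegrableOn (fun y : ℝ => (|L| / 2) ^ p * y⁻¹) (Ioc 0 δ) := by
    refine integrableOn_of_abs_le_of_lintegral_lt_top measurableSet_Ioc Ioc_subset_Ioi_self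
      (by fun_prop) (fun y hy => ?_) hint
    obtain ⟨hy1, hy2, hy3⟩ := hsub hy
    have hw : y⁻¹ ≤ y ^ γ := by
      rw [← Real.rpow_neg_one]
      exact Real.rpow_le_rpow_of_exponent_ge hy2 hy3 hγ
    have hyi : 0 < y⁻¹ := inv_pos.2 hy2
    rw [abs_of_nonneg (by positivity)]
    have : (|L| / 2) ^ p ≤ |f y| ^ p :=
      Real.rpow_le_rpow hpos.le (le_of_lt hy1) (by linarith)
    gcongr
  have hinv' : IntegrableOn (fun y : ℝ => y⁻¹) (Ioc 0 δ) := by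
    have hc : (|L| / 2) ^ p ≠ 0 := (Real.rpow_pos_of_pos hpos p).ne'
    simpa [IntegrableOn, hc] using hinv.const_mul ((|L| / 2) ^ p)⁻¹
  rw [← intervalIntegrable_iff_integrableOn_Ioc_of_le hδ0.le, intervalIntegrable_inv_iff] at hinv'
  rcases hinv' with h | h
  · exact hδ0.ne h
  · exact h left_mem_uIcc

/-- The partial derivative in the last variable, restricted to the half space, of a jointly
measurable function is jointly measurable. -/
lemma measurable_indicator_deriv_snd {X : Type*} [MeasurableSpace X] {u : X → ℝ → ℝ}
    (hu : Measurable (Function.uncurry u))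
    (hd : ∀ x, ∀ y ∈ Ioi (0 : ℝ), DifferentiableAt ℝ (u x) y) :
    Measurable ({q : X × ℝ | 0 < q.2}.indicator fun q => deriv (u q.1) q.2) := by
  have hs : MeasurableSet {q : X × ℝ | 0 < q.2} := measurableSet_lt measurable_const measurable_snd
  have hr : Tendsto (fun n : ℕ => 1 / ((n : ℝ) + 1)) atTop (nhdsWithin 0 {0}ᶜ) :=
    tendsto_nhdsWithin_iff.2 ⟨tendsto_one_div_add_atTop_nhds_zero_nat,
      Eventually.of_forall fun n => (Nat.one_div_pos_of_nat (α := ℝ)).ne'⟩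
  refine measurable_of_tendsto_metrizable (f := fun n : ℕ => {q : X × ℝ | 0 < q.2}.indicator
    fun q => (1 / ((n : ℝ) + 1))⁻¹ • (u q.1 (q.2 + 1 / ((n : ℝ) + 1)) - u q.1 q.2)) (fun n => ?_)
    (tendsto_pi_nhds.2 fun q => ?_)
  · have hshift : Measurable fun q : X × ℝ => u q.1 (q.2 + 1 / ((n : ℝ) + 1)) :=
      hu.comp (measurable_fst.prodMk (measurable_snd.add_const _))
    have hu' : Measurable fun q : X × ℝ => u q.1 q.2 := hu
    refine Measurable.indicator ?_ hs
    fun_prop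
  · by_cases hq : 0 < q.2
    · simp only [indicator_of_mem (show q ∈ {q : X × ℝ | 0 < q.2} from hq)]
      exact (hasDerivAt_iff_tendsto_slope_zero.1 (hd q.1 q.2 hq).hasDerivAt).comp hr
    · simp only [indicator_of_notMem (show q ∉ {q : X × ℝ | 0 < q.2} from hq)]
      exact tendsto_const_nhds

/-- In the strongly weighted regime `β ≤ αp − 1`, the boundary vanishing of `x_d^α u`
is automatic. -/
theorem boundary_vanishing_automatic (d : ℕ) (hd : 2 ≤ d) (p α β : ℝ) (hp : 1 ≤ p)
    (hβ : β ≤ α * p - 1)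
    (u : (Fin (d - 1) → ℝ) → ℝ → ℝ)
    (hu_meas : Measurable (Function.uncurry u))
    (hu_diff : ∀ x' : Fin (d - 1) → ℝ, ∀ y ∈ Ioi (0 : ℝ), DifferentiableAt ℝ (u x') y)
    (hu_int : (∫⁻ x' : Fin (d - 1) → ℝ, ∫⁻ y in Ioi (0 : ℝ),
        ENNReal.ofReal (|u x' y| ^ p * y ^ β)) < ⊤)
    (hg_int : (∫⁻ x' : Fin (d - 1) → ℝ, ∫⁻ y in Ioi (0 : ℝ),
        ENNReal.ofReal (|deriv (u x') y + α / y * u x' y| ^ p * y ^ β)) < ⊤) :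
    ∀ᵐ x' : Fin (d - 1) → ℝ,
      Tendsto (fun y => y ^ α * u x' y) (nhdsWithin 0 (Ioi 0)) (nhds 0) := by
  have hu_fin : ∀ᵐ x' : Fin (d - 1) → ℝ,
      (∫⁻ y in Ioi (0 : ℝ), ENNReal.ofReal (|u x' y| ^ p * y ^ β)) < ⊤ := by
    refine ae_lt_top (Measurable.lintegral_prod_right' (f := fun q : (Fin (d - 1) → ℝ) × ℝ =>
      ENNReal.ofReal (|u q.1 q.2| ^ p * q.2 ^ β)) ?_) hu_int.ne
    have h : Measurable fun q : (Fin (d - 1) → ℝ) × ℝ => u q.1 q.2 := hu_meas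
    fun_prop
  have hg_fin : ∀ᵐ x' : Fin (d - 1) → ℝ, (∫⁻ y in Ioi (0 : ℝ),
      ENNReal.ofReal (|deriv (u x') y + α / y * u x' y| ^ p * y ^ β)) < ⊤ := by
    refine ae_lt_top ?_ hg_int.ne
    set D := {q : (Fin (d - 1) → ℝ) × ℝ | 0 < q.2}.indicator fun q => deriv (u q.1) q.2 with hD
    have hcongr : ∀ x' : Fin (d - 1) → ℝ, (∫⁻ y in Ioi (0 : ℝ),
        ENNReal.ofReal (|deriv (u x') y + α / y * u x' y| ^ p * y ^ β)) =
        ∫⁻ y in Ioi (0 : ℝ), ENNReal.ofReal (|D (x', y) + α / y * u x' y| ^ p * y ^ β) :=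
      fun x' => setLIntegral_congr_fun measurableSet_Ioi fun y hy => by
        simp only [hD, indicator_of_mem
          (show (x', y) ∈ {q : (Fin (d - 1) → ℝ) × ℝ | 0 < q.2} from hy)]
    simp only [hcongr]
    refine Measurable.lintegral_prod_right' (f := fun q : (Fin (d - 1) → ℝ) × ℝ =>
      ENNReal.ofReal (|D q + α / q.2 * u q.1 q.2| ^ p * q.2 ^ β)) ?_
    have h : Measurable fun q : (Fin (d - 1) → ℝ) × ℝ => u q.1 q.2 := hu_meas
    have hDm : Measurable D := measurable_indicator_deriv_snd hu_meas hu_diff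
    fun_prop
  have hweight : ∀ y : ℝ, 0 < y → ∀ v : ℝ,
      |y ^ α * v| ^ p * y ^ (β - α * p) = |v| ^ p * y ^ β := fun y hy v => by
    rw [abs_mul, abs_of_pos (Real.rpow_pos_of_pos hy α),
      Real.mul_rpow (Real.rpow_nonneg hy.le α) (abs_nonneg v), ← Real.rpow_mul hy.le, mul_comm,
      ← mul_assoc, ← Real.rpow_add hy, sub_add_cancel, mul_comm]
  filter_upwards [hu_fin, hg_fin] with x' hu hg
  have hderiv : ∀ y : ℝ, 0 < y → HasDerivAt (fun y => y ^ α * u x' y)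
      (y ^ α * (deriv (u x') y + α / y * u x' y)) y := fun y hy => by
    refine ((Real.hasDerivAt_rpow_const (p := α) (Or.inl hy.ne')).mul
      (hu_diff x' y hy).hasDerivAt).congr_deriv ?_
    rw [Real.rpow_sub_one hy.ne']
    field_simp
    ring
  refine tendsto_zero_of_weighted_lintegral_lt_top hp (γ := β - α * p) (by linarith)
    (fun y hy => (hderiv y hy).differentiableAt) ?_ ?_
  · rwa [setLIntegral_congr_fun measurableSet_Ioi fun y hy => by rw [hweight y hy]]
  · rwa [setLIntegral_congr_fun measurableSet_Ioi fun y hy => by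
      rw [(hderiv y hy).deriv, hweight y hy]]
end

section
/- Let d ≥ 2, q ∈ [1,∞) and γ ∈ ℝ. Let a : (0,∞) → ℝ be measurable and essentially bounded, and let w : ℝ × ℝ^{d-1} × (0,∞) → ℝ be measurable with ∫_{ℝ^{d+1}_+} |w(t,x)|^q x_d^γ dx dt < ∞. Then lim_{h → 0⁺} ∫_{ℝ^{d+1}_+} |a(x_d + h) − a(x_d)|^q |w(t,x)|^q x_d^γ dx dt = 0. -/
open MeasureTheory Set ENNReal Filter

/-- Translation is continuous in `L^p(ℝ)` for `1 ≤ p < ∞`. -/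
theorem tendsto_eLpNorm_translate_sub {p : ℝ≥0∞} [Fact (1 ≤ p)] (hp : p ≠ ⊤) {b : ℝ → ℝ}
    (hb : MemLp b p volume) :
    Tendsto (fun h : ℝ => eLpNorm ((fun s => b (s + h)) - b) p volume) (nhds 0) (nhds 0) := by
  let g : C(ℝ, C(ℝ, ℝ)) :=
    (ContinuousMap.mk (fun z : ℝ × ℝ => z.2 + z.1) (by fun_prop)).curry
  have hmp (h : ℝ) : MeasurePreserving (g h) volume volume :=
    measurePreserving_add_right volume h
  have hcont : Continuous fun h : ℝ => Lp.compMeasurePreserving (g h) (hmp h) (hb.toLp b) :=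
    continuous_const.compMeasurePreservingLp g.continuous hmp hp
  have htend := hcont.tendsto 0
  simp only [Lp.toLp_compMeasurePreserving] at htend
  have hzero : b ∘ g 0 = b := funext fun s => congrArg b (add_zero s)
  have hnorm := (Lp.tendsto_Lp_iff_tendsto_eLpNorm'' _
    (fun h => hb.comp_measurePreserving (hmp h)) _ (hb.comp_measurePreserving (hmp 0))).1 htend
  rw [hzero] at hnorm
  exact hnorm

/-- An essentially bounded function on `(0, ∞)` is the almost everywhere limit of its translates
along a subsequence of any sequence of positive shifts tending to zero. -/
theorem exists_subseq_tendsto_ae_translate {a : ℝ → ℝ} (ha : Measurable a) {M : ℝ}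
    (hM : ∀ᵐ s ∂((volume : Measure ℝ).restrict (Ioi 0)), |a s| ≤ M) {u : ℕ → ℝ}
    (hu : Tendsto u atTop (nhdsWithin 0 (Ioi 0))) :
    ∃ φ : ℕ → ℕ, StrictMono φ ∧
      ∀ᵐ s : ℝ, 0 < s → Tendsto (fun n => a (s + u (φ n))) atTop (nhds (a s)) := by
  have hu0 : Tendsto u atTop (nhds 0) := hu.mono_right nhdsWithin_le_nhds
  have hupos : ∀ᶠ n in atTop, 0 < u n := hu.eventually self_mem_nhdsWithin
  set b : ℝ → ℝ := (Ioi 0).indicator fun s => a s * (1 + s ^ 2)⁻¹ with hb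
  have hbm : Measurable b := by
    refine Measurable.indicator ?_ measurableSet_Ioi
    fun_prop
  have hbint : MemLp b 1 volume := by
    rw [memLp_one_iff_integrable, hb, integrable_indicator_iff measurableSet_Ioi]
    exact integrable_inv_one_add_sq.integrableOn.bdd_mul (c := M) ha.aestronglyMeasurable hM
  have hmeas : TendstoInMeasure volume (fun n s => b (s + u n)) atTop b :=
    tendstoInMeasure_of_tendsto_eLpNorm one_ne_zero
      (fun n => (hbm.comp (measurable_add_const (u n))).aestronglyMeasurable)
      hbm.aestronglyMeasurable
      ((tendsto_eLpNorm_translate_sub one_ne_top hbint).comp hu0)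
  obtain ⟨φ, hφ, hlim⟩ := hmeas.exists_seq_tendsto_ae
  refine ⟨φ, hφ, ?_⟩
  filter_upwards [hlim] with s hs hspos
  have hb_mul {r : ℝ} (hr : 0 < r) : b r * (1 + r ^ 2) = a r := by
    have : (1 + r ^ 2) ≠ 0 := by positivity
    rw [hb, indicator_of_mem (mem_Ioi.2 hr)]
    field_simp
  have hs_shift : Tendsto (fun n => s + u (φ n)) atTop (nhds s) := by
    simpa using (hu0.comp hφ.tendsto_atTop).const_add s
  have hprod := hs.mul ((hs_shift.pow 2).const_add 1)
  rw [hb_mul hspos] at hprod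
  refine hprod.congr' ?_
  filter_upwards [hφ.tendsto_atTop.eventually hupos] with n hn
  exact hb_mul (add_pos hspos hn)

/-- Multiplication by the translation difference `a(x_d + h) − a(x_d)` of a bounded
coefficient tends to zero strongly in `L_{q,γ}(ℝ^{d+1}_+)` as `h → 0⁺`. -/
theorem coefficient_translation_continuity (d : ℕ) (hd : 2 ≤ d) (q γ : ℝ) (hq : 1 ≤ q)
    (a : ℝ → ℝ) (ha_meas : Measurable a)
    (M : ℝ) (ha_bdd : ∀ᵐ s ∂((volume : Measure ℝ).restrict (Ioi 0)), |a s| ≤ M)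
    (w : ℝ × (Fin (d - 1) → ℝ) × ℝ → ℝ) (hw_meas : Measurable w)
    (hw_int : (∫⁻ z : ℝ × (Fin (d - 1) → ℝ) × ℝ in {z | 0 < z.2.2},
        ENNReal.ofReal (|w z| ^ q * z.2.2 ^ γ)) < ⊤) :
    Tendsto (fun h : ℝ => ∫⁻ z : ℝ × (Fin (d - 1) → ℝ) × ℝ in {z | 0 < z.2.2},
        ENNReal.ofReal (|a (z.2.2 + h) - a z.2.2| ^ q * |w z| ^ q * z.2.2 ^ γ))
      (nhdsWithin 0 (Ioi 0)) (nhds 0) := by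
  have hq0 : 0 < q := zero_lt_one.trans_le hq
  have hset : MeasurableSet {z : ℝ × (Fin (d - 1) → ℝ) × ℝ | 0 < z.2.2} :=
    measurableSet_lt measurable_const (by fun_prop)
  have hproj : Measure.QuasiMeasurePreserving
      (fun z : ℝ × (Fin (d - 1) → ℝ) × ℝ => z.2.2) volume volume :=
    Measure.quasiMeasurePreserving_snd.comp Measure.quasiMeasurePreserving_snd
  have hMpos : ∀ᵐ s : ℝ, 0 < s → |a s| ≤ M := (ae_restrict_iff' measurableSet_Ioi).1 ha_bdd
  have hMshift (h : ℝ) : ∀ᵐ s : ℝ, 0 < s + h → |a (s + h)| ≤ M :=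
    (measurePreserving_add_right volume h).quasiMeasurePreserving.ae hMpos
  refine tendsto_of_subseq_tendsto fun u hu => ?_
  obtain ⟨k, hk⟩ := eventually_atTop.1 (hu.eventually self_mem_nhdsWithin)
  obtain ⟨φ, hφ, hlim⟩ := exists_subseq_tendsto_ae_translate ha_meas ha_bdd hu
  refine ⟨fun n => φ (n + k), ?_⟩
  have hpos (n : ℕ) : 0 < u (φ (n + k)) :=
    hk _ ((Nat.le_add_left k n).trans (hφ.id_le (n + k)))
  rw [← lintegral_zero (μ := volume.restrict {z : ℝ × (Fin (d - 1) → ℝ) × ℝ | 0 < z.2.2})]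
  refine tendsto_lintegral_of_dominated_convergence
    (fun z => ENNReal.ofReal ((M + M) ^ q) * ENNReal.ofReal (|w z| ^ q * z.2.2 ^ γ))
    (fun n => by fun_prop) (fun n => ?_) ?_ ?_
  · rw [EventuallyLE, ae_restrict_iff' hset]
    filter_upwards [hproj.ae hMpos, hproj.ae (hMshift (u (φ (n + k))))] with z hz hz' hzpos
    have hzpos : 0 < z.2.2 := hzpos
    have hdiff : |a (z.2.2 + u (φ (n + k))) - a z.2.2| ≤ M + M :=
      (abs_sub _ _).trans (add_le_add (hz' (add_pos hzpos (hpos n))) (hz hzpos))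
    rw [← ENNReal.ofReal_mul (Real.rpow_nonneg ((abs_nonneg _).trans hdiff) q), mul_assoc]
    gcongr
  · rw [lintegral_const_mul' _ _ ofReal_ne_top]
    exact mul_ne_top ofReal_ne_top hw_int.ne
  · rw [ae_restrict_iff' hset]
    filter_upwards [hproj.ae hlim] with z hz hzpos
    have hdiff : Tendsto (fun n => |a (z.2.2 + u (φ (n + k))) - a z.2.2| ^ q) atTop (nhds 0) := by
      have := (((hz hzpos).comp (tendsto_add_atTop_nat k)).sub_const (a z.2.2)).abs.rpow_const
        (p := q) (Or.inr hq0.le)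
      simpa [Real.zero_rpow hq0.ne'] using this
    simpa using ENNReal.tendsto_ofReal ((hdiff.mul_const (|w z| ^ q)).mul_const (z.2.2 ^ γ))
end

section
/- Let d ≥ 2, γ₀ > −1, p ∈ (1,∞) and a, b ∈ ℝ. Let μ be the measure x_d^{γ₀} dx on ℝ^d_+ and set w(x) = (1 + |x|²)^{a/2} x_d^b. For x₀ in the closed half space and r > 0 write B_r^+(x₀) = {x ∈ ℝ^d : |x − x₀| < r} ∩ ℝ^d_+, and define [w]_{A_p} = sup over all r > 0 and x₀ in the closed half space of the quantity (μ(B_r^+(x₀))^{−1} ∫_{B_r^+(x₀)} w dμ) · (μ(B_r^+(x₀))^{−1} ∫_{B_r^+(x₀)} w^{−1/(p−1)} dμ)^{p−1}. Then [w]_{A_p} < ∞ if and only if both −(1+γ₀) < b < (1+γ₀)(p−1) and −(d+γ₀) < a + b < (d+γ₀)(p−1). -/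
open MeasureTheory Set ENNReal

/-- The weighted half space `ℝ^d_+`, realized as pairs `(x', x_d)` with `x_d > 0`. -/
noncomputable def muHalf (d : ℕ) (γ₀ : ℝ) : Measure ((Fin (d - 1) → ℝ) × ℝ) :=
  ((volume : Measure ((Fin (d - 1) → ℝ) × ℝ)).restrict {x | 0 < x.2}).withDensity
    fun x => ENNReal.ofReal (x.2 ^ γ₀)

/-- The Euclidean half-ball `B_r^+(x₀)` in product coordinates. -/
def halfBall (d : ℕ) (x₀ : (Fin (d - 1) → ℝ) × ℝ) (r : ℝ) : Set ((Fin (d - 1) → ℝ) × ℝ) :=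
  {x | (∑ i, (x.1 i - x₀.1 i) ^ 2) + (x.2 - x₀.2) ^ 2 < r ^ 2 ∧ 0 < x.2}

/-- The weight `w(x) = (1 + |x|²)^{a/2} x_d^b`. -/
noncomputable def powerWeight (d : ℕ) (a b : ℝ) (x : (Fin (d - 1) → ℝ) × ℝ) : ℝ :=
  (1 + ((∑ i, x.1 i ^ 2) + x.2 ^ 2)) ^ (a / 2) * x.2 ^ b

/-- The Muckenhoupt `A_p` characteristic of `powerWeight` with respect to
`μ = x_d^{γ₀} dx` on the half space, over all half-balls centered at points of the
closed half space. -/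
noncomputable def ApCharacteristic (d : ℕ) (γ₀ p a b : ℝ) : ℝ≥0∞ :=
  ⨆ (r : ℝ) (_ : 0 < r) (x₀ : (Fin (d - 1) → ℝ) × ℝ) (_ : 0 ≤ x₀.2),
    ((muHalf d γ₀ (halfBall d x₀ r))⁻¹ *
        ∫⁻ x in halfBall d x₀ r, ENNReal.ofReal (powerWeight d a b x) ∂(muHalf d γ₀)) *
      ((muHalf d γ₀ (halfBall d x₀ r))⁻¹ *
        ∫⁻ x in halfBall d x₀ r,
          ENNReal.ofReal (powerWeight d a b x ^ (-(1 / (p - 1)))) ∂(muHalf d γ₀)) ^ (p - 1)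

lemma rpow_le_of_comparable {y z k : ℝ} (s : ℝ) (hy : 0 < y) (hz : 0 < z) (hk : 1 ≤ k)
    (hyz : y ≤ k * z) (hzy : z ≤ k * y) : y ^ s ≤ k ^ |s| * z ^ s := by
  have hk0 : 0 < k := by linarith
  rcases le_or_gt 0 s with hs | hs
  · rw [abs_of_nonneg hs, ← Real.mul_rpow hk0.le hz.le]
    exact Real.rpow_le_rpow hy.le hyz hs
  · rw [abs_of_neg hs, Real.rpow_neg hk0.le, ← Real.inv_rpow hk0.le,
      ← Real.mul_rpow (by positivity) hz.le]
    refine Real.rpow_le_rpow_of_nonpos (by positivity) ?_ hs.le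
    rw [inv_mul_le_iff₀ hk0]
    exact hzy

lemma sum_sq_le_card_mul_norm_sq {n : ℕ} (v : Fin n → ℝ) : ∑ i, v i ^ 2 ≤ n * ‖v‖ ^ 2 := by
  calc ∑ i, v i ^ 2 ≤ ∑ _i : Fin n, ‖v‖ ^ 2 := by
        refine Finset.sum_le_sum fun i _ => ?_
        rw [← sq_abs, ← Real.norm_eq_abs]
        exact pow_le_pow_left₀ (norm_nonneg _) (norm_le_pi_norm v i) 2
    _ = n * ‖v‖ ^ 2 := by simp

lemma norm_sq_le_sum_sq {n : ℕ} (v : Fin n → ℝ) : ‖v‖ ^ 2 ≤ ∑ i, v i ^ 2 := by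
  have h0 : 0 ≤ ∑ i, v i ^ 2 := Finset.sum_nonneg fun i _ => sq_nonneg _
  rw [← Real.le_sqrt (norm_nonneg _) h0, pi_norm_le_iff_of_nonneg (Real.sqrt_nonneg _)]
  intro i
  refine Real.le_sqrt_of_sq_le ?_
  rw [Real.norm_eq_abs, sq_abs]
  exact Finset.single_le_sum (f := fun i => v i ^ 2) (fun i _ => sq_nonneg _) (Finset.mem_univ i)

lemma sq_one_add_norm_comparable {n : ℕ} (x : (Fin n → ℝ) × ℝ) :
    (1 + ‖x‖) ^ 2 ≤ (n + 2) * (1 + ((∑ i, x.1 i ^ 2) + x.2 ^ 2)) ∧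
      1 + ((∑ i, x.1 i ^ 2) + x.2 ^ 2) ≤ (n + 2) * (1 + ‖x‖) ^ 2 := by
  have h1 : ‖x.1‖ ≤ ‖x‖ := norm_fst_le x
  have h2 : |x.2| ≤ ‖x‖ := norm_snd_le x
  have h3 := sum_sq_le_card_mul_norm_sq x.1
  have h4 := norm_sq_le_sum_sq x.1
  have h5 : ‖x‖ ^ 2 ≤ (∑ i, x.1 i ^ 2) + x.2 ^ 2 := by
    rw [Prod.norm_def]
    rcases max_cases ‖x.1‖ ‖x.2‖ with ⟨h, _⟩ | ⟨h, _⟩ <;> rw [h]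
    · nlinarith [sq_nonneg x.2]
    · rw [Real.norm_eq_abs, sq_abs]; nlinarith [sq_nonneg ‖x.1‖]
  have hn : (0 : ℝ) ≤ n := n.cast_nonneg
  have h6 : ‖x.1‖ ^ 2 ≤ ‖x‖ ^ 2 := pow_le_pow_left₀ (norm_nonneg _) h1 2
  have h7 : x.2 ^ 2 ≤ ‖x‖ ^ 2 := by
    rw [← sq_abs x.2]; exact pow_le_pow_left₀ (abs_nonneg _) h2 2
  have h8 : (n : ℝ) * ‖x.1‖ ^ 2 ≤ n * ‖x‖ ^ 2 := mul_le_mul_of_nonneg_left h6 hn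
  have h9 := norm_nonneg x
  constructor
  · nlinarith [sq_nonneg (‖x‖ - 1), mul_nonneg hn (sq_nonneg ‖x‖)]
  · nlinarith [mul_nonneg hn (sq_nonneg ‖x‖), mul_nonneg hn h9]

lemma powerWeight_comparable (d : ℕ) (s τ : ℝ) :
    ∃ C : ℝ, 0 < C ∧ ∀ x : (Fin (d - 1) → ℝ) × ℝ, 0 < x.2 →
      powerWeight d s τ x ≤ C * ((1 + ‖x‖) ^ s * x.2 ^ τ) ∧
        (1 + ‖x‖) ^ s * x.2 ^ τ ≤ C * powerWeight d s τ x := by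
  refine ⟨(((d - 1 : ℕ) : ℝ) + 2) ^ |s / 2|, by positivity, fun x hx => ?_⟩
  obtain ⟨h1, h2⟩ := sq_one_add_norm_comparable x
  have hk : (1 : ℝ) ≤ ((d - 1 : ℕ) : ℝ) + 2 := by
    have : (0 : ℝ) ≤ ((d - 1 : ℕ) : ℝ) := Nat.cast_nonneg _
    linarith
  have hN : 0 < 1 + ‖x‖ := by positivity
  have hQ : 0 < 1 + ((∑ i, x.1 i ^ 2) + x.2 ^ 2) := by positivity
  have hsq : ((1 + ‖x‖) ^ 2) ^ (s / 2) = (1 + ‖x‖) ^ s := by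
    rw [← Real.rpow_natCast, ← Real.rpow_mul hN.le]; congr 1; push_cast; ring
  have hτ : 0 ≤ x.2 ^ τ := Real.rpow_nonneg hx.le _
  unfold powerWeight
  rw [← hsq, ← mul_assoc, ← mul_assoc]
  exact ⟨mul_le_mul_of_nonneg_right
      (rpow_le_of_comparable _ hQ (by positivity) hk h2 h1) hτ,
    mul_le_mul_of_nonneg_right
      (rpow_le_of_comparable _ (by positivity) hQ hk h1 h2) hτ⟩

lemma measurable_powerWeight (d : ℕ) (s τ : ℝ) : Measurable (powerWeight d s τ) := by
  unfold powerWeight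
  fun_prop

lemma measurableSet_halfBall (d : ℕ) (x₀ : (Fin (d - 1) → ℝ) × ℝ) (r : ℝ) :
    MeasurableSet (halfBall d x₀ r) := by
  have h1 : Measurable fun x : (Fin (d - 1) → ℝ) × ℝ =>
      (∑ i, (x.1 i - x₀.1 i) ^ 2) + (x.2 - x₀.2) ^ 2 := by fun_prop
  exact (measurableSet_lt h1 measurable_const).inter
    (measurableSet_lt measurable_const measurable_snd)

lemma halfBall_subset_box (d : ℕ) (x₀ : (Fin (d - 1) → ℝ) × ℝ) {r : ℝ} (hr : 0 < r) :
    halfBall d x₀ r ⊆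
      Metric.ball x₀.1 r ×ˢ Ioo (max 0 (x₀.2 - r)) (x₀.2 + r) := by
  rintro x ⟨h, hx⟩
  have h1 := norm_sq_le_sum_sq (x.1 - x₀.1)
  simp only [Pi.sub_apply] at h1
  refine ⟨?_, ?_⟩
  · rw [Metric.mem_ball, dist_eq_norm]
    exact lt_of_pow_lt_pow_left₀ 2 hr.le (by nlinarith [sq_nonneg (x.2 - x₀.2)])
  · have h2 : |x.2 - x₀.2| < r := by
      refine abs_lt_of_sq_lt_sq ?_ hr.le
      nlinarith [sq_nonneg ‖x.1 - x₀.1‖]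
    rw [abs_lt] at h2
    exact ⟨max_lt hx (by linarith), by linarith⟩

lemma box_subset_halfBall (d : ℕ) (x₀ : (Fin (d - 1) → ℝ) × ℝ) (hx₀ : 0 ≤ x₀.2) {r ρ : ℝ}
    (hr : 0 < r) (hρ : ρ * (((d - 1 : ℕ) : ℝ) + 1) ≤ r) :
    Metric.ball x₀.1 ρ ×ˢ Ioc x₀.2 (x₀.2 + r / 2) ⊆ halfBall d x₀ r := by
  rintro x ⟨h, hx, hx'⟩
  rw [Metric.mem_ball, dist_eq_norm] at h
  have h1 := sum_sq_le_card_mul_norm_sq (x.1 - x₀.1)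
  simp only [Pi.sub_apply] at h1
  refine ⟨?_, by linarith⟩
  set m : ℝ := ((d - 1 : ℕ) : ℝ)
  have hm : 0 ≤ m := Nat.cast_nonneg _
  have h0 := norm_nonneg (x.1 - x₀.1)
  have h2 : ‖x.1 - x₀.1‖ * (m + 1) ≤ r :=
    (mul_le_mul_of_nonneg_right h.le (by linarith)).trans hρ
  have h3 : (‖x.1 - x₀.1‖ * (m + 1)) ^ 2 ≤ r ^ 2 := pow_le_pow_left₀ (by positivity) h2 2
  have h4 : 4 * (m * ‖x.1 - x₀.1‖ ^ 2) ≤ (‖x.1 - x₀.1‖ * (m + 1)) ^ 2 := by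
    nlinarith [mul_nonneg (sq_nonneg (m - 1)) (sq_nonneg ‖x.1 - x₀.1‖)]
  have h5 : (x.2 - x₀.2) ^ 2 ≤ (r / 2) ^ 2 := pow_le_pow_left₀ (by linarith) (by linarith) 2
  nlinarith

lemma setLIntegral_prod_mul {n : ℕ} (S : Set (Fin n → ℝ)) (T : Set ℝ) {f : (Fin n → ℝ) → ℝ≥0∞}
    {g : ℝ → ℝ≥0∞} (hf : Measurable f) (hg : Measurable g) :
    ∫⁻ x in S ×ˢ T, f x.1 * g x.2 = (∫⁻ y in S, f y) * ∫⁻ t in T, g t := by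
  rw [Measure.volume_eq_prod, ← Measure.prod_restrict]
  exact lintegral_prod_mul hf.aemeasurable hg.aemeasurable

lemma lintegral_Ioo_rpow {τ h : ℝ} (hτ : -1 < τ) (hh : 0 < h) :
    ∫⁻ y in Ioo 0 h, ENNReal.ofReal (y ^ τ) = ENNReal.ofReal (h ^ (τ + 1) / (τ + 1)) := by
  rw [← ofReal_integral_eq_lintegral_ofReal, ← integral_Ioc_eq_integral_Ioo,
    ← intervalIntegral.integral_of_le hh.le, integral_rpow (Or.inl hτ),
    Real.zero_rpow (by linarith), sub_zero]
  · exact (intervalIntegral.integrableOn_Ioo_rpow_iff hh).2 hτ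
  · filter_upwards [ae_restrict_mem measurableSet_Ioo] with y hy
    exact Real.rpow_nonneg hy.1.le _

lemma lintegral_Ioo_rpow_eq_top {τ h : ℝ} (hτ : τ ≤ -1) (hh : 0 < h) :
    ∫⁻ y in Ioo 0 h, ENNReal.ofReal (y ^ τ) = ⊤ := by
  by_contra hne
  refine absurd ((intervalIntegral.integrableOn_Ioo_rpow_iff hh).1 ?_) (not_lt.2 hτ)
  refine ⟨by fun_prop, ?_⟩
  rw [hasFiniteIntegral_iff_ofReal]
  · exact lt_top_iff_ne_top.2 hne
  · filter_upwards [ae_restrict_mem measurableSet_Ioo] with y hy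
    exact Real.rpow_nonneg hy.1.le _

lemma lintegral_Ioo_inv {h : ℝ} (hh : 1 ≤ h) :
    ∫⁻ y in Ioo 1 h, ENNReal.ofReal y⁻¹ = ENNReal.ofReal (Real.log h) := by
  have hi : IntervalIntegrable (fun y : ℝ => y⁻¹) volume 1 h := by
    refine intervalIntegral.intervalIntegrable_inv (fun x hx => ?_) (by fun_prop)
    rw [uIcc_of_le hh] at hx
    linarith [hx.1]
  rw [← ofReal_integral_eq_lintegral_ofReal, ← integral_Ioc_eq_integral_Ioo,
    ← intervalIntegral.integral_of_le hh, integral_inv_of_pos one_pos (by linarith), div_one]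
  · exact ((intervalIntegrable_iff_integrableOn_Ioo_of_le hh).1 hi)
  · filter_upwards [ae_restrict_mem measurableSet_Ioo] with y hy
    exact inv_nonneg.2 (by linarith [hy.1])

/-- The integral of `powerWeight d s τ` over a half-ball, against Lebesgue measure. -/
noncomputable def halfBallMass (d : ℕ) (s τ : ℝ) (x₀ : (Fin (d - 1) → ℝ) × ℝ) (r : ℝ) : ℝ≥0∞ :=
  ∫⁻ x in halfBall d x₀ r, ENNReal.ofReal (powerWeight d s τ x)

/-- The typical size of `powerWeight d s τ` on the half-ball of radius `r` around `x₀`. -/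
noncomputable def weightScale {n : ℕ} (s τ : ℝ) (x₀ : (Fin n → ℝ) × ℝ) (r : ℝ) : ℝ :=
  (1 + ‖x₀‖ + r) ^ s * (x₀.2 + r) ^ τ

lemma weightScale_pos {n : ℕ} (s τ : ℝ) {x₀ : (Fin n → ℝ) × ℝ} (hx₀ : 0 ≤ x₀.2) {r : ℝ}
    (hr : 0 < r) : 0 < weightScale s τ x₀ r := by
  unfold weightScale
  positivity

lemma ofReal_le_halfBallMass (d : ℕ) (s τ : ℝ) :
    ∃ c : ℝ, 0 < c ∧ ∀ x₀ : (Fin (d - 1) → ℝ) × ℝ, 0 ≤ x₀.2 → ∀ r : ℝ, 0 < r →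
      ENNReal.ofReal (c * (r ^ (d - 1) * r * weightScale s τ x₀ r)) ≤ halfBallMass d s τ x₀ r := by
  obtain ⟨C, hC, hpw⟩ := powerWeight_comparable d s τ
  set m : ℝ := ((d - 1 : ℕ) : ℝ) with hm_def
  have hm : 0 ≤ m := Nat.cast_nonneg _
  set K : ℝ := 9 ^ |s| * 4 ^ |τ| * C with hK
  have hKpos : 0 < K := by positivity
  refine ⟨K⁻¹ * ((2 / (m + 1)) ^ (d - 1) * (1 / 4)), by positivity, fun x₀ hx₀ r hr => ?_⟩
  set P := Metric.ball x₀.1 (r / (m + 1)) ×ˢ Ioc (x₀.2 + r / 4) (x₀.2 + r / 2) with hP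
  have hsub : P ⊆ halfBall d x₀ r :=
    (prod_mono subset_rfl (Ioc_subset_Ioc_left (by linarith))).trans
      (box_subset_halfBall d x₀ hx₀ (ρ := r / (m + 1)) hr
        (by rw [div_mul_cancel₀ _ (by positivity)]))
  have hPm : MeasurableSet P := Metric.isOpen_ball.measurableSet.prod measurableSet_Ioc
  have hpt : ∀ x ∈ P, K⁻¹ * weightScale s τ x₀ r ≤ powerWeight d s τ x := by
    rintro x ⟨hx1, hx2, hx3⟩
    have hx0 : 0 < x.2 := by linarith
    have hy : x.2 ≤ ‖x‖ := (le_abs_self _).trans (norm_snd_le x)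
    have hd : ‖x₀‖ ≤ ‖x‖ + r := by
      have : ‖x - x₀‖ ≤ r := by
        rw [Prod.norm_def, max_le_iff]
        constructor
        · rw [Metric.mem_ball, dist_eq_norm] at hx1
          exact hx1.le.trans (div_le_self hr.le (by linarith))
        · rw [Prod.snd_sub, Real.norm_eq_abs, abs_le]
          constructor <;> linarith
      have h2 := norm_sub_norm_le x₀ x
      rw [norm_sub_rev] at h2
      linarith
    have hs := rpow_le_of_comparable (y := 1 + ‖x₀‖ + r) (z := 1 + ‖x‖) (k := 9) s
      (by positivity) (by positivity) (by norm_num) (by nlinarith [norm_nonneg x])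
      (by
        have : ‖x‖ ≤ ‖x₀‖ + r := by
          rw [Prod.norm_def, max_le_iff]
          constructor
          · rw [Metric.mem_ball, dist_eq_norm] at hx1
            have h1 : r / (m + 1) ≤ r := div_le_self hr.le (by linarith)
            have h2 := norm_sub_norm_le x.1 x₀.1
            have h3 := norm_fst_le x₀
            linarith
          · rw [Real.norm_eq_abs, abs_of_pos hx0]
            have h3 := (le_abs_self _).trans (norm_snd_le x₀)
            linarith
        linarith [norm_nonneg x₀])
    have ht := rpow_le_of_comparable (y := x₀.2 + r) (z := x.2) (k := 4) τ
      (by positivity) hx0 (by norm_num) (by linarith) (by linarith)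
    rw [inv_mul_le_iff₀ hKpos]
    calc weightScale s τ x₀ r ≤ (9 ^ |s| * (1 + ‖x‖) ^ s) * (4 ^ |τ| * x.2 ^ τ) := by
          unfold weightScale
          gcongr
      _ = 9 ^ |s| * 4 ^ |τ| * ((1 + ‖x‖) ^ s * x.2 ^ τ) := by ring
      _ ≤ 9 ^ |s| * 4 ^ |τ| * (C * powerWeight d s τ x) := by
          exact mul_le_mul_of_nonneg_left (hpw x hx0).2 (by positivity)
      _ = K * powerWeight d s τ x := by rw [hK]; ring
  have hvol : volume P = ENNReal.ofReal ((2 * (r / (m + 1))) ^ (d - 1) * (r / 4)) := by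
    rw [hP, Measure.volume_eq_prod, Measure.prod_prod, Real.volume_pi_ball _ (by positivity),
      Real.volume_Ioc, ← ENNReal.ofReal_mul (by positivity), Fintype.card_fin]
    congr 2
    ring
  calc _ = ENNReal.ofReal (K⁻¹ * weightScale s τ x₀ r) * volume P := by
        rw [hvol, ← ENNReal.ofReal_mul
          (mul_nonneg (by positivity) (weightScale_pos s τ hx₀ hr).le)]
        congr 1
        rw [show 2 * (r / (m + 1)) = 2 / (m + 1) * r by ring, mul_pow]
        ring
    _ = ∫⁻ x in P, ENNReal.ofReal (K⁻¹ * weightScale s τ x₀ r) := by rw [setLIntegral_const]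
    _ ≤ ∫⁻ x in P, ENNReal.ofReal (powerWeight d s τ x) :=
        setLIntegral_mono' hPm fun x hx => ENNReal.ofReal_le_ofReal (hpt x hx)
    _ ≤ _ := lintegral_mono_set hsub

lemma lintegral_interval_rpow_le {τ : ℝ} (hτ : -1 < τ) :
    ∃ C : ℝ, 0 < C ∧ ∀ t : ℝ, 0 ≤ t → ∀ r : ℝ, 0 < r →
      ∫⁻ y in Ioo (max 0 (t - r)) (t + r), ENNReal.ofReal (y ^ τ) ≤
        ENNReal.ofReal (C * (r * (t + r) ^ τ)) := by
  have hτ' : 0 < τ + 1 := by linarith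
  refine ⟨2 * 3 ^ |τ| + 3 / (τ + 1), by positivity, fun t ht r hr => ?_⟩
  have hh : 0 < t + r := by linarith
  have hp : 0 < (t + r) ^ τ := by positivity
  rcases le_or_gt (2 * r) t with h | h
  · calc _ ≤ ∫⁻ y in Ioo (max 0 (t - r)) (t + r), ENNReal.ofReal (3 ^ |τ| * (t + r) ^ τ) := by
          refine setLIntegral_mono' measurableSet_Ioo fun y hy => ENNReal.ofReal_le_ofReal ?_
          obtain ⟨h1, h2⟩ := hy
          rw [max_lt_iff] at h1
          exact rpow_le_of_comparable τ h1.1 hh (by norm_num) (by linarith) (by linarith)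
      _ = ENNReal.ofReal (3 ^ |τ| * (t + r) ^ τ * (2 * r)) := by
          rw [setLIntegral_const, Real.volume_Ioo, max_eq_right (by linarith),
            ← ENNReal.ofReal_mul (by positivity)]
          congr 2
          ring
      _ ≤ _ := by
          refine ENNReal.ofReal_le_ofReal ?_
          have : 0 ≤ 3 / (τ + 1) * (r * (t + r) ^ τ) := by positivity
          linarith
  · calc _ ≤ ∫⁻ y in Ioo 0 (t + r), ENNReal.ofReal (y ^ τ) :=
          lintegral_mono_set (Ioo_subset_Ioo_left (le_max_left _ _))
      _ = ENNReal.ofReal ((t + r) ^ (τ + 1) / (τ + 1)) := lintegral_Ioo_rpow hτ hh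
      _ ≤ _ := by
          refine ENNReal.ofReal_le_ofReal ?_
          rw [Real.rpow_add_one hh.ne', add_mul]
          have h1 : 0 ≤ 2 * (3 : ℝ) ^ |τ| * (r * (t + r) ^ τ) := by positivity
          have h2 : (t + r) ^ τ * (t + r) / (τ + 1) ≤ 3 / (τ + 1) * (r * (t + r) ^ τ) := by
            rw [div_mul_eq_mul_div]
            refine div_le_div_of_nonneg_right ?_ hτ'.le
            nlinarith
          linarith

lemma lintegral_ball_prod_rpow_le {n : ℕ} {κ : ℝ} (hκ : -1 < κ) (hκ0 : κ ≤ 0) {ρ : ℝ}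
    (hρ : 0 < ρ) :
    ∫⁻ v in Metric.ball (0 : Fin n → ℝ) ρ, ENNReal.ofReal (∏ i, (1 + |v i|) ^ κ) ≤
      ENNReal.ofReal ((2 * (ρ ^ (κ + 1) / (κ + 1))) ^ n) := by
  have hcont : Continuous fun y : ℝ => (1 + |y|) ^ κ :=
    (continuous_const.add continuous_abs).rpow_const fun y =>
      Or.inl (show (1 : ℝ) + |y| ≠ 0 by positivity)
  have hball : Metric.ball (0 : Fin n → ℝ) ρ = Set.pi univ fun _ => Ioo (-ρ) ρ := by
    rw [ball_pi _ hρ]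
    simp [Real.ball_eq_Ioo]
  have hint : IntegrableOn (fun y : ℝ => (1 + |y|) ^ κ) (Ioo (-ρ) ρ) :=
    (hcont.integrableOn_Icc).mono_set Ioo_subset_Icc_self
  have h1 : ∫ y in (0)..ρ, (1 + |y|) ^ κ ≤ ρ ^ (κ + 1) / (κ + 1) := by
    have : ∫ y in (0)..ρ, y ^ κ = ρ ^ (κ + 1) / (κ + 1) := by
      rw [integral_rpow (Or.inl hκ), Real.zero_rpow (by linarith), sub_zero]
    rw [← this]
    refine intervalIntegral.integral_mono_on_of_le_Ioo hρ.le (hcont.intervalIntegrable _ _)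
      (intervalIntegral.intervalIntegrable_rpow' hκ) fun y hy => ?_
    refine Real.rpow_le_rpow_of_nonpos hy.1 ?_ hκ0
    rw [abs_of_pos hy.1]
    linarith
  have h2 : ∫ y in Ioo (-ρ) ρ, (1 + |y|) ^ κ ≤ 2 * (ρ ^ (κ + 1) / (κ + 1)) := by
    rw [← integral_Ioc_eq_integral_Ioo, ← intervalIntegral.integral_of_le (by linarith),
      ← intervalIntegral.integral_add_adjacent_intervals (b := 0)
        (hcont.intervalIntegrable _ _) (hcont.intervalIntegrable _ _)]
    have := intervalIntegral.integral_comp_neg (a := 0) (b := ρ) fun y : ℝ => (1 + |y|) ^ κ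
    simp only [abs_neg, neg_zero] at this
    linarith
  rw [hball, volume_pi, Measure.restrict_pi_pi, ← ofReal_integral_eq_lintegral_ofReal]
  · refine ENNReal.ofReal_le_ofReal ?_
    rw [integral_fintype_prod_eq_prod (𝕜 := ℝ) fun _ y => (1 + |y|) ^ κ, Finset.prod_const,
      Finset.card_univ, Fintype.card_fin]
    refine pow_le_pow_left₀ (integral_nonneg fun y => ?_) h2 n
    positivity
  · exact Integrable.fintype_prod (𝕜 := ℝ) (f := fun _ y => (1 + |y|) ^ κ) fun _ => hint
  · exact Filter.Eventually.of_forall fun v => Finset.prod_nonneg fun i _ => by positivity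

lemma one_add_norm_rpow_le_prod {n : ℕ} {κ q : ℝ} (hκ0 : κ ≤ 0) (hq : 0 < q)
    (x : (Fin n → ℝ) × ℝ) (hx : 0 < x.2) :
    (1 + ‖x‖) ^ (κ * (n + q)) ≤ (∏ i, (1 + |x.1 i|) ^ κ) * x.2 ^ (κ * q) := by
  have hN : 0 < 1 + ‖x‖ := by positivity
  rw [mul_add, Real.rpow_add hN, Real.rpow_mul hN.le, Real.rpow_natCast]
  have h1 : ((1 + ‖x‖) ^ κ) ^ n ≤ ∏ i, (1 + |x.1 i|) ^ κ := by
    calc ((1 + ‖x‖) ^ κ) ^ n = ∏ _i : Fin n, (1 + ‖x‖) ^ κ := by simp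
      _ ≤ _ := by
        refine Finset.prod_le_prod (fun i _ => by positivity) fun i _ => ?_
        refine Real.rpow_le_rpow_of_nonpos (by positivity) ?_ hκ0
        have := (norm_le_pi_norm x.1 i).trans (norm_fst_le x)
        rw [Real.norm_eq_abs] at this
        linarith
  have h2 : (1 + ‖x‖) ^ (κ * q) ≤ x.2 ^ (κ * q) := by
    refine Real.rpow_le_rpow_of_nonpos hx ?_ (mul_nonpos_of_nonpos_of_nonneg hκ0 hq.le)
    have := (le_abs_self _).trans (norm_snd_le x)
    linarith
  gcongr

lemma lintegral_box_origin_le {n : ℕ} {s τ : ℝ} (hτ : -1 < τ) (hsτ : -((n : ℝ) + 1) < s + τ) :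
    ∃ C : ℝ, 0 < C ∧ ∀ ρ : ℝ, 1 ≤ ρ →
      ∫⁻ x in Metric.ball (0 : Fin n → ℝ) ρ ×ˢ Ioo 0 ρ,
        ENNReal.ofReal ((1 + ‖x‖) ^ s * x.2 ^ τ) ≤
      ENNReal.ofReal (C * (ρ ^ n * ρ * (ρ ^ s * ρ ^ τ))) := by
  have hτ' : 0 < τ + 1 := by linarith
  have hms : ∀ ρ : ℝ, MeasurableSet (Metric.ball (0 : Fin n → ℝ) ρ ×ˢ Ioo (0 : ℝ) ρ) :=
    fun ρ => Metric.isOpen_ball.measurableSet.prod measurableSet_Ioo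
  rcases le_or_gt 0 s with hs | hs
  · refine ⟨2 ^ s * 2 ^ n / (τ + 1), by positivity, fun ρ hρ => ?_⟩
    have hρ0 : 0 < ρ := by linarith
    calc _ ≤ ∫⁻ x in Metric.ball (0 : Fin n → ℝ) ρ ×ˢ Ioo 0 ρ,
          ENNReal.ofReal ((2 * ρ) ^ s) * ENNReal.ofReal (x.2 ^ τ) := by
          refine setLIntegral_mono' (hms ρ) fun x hx => ?_
          obtain ⟨h1, h2, h3⟩ := hx
          rw [← ENNReal.ofReal_mul (by positivity)]
          refine ENNReal.ofReal_le_ofReal ?_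
          have : ‖x‖ ≤ ρ := by
            rw [Prod.norm_def, max_le_iff, Real.norm_eq_abs, abs_of_pos h2]
            exact ⟨(mem_ball_zero_iff.1 h1).le, h3.le⟩
          have h4 : 1 + ‖x‖ ≤ 2 * ρ := by linarith
          gcongr
      _ = ENNReal.ofReal ((2 * ρ) ^ s) * ENNReal.ofReal ((2 * ρ) ^ n) *
          ENNReal.ofReal (ρ ^ (τ + 1) / (τ + 1)) := by
          rw [setLIntegral_prod_mul _ _ (f := fun _ => ENNReal.ofReal ((2 * ρ) ^ s))
            (g := fun y => ENNReal.ofReal (y ^ τ)) measurable_const (by fun_prop),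
            setLIntegral_const, lintegral_Ioo_rpow hτ hρ0, Real.volume_pi_ball _ hρ0,
            Fintype.card_fin]
      _ = _ := by
          rw [← ENNReal.ofReal_mul (by positivity), ← ENNReal.ofReal_mul (by positivity)]
          congr 1
          rw [Real.rpow_add_one hρ0.ne', Real.mul_rpow (by norm_num) hρ0.le, mul_pow]
          ring
  · have hq : 0 < (n : ℝ) + (τ + 1) := by positivity
    set κ : ℝ := s / (n + (τ + 1)) with hκ_def
    have hκs : κ * (n + (τ + 1)) = s := div_mul_cancel₀ _ hq.ne'
    have hκ0 : κ ≤ 0 := (div_neg_of_neg_of_pos hs hq).le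
    have hκ : -1 < κ := by
      rw [hκ_def, lt_div_iff₀ hq]
      linarith
    have hκ' : 0 < κ + 1 := by linarith
    have hexp : τ + κ * (τ + 1) + 1 = (κ + 1) * (τ + 1) := by ring
    have hexp0 : 0 < (κ + 1) * (τ + 1) := by positivity
    refine ⟨(2 / (κ + 1)) ^ n / ((κ + 1) * (τ + 1)), by positivity, fun ρ hρ => ?_⟩
    have hρ0 : 0 < ρ := by linarith
    calc _ ≤ ∫⁻ x in Metric.ball (0 : Fin n → ℝ) ρ ×ˢ Ioo 0 ρ,
          ENNReal.ofReal (∏ i, (1 + |x.1 i|) ^ κ) *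
            ENNReal.ofReal (x.2 ^ (τ + κ * (τ + 1))) := by
          refine setLIntegral_mono' (hms ρ) fun x hx => ?_
          have hx0 : 0 < x.2 := hx.2.1
          have hpr : 0 ≤ ∏ i, (1 + |x.1 i|) ^ κ := Finset.prod_nonneg fun i _ => by positivity
          rw [← ENNReal.ofReal_mul hpr]
          refine ENNReal.ofReal_le_ofReal ?_
          have := one_add_norm_rpow_le_prod hκ0 hτ' x hx0
          rw [hκs] at this
          rw [add_comm τ, Real.rpow_add hx0, ← mul_assoc]
          gcongr
      _ ≤ ENNReal.ofReal ((2 * (ρ ^ (κ + 1) / (κ + 1))) ^ n) *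
          ENNReal.ofReal (ρ ^ ((κ + 1) * (τ + 1)) / ((κ + 1) * (τ + 1))) := by
          rw [setLIntegral_prod_mul _ _
            (f := fun v : Fin n → ℝ => ENNReal.ofReal (∏ i, (1 + |v i|) ^ κ))
            (g := fun y => ENNReal.ofReal (y ^ (τ + κ * (τ + 1)))) (by fun_prop) (by fun_prop),
            lintegral_Ioo_rpow (by linarith) hρ0, hexp]
          gcongr
          exact lintegral_ball_prod_rpow_le hκ hκ0 hρ0
      _ = _ := by
          rw [← ENNReal.ofReal_mul (by positivity)]
          congr 1
          have h1 : (ρ ^ (κ + 1)) ^ n * ρ ^ ((κ + 1) * (τ + 1)) =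
              ρ ^ n * ρ * (ρ ^ s * ρ ^ τ) := by
            rw [← Real.rpow_natCast, ← Real.rpow_mul hρ0.le, ← Real.rpow_add hρ0,
              ← Real.rpow_natCast ρ n, ← Real.rpow_add_one hρ0.ne', ← Real.rpow_add hρ0,
              ← Real.rpow_add hρ0, ← hκs]
            congr 1
            ring
          rw [← h1, show 2 * (ρ ^ (κ + 1) / (κ + 1)) = 2 / (κ + 1) * ρ ^ (κ + 1) by ring, mul_pow]
          ring

lemma halfBallMass_le_of_bound (d : ℕ) (s τ : ℝ) :
    ∃ C : ℝ, 0 < C ∧ ∀ (x₀ : (Fin (d - 1) → ℝ) × ℝ) (r : ℝ)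
      (P : Set ((Fin (d - 1) → ℝ) × ℝ)), MeasurableSet P → halfBall d x₀ r ⊆ P →
      (∀ x ∈ P, 0 < x.2) → halfBallMass d s τ x₀ r ≤
        ENNReal.ofReal C * ∫⁻ x in P, ENNReal.ofReal ((1 + ‖x‖) ^ s * x.2 ^ τ) := by
  obtain ⟨C, hC, hpw⟩ := powerWeight_comparable d s τ
  refine ⟨C, hC, fun x₀ r P hP hsub hpos => ?_⟩
  calc _ ≤ ∫⁻ x in P, ENNReal.ofReal (powerWeight d s τ x) := lintegral_mono_set hsub
    _ ≤ ∫⁻ x in P, ENNReal.ofReal C * ENNReal.ofReal ((1 + ‖x‖) ^ s * x.2 ^ τ) := by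
        refine setLIntegral_mono' hP fun x hx => ?_
        rw [← ENNReal.ofReal_mul hC.le]
        exact ENNReal.ofReal_le_ofReal (hpw x (hpos x hx)).1
    _ = _ := lintegral_const_mul' _ _ ENNReal.ofReal_ne_top

lemma halfBallMass_le_ofReal (d : ℕ) {s τ : ℝ} (hτ : -1 < τ)
    (hsτ : -(((d - 1 : ℕ) : ℝ) + 1) < s + τ) :
    ∃ C : ℝ, 0 < C ∧ ∀ x₀ : (Fin (d - 1) → ℝ) × ℝ, 0 ≤ x₀.2 → ∀ r : ℝ, 0 < r →
      halfBallMass d s τ x₀ r ≤ ENNReal.ofReal (C * (r ^ (d - 1) * r * weightScale s τ x₀ r)) := by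
  obtain ⟨C, hC, hmass⟩ := halfBallMass_le_of_bound d s τ
  obtain ⟨C₁, hC₁, h1d⟩ := lintegral_interval_rpow_le hτ
  obtain ⟨C₂, hC₂, horigin⟩ := lintegral_box_origin_le hτ hsτ
  set K₁ : ℝ := 3 ^ |s| * 2 ^ (d - 1) * C₁ with hK₁
  set K₂ : ℝ := C₂ * (3 ^ (d - 1) * 3 * (3 ^ |s| * 3 ^ |τ|)) with hK₂
  have hK₁0 : 0 < K₁ := by positivity
  have hK₂0 : 0 < K₂ := by positivity
  refine ⟨C * (K₁ + K₂), by positivity, fun x₀ hx₀ r hr => ?_⟩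
  have hbox := halfBall_subset_box d x₀ hr
  have hS := weightScale_pos s τ hx₀ hr
  have hx₀le : x₀.2 ≤ ‖x₀‖ := (le_abs_self _).trans (norm_snd_le x₀)
  have hA : 0 < r ^ (d - 1) * r * weightScale s τ x₀ r := by positivity
  suffices h : ∃ P, MeasurableSet P ∧ halfBall d x₀ r ⊆ P ∧ (∀ x ∈ P, 0 < x.2) ∧
      ∫⁻ x in P, ENNReal.ofReal ((1 + ‖x‖) ^ s * x.2 ^ τ) ≤
        ENNReal.ofReal ((K₁ + K₂) * (r ^ (d - 1) * r * weightScale s τ x₀ r)) by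
    obtain ⟨P, hPm, hsub, hpos, hle⟩ := h
    refine (hmass x₀ r P hPm hsub hpos).trans ?_
    rw [mul_assoc C, ENNReal.ofReal_mul hC.le]
    gcongr
  rcases le_or_gt (2 * r) (1 + ‖x₀‖) with h | h
  · refine ⟨_, Metric.isOpen_ball.measurableSet.prod measurableSet_Ioo, hbox,
      fun x hx => (le_max_left _ _).trans_lt hx.2.1, ?_⟩
    calc _ ≤ ∫⁻ x in Metric.ball x₀.1 r ×ˢ Ioo (max 0 (x₀.2 - r)) (x₀.2 + r),
            ENNReal.ofReal (3 ^ |s| * (1 + ‖x₀‖ + r) ^ s) * ENNReal.ofReal (x.2 ^ τ) := by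
          refine setLIntegral_mono' (Metric.isOpen_ball.measurableSet.prod measurableSet_Ioo)
            fun x hx => ?_
          obtain ⟨h1, h2, h3⟩ := hx
          rw [max_lt_iff] at h2
          rw [← ENNReal.ofReal_mul (by positivity)]
          refine ENNReal.ofReal_le_ofReal ?_
          have hd : ‖x - x₀‖ ≤ r := by
            rw [Prod.norm_def, max_le_iff, Real.norm_eq_abs]
            rw [Metric.mem_ball, dist_eq_norm] at h1
            refine ⟨h1.le, ?_⟩
            rw [Prod.snd_sub, abs_le]
            constructor <;> linarith
          have h4 := norm_sub_norm_le x x₀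
          have h5 := norm_sub_norm_le x₀ x
          rw [norm_sub_rev] at h5
          have := rpow_le_of_comparable (y := 1 + ‖x‖) (z := 1 + ‖x₀‖ + r) (k := 3) s
            (by positivity) (by positivity) (by norm_num) (by linarith [norm_nonneg x₀])
            (by linarith)
          have h6 : 0 ≤ x.2 ^ τ := Real.rpow_nonneg h2.1.le _
          gcongr
      _ ≤ ENNReal.ofReal (3 ^ |s| * (1 + ‖x₀‖ + r) ^ s) * ENNReal.ofReal ((2 * r) ^ (d - 1)) *
          ENNReal.ofReal (C₁ * (r * (x₀.2 + r) ^ τ)) := by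
          rw [setLIntegral_prod_mul _ _
            (f := fun _ => ENNReal.ofReal (3 ^ |s| * (1 + ‖x₀‖ + r) ^ s))
            (g := fun y => ENNReal.ofReal (y ^ τ)) measurable_const (by fun_prop),
            setLIntegral_const, Real.volume_pi_ball _ hr, Fintype.card_fin]
          gcongr
          exact h1d x₀.2 hx₀ r hr
      _ = ENNReal.ofReal (K₁ * (r ^ (d - 1) * r * weightScale s τ x₀ r)) := by
          rw [← ENNReal.ofReal_mul (by positivity), ← ENNReal.ofReal_mul (by positivity)]
          congr 1
          rw [hK₁, weightScale, mul_pow]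
          ring
      _ ≤ _ := by
          refine ENNReal.ofReal_le_ofReal (mul_le_mul_of_nonneg_right ?_ hA.le)
          linarith
  · refine ⟨_, (Metric.isOpen_ball (x := 0) (ε := 3 * r)).measurableSet.prod
      (measurableSet_Ioo (a := 0) (b := 3 * r)), hbox.trans (prod_mono ?_ ?_),
      fun x hx => hx.2.1, ?_⟩
    · refine Metric.ball_subset_ball' ?_
      rw [dist_zero_right]
      have := norm_fst_le x₀
      linarith
    · exact Ioo_subset_Ioo (le_max_left _ _) (by linarith)
    · refine (horigin (3 * r) (by linarith [norm_nonneg x₀])).trans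
        (ENNReal.ofReal_le_ofReal ?_)
      have hs := rpow_le_of_comparable (y := 3 * r) (z := 1 + ‖x₀‖ + r) (k := 3) s
        (by positivity) (by positivity) (by norm_num) (by linarith [norm_nonneg x₀])
        (by linarith)
      have ht := rpow_le_of_comparable (y := 3 * r) (z := x₀.2 + r) (k := 3) τ
        (by positivity) (by positivity) (by norm_num) (by linarith) (by linarith)
      calc _ ≤ C₂ * ((3 * r) ^ (d - 1) * (3 * r) *
            ((3 ^ |s| * (1 + ‖x₀‖ + r) ^ s) * (3 ^ |τ| * (x₀.2 + r) ^ τ))) := by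
            gcongr
        _ = K₂ * (r ^ (d - 1) * r * weightScale s τ x₀ r) := by
            rw [hK₂, weightScale, mul_pow]
            ring
        _ ≤ _ := mul_le_mul_of_nonneg_right (by linarith) hA.le

lemma halfBallMass_eq_top (d : ℕ) (s : ℝ) {τ : ℝ} (hτ : τ ≤ -1) :
    halfBallMass d s τ 0 1 = ⊤ := by
  obtain ⟨C, hC, hpw⟩ := powerWeight_comparable d s τ
  set m : ℝ := ((d - 1 : ℕ) : ℝ) with hm_def
  have hm : 0 ≤ m := Nat.cast_nonneg _
  set P := Metric.ball (0 : Fin (d - 1) → ℝ) (1 / (m + 1)) ×ˢ Ioo (0 : ℝ) (1 / 2) with hP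
  have hPm : MeasurableSet P := Metric.isOpen_ball.measurableSet.prod measurableSet_Ioo
  have hsub : P ⊆ halfBall d 0 1 := by
    refine Subset.trans (prod_mono subset_rfl ?_) (box_subset_halfBall d 0 le_rfl
      (ρ := 1 / (m + 1)) one_pos (by rw [div_mul_cancel₀ _ (by positivity)]))
    simpa using Ioo_subset_Ioc_self
  have hK : (0 : ℝ) < 2 ^ |s| * C := by positivity
  have hpt : ∀ x ∈ P, x.2 ^ τ ≤ 2 ^ |s| * C * powerWeight d s τ x := by
    rintro x ⟨hx1, hx2, hx3⟩
    have hx : ‖x‖ ≤ 1 := by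
      rw [Prod.norm_def, max_le_iff, Real.norm_eq_abs, abs_of_pos hx2]
      refine ⟨(mem_ball_zero_iff.1 hx1).le.trans ?_, by linarith⟩
      rw [div_le_one (by positivity)]
      linarith
    have h1 := rpow_le_of_comparable (y := 1) (z := 1 + ‖x‖) (k := 2) s
      one_pos (by positivity) (by norm_num) (by linarith [norm_nonneg x]) (by linarith)
    rw [Real.one_rpow] at h1
    have h2 : 0 ≤ x.2 ^ τ := Real.rpow_nonneg hx2.le _
    calc x.2 ^ τ ≤ (2 ^ |s| * (1 + ‖x‖) ^ s) * x.2 ^ τ := le_mul_of_one_le_left h2 h1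
      _ = 2 ^ |s| * ((1 + ‖x‖) ^ s * x.2 ^ τ) := by ring
      _ ≤ 2 ^ |s| * (C * powerWeight d s τ x) :=
          mul_le_mul_of_nonneg_left (hpw x hx2).2 (by positivity)
      _ = _ := by ring
  have hle : (⊤ : ℝ≥0∞) ≤ ENNReal.ofReal (2 ^ |s| * C) * halfBallMass d s τ 0 1 :=
    calc (⊤ : ℝ≥0∞) = ∫⁻ x in P, 1 * ENNReal.ofReal (x.2 ^ τ) := by
          rw [hP, setLIntegral_prod_mul _ _ (f := fun _ => 1)
            (g := fun y => ENNReal.ofReal (y ^ τ)) measurable_const (by fun_prop),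
            lintegral_Ioo_rpow_eq_top hτ (by norm_num), setLIntegral_const, one_mul,
            ENNReal.mul_top]
          exact (Metric.measure_ball_pos volume _ (by positivity)).ne'
      _ ≤ ∫⁻ x in P, ENNReal.ofReal (2 ^ |s| * C) * ENNReal.ofReal (powerWeight d s τ x) := by
          refine setLIntegral_mono' hPm fun x hx => ?_
          rw [one_mul, ← ENNReal.ofReal_mul hK.le]
          exact ENNReal.ofReal_le_ofReal (hpt x hx)
      _ = ENNReal.ofReal (2 ^ |s| * C) * ∫⁻ x in P, ENNReal.ofReal (powerWeight d s τ x) :=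
          lintegral_const_mul' _ _ ENNReal.ofReal_ne_top
      _ ≤ _ := by
          gcongr
          exact lintegral_mono_set hsub
  by_contra hne
  exact (ENNReal.mul_ne_top ENNReal.ofReal_ne_top hne) (top_le_iff.1 hle)

lemma measurableSet_cone {n : ℕ} (ρ : ℝ) :
    MeasurableSet {x : (Fin n → ℝ) × ℝ | ‖x.1‖ < x.2 ∧ x.2 ∈ Ioo 1 ρ} :=
  (measurableSet_lt measurable_fst.norm measurable_snd).inter (measurable_snd measurableSet_Ioo)

lemma lintegral_cone_eq {n : ℕ} (e ρ : ℝ) :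
    ∫⁻ x in {x : (Fin n → ℝ) × ℝ | ‖x.1‖ < x.2 ∧ x.2 ∈ Ioo 1 ρ}, ENNReal.ofReal (x.2 ^ e) =
      ∫⁻ y in Ioo 1 ρ, ENNReal.ofReal (y ^ e * (2 * y) ^ n) := by
  have hD := measurableSet_cone (n := n) ρ
  rw [← lintegral_indicator hD, Measure.volume_eq_prod, lintegral_prod_symm' _
    (Measurable.indicator (by fun_prop) hD), ← lintegral_indicator measurableSet_Ioo]
  congr 1
  ext y
  by_cases hy : y ∈ Ioo 1 ρ
  · have hy0 : 0 < y := by linarith [hy.1]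
    have h1 : ∀ v : Fin n → ℝ, indicator {x : (Fin n → ℝ) × ℝ | ‖x.1‖ < x.2 ∧ x.2 ∈ Ioo 1 ρ}
        (fun x => ENNReal.ofReal (x.2 ^ e)) (v, y) =
        indicator (Metric.ball 0 y) (fun _ => ENNReal.ofReal (y ^ e)) v := by
      intro v
      by_cases hv : ‖v‖ < y
      · rw [indicator_of_mem (mem_ball_zero_iff.2 hv), indicator_of_mem]
        exact ⟨hv, hy⟩
      · rw [indicator_of_notMem (fun h => hv (mem_ball_zero_iff.1 h)), indicator_of_notMem]
        exact fun h => hv h.1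
    simp_rw [h1]
    rw [lintegral_indicator Metric.isOpen_ball.measurableSet, setLIntegral_const,
      indicator_of_mem hy, Real.volume_pi_ball _ hy0, Fintype.card_fin,
      ← ENNReal.ofReal_mul (by positivity)]
  · have h1 : ∀ v : Fin n → ℝ, indicator {x : (Fin n → ℝ) × ℝ | ‖x.1‖ < x.2 ∧ x.2 ∈ Ioo 1 ρ}
        (fun x => ENNReal.ofReal (x.2 ^ e)) (v, y) = 0 :=
      fun v => indicator_of_notMem (fun h => hy h.2) _
    simp_rw [h1]
    rw [lintegral_zero, indicator_of_notMem hy]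

lemma ofReal_mul_log_le_halfBallMass (d : ℕ) {s τ : ℝ}
    (hsτ : s + τ ≤ -(((d - 1 : ℕ) : ℝ) + 1)) :
    ∃ c : ℝ, 0 < c ∧ ∀ X : ℝ, 0 ≤ X → ∃ R : ℝ, 0 < R ∧
      ENNReal.ofReal (c * (R ^ (d - 1) * R * weightScale s τ (0 : (Fin (d - 1) → ℝ) × ℝ) R) * X) ≤
        halfBallMass d s τ 0 R := by
  obtain ⟨C, hC, hpw⟩ := powerWeight_comparable d s τ
  set m : ℝ := ((d - 1 : ℕ) : ℝ) with hm_def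
  have hm : 0 ≤ m := Nat.cast_nonneg _
  set K : ℝ := 2 ^ |s| * C with hK
  have hK0 : 0 < K := by positivity
  refine ⟨K⁻¹ * (2 ^ (d - 1) / 2 ^ |s|), by positivity, fun X hX => ?_⟩
  set ρ : ℝ := Real.exp X with hρ
  have hρ1 : 1 ≤ ρ := Real.one_le_exp hX
  set R : ℝ := 2 * (m + 1) * ρ with hR
  have hρR : 2 * ρ ≤ R := by nlinarith
  have hR1 : 1 ≤ R := by linarith
  have hR0 : 0 < R := by linarith
  refine ⟨R, hR0, ?_⟩
  set D := {x : (Fin (d - 1) → ℝ) × ℝ | ‖x.1‖ < x.2 ∧ x.2 ∈ Ioo 1 ρ} with hD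
  have hDm : MeasurableSet D := measurableSet_cone ρ
  have hsub : D ⊆ halfBall d 0 R := by
    refine Subset.trans ?_ (box_subset_halfBall d 0 le_rfl (ρ := ρ) hR0
      (by rw [← hm_def]; nlinarith))
    rintro x ⟨h1, h2, h3⟩
    refine ⟨mem_ball_zero_iff.2 (h1.trans h3), ?_, ?_⟩
    · simp only [Prod.snd_zero]; linarith
    · simp only [Prod.snd_zero]; linarith
  have hpt : ∀ x ∈ D, x.2 ^ (s + τ) ≤ K * powerWeight d s τ x := by
    rintro x ⟨h1, h2, h3⟩
    have hx2 : 0 < x.2 := by linarith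
    have hx : ‖x‖ = x.2 := by
      rw [Prod.norm_def, Real.norm_eq_abs, abs_of_pos hx2, max_eq_right h1.le]
    have h4 := rpow_le_of_comparable (y := x.2) (z := 1 + ‖x‖) (k := 2) s
      hx2 (by positivity) (by norm_num) (by linarith) (by linarith)
    have h5 : 0 ≤ x.2 ^ τ := Real.rpow_nonneg hx2.le _
    calc x.2 ^ (s + τ) ≤ (2 ^ |s| * (1 + ‖x‖) ^ s) * x.2 ^ τ := by
          rw [Real.rpow_add hx2]
          gcongr
      _ = 2 ^ |s| * ((1 + ‖x‖) ^ s * x.2 ^ τ) := by ring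
      _ ≤ 2 ^ |s| * (C * powerWeight d s τ x) :=
          mul_le_mul_of_nonneg_left (hpw x hx2).2 (by positivity)
      _ = _ := by rw [hK]; ring
  have hs := rpow_le_of_comparable (y := 1 + R) (z := R) (k := 2) s
    (by positivity) hR0 (by norm_num) (by linarith) (by linarith)
  have hpow : R ^ (s + τ + m + 1) = R ^ (d - 1) * R * (R ^ s * R ^ τ) := by
    rw [Real.rpow_add_one hR0.ne', Real.rpow_add hR0, Real.rpow_add hR0, hm_def,
      Real.rpow_natCast]
    ring
  calc _ ≤ ENNReal.ofReal (K⁻¹ * (2 ^ (d - 1) * R ^ (s + τ + m + 1)) * X) := by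
        refine ENNReal.ofReal_le_ofReal (mul_le_mul_of_nonneg_right ?_ hX)
        rw [mul_assoc]
        refine mul_le_mul_of_nonneg_left ?_ (by positivity)
        rw [hpow, div_mul_eq_mul_div, div_le_iff₀ (by positivity), weightScale]
        simp only [norm_zero, add_zero, Prod.snd_zero, zero_add]
        calc _ ≤ 2 ^ (d - 1) * (R ^ (d - 1) * R * ((2 ^ |s| * R ^ s) * R ^ τ)) := by gcongr
          _ = _ := by ring
    _ = ENNReal.ofReal (K⁻¹ * (2 ^ (d - 1) * R ^ (s + τ + m + 1))) *
          ∫⁻ y in Ioo 1 ρ, ENNReal.ofReal y⁻¹ := by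
        rw [lintegral_Ioo_inv hρ1, hρ, Real.log_exp, ENNReal.ofReal_mul (by positivity)]
    _ = ∫⁻ y in Ioo 1 ρ, ENNReal.ofReal (K⁻¹ * (2 ^ (d - 1) * R ^ (s + τ + m + 1))) *
          ENNReal.ofReal y⁻¹ := (lintegral_const_mul' _ _ ENNReal.ofReal_ne_top).symm
    _ ≤ ∫⁻ y in Ioo 1 ρ, ENNReal.ofReal K⁻¹ *
          ENNReal.ofReal (y ^ (s + τ) * (2 * y) ^ (d - 1)) := by
        refine setLIntegral_mono' measurableSet_Ioo fun y hy => ?_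
        have hy0 : 0 < y := by linarith [hy.1]
        rw [← ENNReal.ofReal_mul (by positivity), ← ENNReal.ofReal_mul (by positivity)]
        refine ENNReal.ofReal_le_ofReal ?_
        rw [mul_assoc]
        refine mul_le_mul_of_nonneg_left ?_ (by positivity)
        have h1 : R ^ (s + τ + m + 1) ≤ y ^ (s + τ + m + 1) :=
          Real.rpow_le_rpow_of_nonpos hy0 (by linarith [hy.2]) (by linarith)
        calc _ ≤ 2 ^ (d - 1) * y ^ (s + τ + m + 1) * y⁻¹ := by gcongr
          _ = _ := by
            rw [Real.rpow_add_one hy0.ne', Real.rpow_add hy0, hm_def, Real.rpow_natCast, mul_pow]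
            field_simp
    _ = ENNReal.ofReal K⁻¹ * ∫⁻ x in D, ENNReal.ofReal (x.2 ^ (s + τ)) := by
        rw [lintegral_const_mul' _ _ ENNReal.ofReal_ne_top, hD, lintegral_cone_eq]
    _ = ∫⁻ x in D, ENNReal.ofReal K⁻¹ * ENNReal.ofReal (x.2 ^ (s + τ)) :=
        (lintegral_const_mul' _ _ ENNReal.ofReal_ne_top).symm
    _ ≤ ∫⁻ x in D, ENNReal.ofReal (powerWeight d s τ x) := by
        refine setLIntegral_mono' hDm fun x hx => ?_
        rw [← ENNReal.ofReal_mul (by positivity)]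
        refine ENNReal.ofReal_le_ofReal ?_
        rw [inv_mul_le_iff₀ hK0]
        exact hpt x hx
    _ ≤ _ := lintegral_mono_set hsub

/-- The average of `powerWeight d s t` over a half-ball, with respect to `muHalf d γ₀`. -/
noncomputable def halfBallAverage (d : ℕ) (γ₀ s t : ℝ) (x₀ : (Fin (d - 1) → ℝ) × ℝ) (r : ℝ) :
    ℝ≥0∞ :=
  (halfBallMass d 0 γ₀ x₀ r)⁻¹ * halfBallMass d s (t + γ₀) x₀ r

lemma setLIntegral_muHalf_halfBall (d : ℕ) (γ₀ : ℝ) {f : (Fin (d - 1) → ℝ) × ℝ → ℝ≥0∞}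
    (hf : Measurable f) (x₀ : (Fin (d - 1) → ℝ) × ℝ) (r : ℝ) :
    ∫⁻ x in halfBall d x₀ r, f x ∂(muHalf d γ₀) =
      ∫⁻ x in halfBall d x₀ r, ENNReal.ofReal (x.2 ^ γ₀) * f x := by
  have hB := measurableSet_halfBall d x₀ r
  have hsub : halfBall d x₀ r ∩ {x | 0 < x.2} = halfBall d x₀ r :=
    inter_eq_left.2 fun x hx => hx.2
  rw [muHalf, setLIntegral_withDensity_eq_setLIntegral_mul _ (by fun_prop) hf hB,
    Measure.restrict_restrict hB, hsub]
  rfl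

lemma setLIntegral_muHalf_powerWeight (d : ℕ) (γ₀ s t : ℝ) (x₀ : (Fin (d - 1) → ℝ) × ℝ) (r : ℝ) :
    ∫⁻ x in halfBall d x₀ r, ENNReal.ofReal (powerWeight d s t x) ∂(muHalf d γ₀) =
      halfBallMass d s (t + γ₀) x₀ r := by
  rw [setLIntegral_muHalf_halfBall d γ₀ (measurable_powerWeight d s t).ennreal_ofReal]
  refine setLIntegral_congr_fun (measurableSet_halfBall d x₀ r) fun x hx => ?_
  have hx0 : 0 < x.2 := hx.2
  rw [← ENNReal.ofReal_mul (Real.rpow_nonneg hx0.le _), powerWeight, powerWeight,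
    Real.rpow_add hx0]
  congr 1
  ring

lemma muHalf_halfBall (d : ℕ) (γ₀ : ℝ) (x₀ : (Fin (d - 1) → ℝ) × ℝ) (r : ℝ) :
    muHalf d γ₀ (halfBall d x₀ r) = halfBallMass d 0 γ₀ x₀ r := by
  have h := setLIntegral_muHalf_powerWeight d γ₀ 0 0 x₀ r
  rw [zero_add] at h
  rw [← h, ← setLIntegral_one]
  congr 1
  ext x
  simp [powerWeight]

lemma setLIntegral_muHalf_powerWeight_rpow (d : ℕ) (γ₀ s t e : ℝ)
    (x₀ : (Fin (d - 1) → ℝ) × ℝ) (r : ℝ) :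
    ∫⁻ x in halfBall d x₀ r, ENNReal.ofReal (powerWeight d s t x ^ e) ∂(muHalf d γ₀) =
      halfBallMass d (s * e) (t * e + γ₀) x₀ r := by
  rw [← setLIntegral_muHalf_powerWeight]
  refine setLIntegral_congr_fun (measurableSet_halfBall d x₀ r) fun x hx => ?_
  have hx0 : 0 < x.2 := hx.2
  have hQ : 0 ≤ 1 + ((∑ i, x.1 i ^ 2) + x.2 ^ 2) := by positivity
  simp only [powerWeight]
  rw [Real.mul_rpow (Real.rpow_nonneg hQ _) (Real.rpow_nonneg hx0.le _), ← Real.rpow_mul hQ,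
    ← Real.rpow_mul hx0.le, div_mul_eq_mul_div]

lemma ApCharacteristic_eq_iSup_halfBallAverage (d : ℕ) (γ₀ p a b : ℝ) :
    ApCharacteristic d γ₀ p a b =
      ⨆ (r : ℝ) (_ : 0 < r) (x₀ : (Fin (d - 1) → ℝ) × ℝ) (_ : 0 ≤ x₀.2),
        halfBallAverage d γ₀ a b x₀ r *
          halfBallAverage d γ₀ (a * -(1 / (p - 1))) (b * -(1 / (p - 1))) x₀ r ^ (p - 1) := by
  simp only [ApCharacteristic, halfBallAverage, muHalf_halfBall, setLIntegral_muHalf_powerWeight,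
    setLIntegral_muHalf_powerWeight_rpow]

lemma weightScale_add {n : ℕ} (s t γ₀ : ℝ) {x₀ : (Fin n → ℝ) × ℝ} (hx₀ : 0 ≤ x₀.2) {r : ℝ}
    (hr : 0 < r) : weightScale s (t + γ₀) x₀ r = weightScale s t x₀ r * weightScale 0 γ₀ x₀ r := by
  unfold weightScale
  rw [Real.rpow_add (by positivity), Real.rpow_zero]
  ring

lemma weightScale_mul_rpow {n : ℕ} (s t : ℝ) {q : ℝ} (hq : q ≠ 0) {x₀ : (Fin n → ℝ) × ℝ}
    (hx₀ : 0 ≤ x₀.2) {r : ℝ} (hr : 0 < r) :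
    weightScale s t x₀ r * weightScale (s * -(1 / q)) (t * -(1 / q)) x₀ r ^ q = 1 := by
  have hM : 0 < 1 + ‖x₀‖ + r := by positivity
  have hh : 0 < x₀.2 + r := by positivity
  unfold weightScale
  rw [Real.mul_rpow (by positivity) (by positivity), ← Real.rpow_mul hM.le,
    ← Real.rpow_mul hh.le, mul_mul_mul_comm, ← Real.rpow_add hM, ← Real.rpow_add hh]
  have h1 : ∀ u : ℝ, u + u * -(1 / q) * q = 0 := fun u => by field_simp; ring
  rw [h1, h1, Real.rpow_zero, Real.rpow_zero, one_mul]

lemma inv_mul_le_ofReal_div {m₀ m₁ : ℝ≥0∞} {A B : ℝ} (hA : 0 < A)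
    (h₀ : ENNReal.ofReal A ≤ m₀) (h₁ : m₁ ≤ ENNReal.ofReal B) :
    m₀⁻¹ * m₁ ≤ ENNReal.ofReal (B / A) := by
  rw [div_eq_inv_mul, ENNReal.ofReal_mul (by positivity), ENNReal.ofReal_inv_of_pos hA]
  gcongr

lemma ofReal_div_le_inv_mul {m₀ m₁ : ℝ≥0∞} {A B : ℝ} (hA : 0 < A)
    (h₀ : m₀ ≤ ENNReal.ofReal A) (h₁ : ENNReal.ofReal B ≤ m₁) :
    ENNReal.ofReal (B / A) ≤ m₀⁻¹ * m₁ := by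
  rw [div_eq_inv_mul, ENNReal.ofReal_mul (by positivity), ENNReal.ofReal_inv_of_pos hA]
  gcongr

lemma halfBallMass_zero_le_ofReal (d : ℕ) {γ₀ : ℝ} (hγ₀ : -1 < γ₀) :
    ∃ C : ℝ, 0 < C ∧ ∀ x₀ : (Fin (d - 1) → ℝ) × ℝ, 0 ≤ x₀.2 → ∀ r : ℝ, 0 < r →
      halfBallMass d 0 γ₀ x₀ r ≤
        ENNReal.ofReal (C * (r ^ (d - 1) * r * weightScale 0 γ₀ x₀ r)) := by
  have hm : (0 : ℝ) ≤ ((d - 1 : ℕ) : ℝ) := Nat.cast_nonneg _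
  exact halfBallMass_le_ofReal d hγ₀ (by linarith)

lemma halfBallAverage_le_ofReal (d : ℕ) {γ₀ s t : ℝ} (ht : -(1 + γ₀) < t)
    (hst : -(((d - 1 : ℕ) : ℝ) + 1 + γ₀) < s + t) :
    ∃ C : ℝ, 0 < C ∧ ∀ x₀ : (Fin (d - 1) → ℝ) × ℝ, 0 ≤ x₀.2 → ∀ r : ℝ, 0 < r →
      halfBallAverage d γ₀ s t x₀ r ≤ ENNReal.ofReal (C * weightScale s t x₀ r) := by
  obtain ⟨c, hc, hlow⟩ := ofReal_le_halfBallMass d 0 γ₀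
  obtain ⟨C, hC, hup⟩ := halfBallMass_le_ofReal d (s := s) (τ := t + γ₀) (by linarith)
    (by linarith)
  refine ⟨C / c, by positivity, fun x₀ hx₀ r hr => ?_⟩
  have h0 := weightScale_pos 0 γ₀ hx₀ hr
  have h1 := weightScale_pos s (t + γ₀) hx₀ hr
  refine (inv_mul_le_ofReal_div (by positivity) (hlow x₀ hx₀ r hr)
    (hup x₀ hx₀ r hr)).trans_eq ?_
  rw [weightScale_add s t γ₀ hx₀ hr]
  congr 1
  field_simp

lemma ofReal_le_halfBallAverage (d : ℕ) {γ₀ : ℝ} (hγ₀ : -1 < γ₀) (s t : ℝ) :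
    ∃ c : ℝ, 0 < c ∧ ∀ x₀ : (Fin (d - 1) → ℝ) × ℝ, 0 ≤ x₀.2 → ∀ r : ℝ, 0 < r →
      ENNReal.ofReal (c * weightScale s t x₀ r) ≤ halfBallAverage d γ₀ s t x₀ r := by
  obtain ⟨c, hc, hlow⟩ := ofReal_le_halfBallMass d s (t + γ₀)
  obtain ⟨C, hC, hup⟩ := halfBallMass_zero_le_ofReal d hγ₀
  refine ⟨c / C, by positivity, fun x₀ hx₀ r hr => ?_⟩
  have h0 := weightScale_pos 0 γ₀ hx₀ hr
  refine Eq.trans_le ?_ (ofReal_div_le_inv_mul (by positivity) (hup x₀ hx₀ r hr)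
    (hlow x₀ hx₀ r hr))
  rw [weightScale_add s t γ₀ hx₀ hr]
  congr 1
  field_simp

lemma halfBallAverage_ne_zero (d : ℕ) {γ₀ : ℝ} (hγ₀ : -1 < γ₀) (s t : ℝ)
    {x₀ : (Fin (d - 1) → ℝ) × ℝ} (hx₀ : 0 ≤ x₀.2) {r : ℝ} (hr : 0 < r) :
    halfBallAverage d γ₀ s t x₀ r ≠ 0 := by
  obtain ⟨c, hc, h⟩ := ofReal_le_halfBallAverage d hγ₀ s t
  have := weightScale_pos s t hx₀ hr
  exact ((ENNReal.ofReal_pos.2 (by positivity)).trans_le (h x₀ hx₀ r hr)).ne'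

lemma halfBallAverage_eq_top (d : ℕ) {γ₀ : ℝ} (hγ₀ : -1 < γ₀) (s : ℝ) {t : ℝ}
    (ht : t ≤ -(1 + γ₀)) : halfBallAverage d γ₀ s t 0 1 = ⊤ := by
  obtain ⟨C, hC, hup⟩ := halfBallMass_zero_le_ofReal d hγ₀
  rw [halfBallAverage, halfBallMass_eq_top d s (by linarith), ENNReal.mul_top]
  exact ENNReal.inv_ne_zero.2 (ne_top_of_le_ne_top ENNReal.ofReal_ne_top (hup 0 le_rfl 1 one_pos))

/-- At and beyond the critical exponent, averages over large half-balls exceed `weightScale` by an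
arbitrarily large factor. -/
lemma exists_ofReal_le_halfBallAverage (d : ℕ) {γ₀ s t : ℝ} (hγ₀ : -1 < γ₀)
    (hst : s + t ≤ -(((d - 1 : ℕ) : ℝ) + 1 + γ₀)) (X : ℝ) (hX : 0 ≤ X) :
    ∃ R : ℝ, 0 < R ∧ ENNReal.ofReal (X * weightScale s t (0 : (Fin (d - 1) → ℝ) × ℝ) R) ≤
      halfBallAverage d γ₀ s t 0 R := by
  obtain ⟨c, hc, hlow⟩ := ofReal_mul_log_le_halfBallMass d (s := s) (τ := t + γ₀) (by linarith)
  obtain ⟨C, hC, hup⟩ := halfBallMass_zero_le_ofReal d hγ₀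
  obtain ⟨R, hR, h⟩ := hlow (C * X / c) (by positivity)
  refine ⟨R, hR, ?_⟩
  have h0 := weightScale_pos 0 γ₀ (x₀ := (0 : (Fin (d - 1) → ℝ) × ℝ)) le_rfl hR
  refine Eq.trans_le ?_ (ofReal_div_le_inv_mul (by positivity) (hup 0 le_rfl R hR) h)
  rw [weightScale_add s t γ₀ (x₀ := (0 : (Fin (d - 1) → ℝ) × ℝ)) le_rfl hR]
  congr 1
  field_simp

/-- Characterization of the parameters `a, b` for which
`(1 + |x|²)^{a/2} x_d^b ∈ A_p(ℝ^d_+, x_d^{γ₀} dx)`. -/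
theorem powerWeight_Ap_iff (d : ℕ) (hd : 2 ≤ d) (γ₀ p a b : ℝ)
    (hγ₀ : -1 < γ₀) (hp : 1 < p) :
    ApCharacteristic d γ₀ p a b < ⊤ ↔
      (-(1 + γ₀) < b ∧ b < (1 + γ₀) * (p - 1) ∧
        -((d : ℝ) + γ₀) < a + b ∧ a + b < ((d : ℝ) + γ₀) * (p - 1)) := by
  have hq : 0 < p - 1 := by linarith
  set q := p - 1 with hq_def
  have hdm : (d : ℝ) = ((d - 1 : ℕ) : ℝ) + 1 := by
    rw [Nat.cast_sub (by omega)]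
    simp
  have hdual : ∀ u v : ℝ, -v < u * -(1 / q) ↔ u < v * q := fun u v => by
    rw [mul_neg, neg_lt_neg_iff, mul_one_div, div_lt_iff₀ hq]
  rw [ApCharacteristic_eq_iSup_halfBallAverage, ← hq_def, hdm, ← hdual b, ← hdual (a + b), add_mul a]
  set a' := a * -(1 / q) with ha'
  set b' := b * -(1 / q) with hb'
  constructor
  · intro hfin
    have hterm : ∀ R : ℝ, 0 < R →
        halfBallAverage d γ₀ a b 0 R * halfBallAverage d γ₀ a' b' 0 R ^ q < ⊤ ∧
        halfBallAverage d γ₀ a b 0 R * halfBallAverage d γ₀ a' b' 0 R ^ q ≤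
          ⨆ (r : ℝ) (_ : 0 < r) (x₀ : (Fin (d - 1) → ℝ) × ℝ) (_ : 0 ≤ x₀.2),
            halfBallAverage d γ₀ a b x₀ r * halfBallAverage d γ₀ a' b' x₀ r ^ q := by
      intro R hR
      have h := le_iSup₂_of_le (f := fun (r : ℝ) (_ : 0 < r) =>
        ⨆ (x₀ : (Fin (d - 1) → ℝ) × ℝ) (_ : 0 ≤ x₀.2),
          halfBallAverage d γ₀ a b x₀ r * halfBallAverage d γ₀ a' b' x₀ r ^ q) R hR
        (le_iSup₂_of_le (f := fun (x₀ : (Fin (d - 1) → ℝ) × ℝ) (_ : 0 ≤ x₀.2) =>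
          halfBallAverage d γ₀ a b x₀ R * halfBallAverage d γ₀ a' b' x₀ R ^ q) 0 le_rfl le_rfl)
      exact ⟨h.trans_lt hfin, h⟩
    set L := ⨆ (r : ℝ) (_ : 0 < r) (x₀ : (Fin (d - 1) → ℝ) × ℝ) (_ : 0 ≤ x₀.2),
      halfBallAverage d γ₀ a b x₀ r * halfBallAverage d γ₀ a' b' x₀ r ^ q with hL
    have hLreal : L = ENNReal.ofReal L.toReal := (ENNReal.ofReal_toReal hfin.ne).symm
    have hL0 : 0 ≤ L.toReal := ENNReal.toReal_nonneg
    obtain ⟨c, hc, hlow⟩ := ofReal_le_halfBallAverage d hγ₀ a b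
    obtain ⟨c', hc', hlow'⟩ := ofReal_le_halfBallAverage d hγ₀ a' b'
    have hbound : ∀ R : ℝ, 0 < R → ∀ X Y : ℝ, 0 ≤ X → 0 ≤ Y →
        ENNReal.ofReal (X * weightScale a b (0 : (Fin (d - 1) → ℝ) × ℝ) R) ≤
          halfBallAverage d γ₀ a b 0 R →
        ENNReal.ofReal (Y * weightScale a' b' (0 : (Fin (d - 1) → ℝ) × ℝ) R) ≤
          halfBallAverage d γ₀ a' b' 0 R → X * Y ^ q ≤ L.toReal := by
      intro R hR X Y hX hY h h'
      have hW := weightScale_pos a b (x₀ := (0 : (Fin (d - 1) → ℝ) × ℝ)) le_rfl hR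
      have hW' := weightScale_pos a' b' (x₀ := (0 : (Fin (d - 1) → ℝ) × ℝ)) le_rfl hR
      have h1 := (mul_le_mul' h (ENNReal.rpow_le_rpow h' hq.le)).trans (hterm R hR).2
      rw [hLreal, ENNReal.ofReal_rpow_of_nonneg (by positivity) hq.le,
        ← ENNReal.ofReal_mul (by positivity), ENNReal.ofReal_le_ofReal_iff hL0,
        Real.mul_rpow hY hW'.le, mul_mul_mul_comm,
        weightScale_mul_rpow a b hq.ne' (x₀ := (0 : (Fin (d - 1) → ℝ) × ℝ)) le_rfl hR,
        mul_one] at h1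
      exact h1
    refine ⟨?_, ?_, ?_, ?_⟩ <;> by_contra! hcon
    · refine (hterm 1 one_pos).1.ne ?_
      rw [halfBallAverage_eq_top d hγ₀ a hcon, ENNReal.top_mul]
      intro h0
      rcases ENNReal.rpow_eq_zero_iff.1 h0 with h | h
      · exact halfBallAverage_ne_zero d hγ₀ a' b' le_rfl one_pos h.1
      · linarith [h.2]
    · refine (hterm 1 one_pos).1.ne ?_
      rw [halfBallAverage_eq_top d hγ₀ a' hcon, ENNReal.top_rpow_of_pos hq, ENNReal.mul_top]
      exact halfBallAverage_ne_zero d hγ₀ a b le_rfl one_pos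
    · obtain ⟨R, hR, h⟩ := exists_ofReal_le_halfBallAverage d hγ₀ hcon
        ((L.toReal + 1) / c' ^ q) (by positivity)
      have := hbound R hR _ c' (by positivity) hc'.le h (hlow' 0 le_rfl R hR)
      rw [div_mul_cancel₀ _ (by positivity)] at this
      linarith
    · obtain ⟨R, hR, h⟩ := exists_ofReal_le_halfBallAverage d hγ₀ hcon
        (((L.toReal + 1) / c) ^ (1 / q)) (by positivity)
      have := hbound R hR c _ hc.le (by positivity) (hlow 0 le_rfl R hR) h
      rw [← Real.rpow_mul (by positivity), one_div_mul_cancel hq.ne', Real.rpow_one,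
        mul_div_cancel₀ _ hc.ne'] at this
      linarith
  · rintro ⟨h1, h2, h3, h4⟩
    obtain ⟨C, hC, hup⟩ := halfBallAverage_le_ofReal d h1 h3
    obtain ⟨C', hC', hup'⟩ := halfBallAverage_le_ofReal d h2 h4
    refine lt_of_le_of_lt (b := ENNReal.ofReal (C * C' ^ q)) ?_ ENNReal.ofReal_lt_top
    refine iSup₂_le fun r hr => iSup₂_le fun x₀ hx₀ => ?_
    have hW := weightScale_pos a b hx₀ hr
    have hW' := weightScale_pos a' b' hx₀ hr
    refine (mul_le_mul' (hup x₀ hx₀ r hr)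
      (ENNReal.rpow_le_rpow (hup' x₀ hx₀ r hr) hq.le)).trans_eq ?_
    rw [ENNReal.ofReal_rpow_of_nonneg (by positivity) hq.le,
      ← ENNReal.ofReal_mul (by positivity), Real.mul_rpow hC'.le hW'.le, mul_mul_mul_comm,
      weightScale_mul_rpow a b hq.ne' hx₀ hr, mul_one]
end

section
/- Let d ≥ 2 and α < 1. For τ > 0, x_d > 0 and z' ∈ ℝ^{d-1}, define Q^α_{x_d}(τ, z') = (4^{(d−α)/2} π^{(d−1)/2} Γ((1−α)/2))^{−1} · x_d^{1−α} · τ^{−(d−α)/2−1} · exp(−(x_d² + |z'|²)/(4τ)). Then: (a) for all τ > 0, x_d > 0, z' ∈ ℝ^{d-1}, ∂_τ Q^α_{x_d}(τ,z') = Δ_{z'} Q^α_{x_d}(τ,z') + ∂²_{x_d} Q^α_{x_d}(τ,z') + (α/x_d) ∂_{x_d} Q^α_{x_d}(τ,z'); (b) for all x_d > 0, ∫_0^∞ ∫_{ℝ^{d-1}} Q^α_{x_d}(τ,z') dz' dτ = 1; (c) for every δ > 0, lim_{x_d → 0⁺} ∫∫_{{(τ,z') : |z'| + τ ≥ δ}}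 Q^α_{x_d}(τ,z') dz' dτ = 0. -/
open MeasureTheory Set ENNReal Filter

/-- The degenerate extension kernel `Q^α_{x_d}(τ, z')`. -/
noncomputable def Qker (d : ℕ) (α xd τ : ℝ) (z' : Fin (d - 1) → ℝ) : ℝ :=
  ((4 : ℝ) ^ (((d : ℝ) - α) / 2) * Real.pi ^ (((d : ℝ) - 1) / 2) *
      Real.Gamma ((1 - α) / 2))⁻¹ *
    (xd ^ (1 - α) * (τ ^ (((d : ℝ) - α) / 2 + 1))⁻¹) *
    Real.exp (-(xd ^ 2 + ∑ i, z' i ^ 2) / (4 * τ))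

/-- The normalization constant of the kernel. -/
noncomputable def QkerConst (d : ℕ) (α : ℝ) : ℝ :=
  ((4 : ℝ) ^ (((d : ℝ) - α) / 2) * Real.pi ^ (((d : ℝ) - 1) / 2) *
    Real.Gamma ((1 - α) / 2))⁻¹

lemma hasDerivAt_Qker_time (d : ℕ) (α xd : ℝ) (z' : Fin (d - 1) → ℝ) {τ : ℝ} (hτ : 0 < τ) :
    HasDerivAt (fun t => Qker d α xd t z')
      (Qker d α xd τ z' *
        (-(((d : ℝ) - α) / 2 + 1) / τ + (xd ^ 2 + ∑ i, z' i ^ 2) / (4 * τ ^ 2))) τ := by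
  have h1 : HasDerivAt (fun t : ℝ => (t ^ (((d : ℝ) - α) / 2 + 1))⁻¹) _ τ :=
    (Real.hasDerivAt_rpow_const (p := ((d : ℝ) - α) / 2 + 1) (Or.inl hτ.ne')).inv
      (Real.rpow_pos_of_pos hτ _).ne'
  have h2 : HasDerivAt (fun t : ℝ => -(xd ^ 2 + ∑ i, z' i ^ 2) / (4 * t)) _ τ :=
    (hasDerivAt_const τ (-(xd ^ 2 + ∑ i, z' i ^ 2))).div ((hasDerivAt_id τ).const_mul 4)
      (by simp [hτ.ne'])
  have h3 := ((h1.const_mul (xd ^ (1 - α))).const_mul (QkerConst d α)).mul h2.exp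
  refine h3.congr_deriv ?_
  have hp := (Real.rpow_pos_of_pos hτ (((d : ℝ) - α) / 2 + 1)).ne'
  simp only [Qker, QkerConst]
  rw [Real.rpow_sub_one hτ.ne']
  generalize ((4 : ℝ) ^ (((d : ℝ) - α) / 2) * Real.pi ^ (((d : ℝ) - 1) / 2) *
    Real.Gamma ((1 - α) / 2))⁻¹ = K
  generalize Real.exp _ = e
  generalize τ ^ (((d : ℝ) - α) / 2 + 1) = P at *
  field_simp
  ring

lemma hasDerivAt_Qker_normal (d : ℕ) (α τ : ℝ) (z' : Fin (d - 1) → ℝ) {y : ℝ} (hy : 0 < y) :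
    HasDerivAt (fun y => Qker d α y τ z')
      (Qker d α y τ z' * ((1 - α) / y - y / (2 * τ))) y := by
  have h1 := Real.hasDerivAt_rpow_const (p := 1 - α) (Or.inl hy.ne')
  have h2 : HasDerivAt (fun y : ℝ => -(y ^ 2 + ∑ i, z' i ^ 2) / (4 * τ)) _ y :=
    ((((hasDerivAt_id y).pow 2).add_const (∑ i, z' i ^ 2)).neg).div_const (4 * τ)
  have h3 := ((h1.mul_const (τ ^ (((d : ℝ) - α) / 2 + 1))⁻¹).const_mul (QkerConst d α)).mul h2.exp
  refine h3.congr_deriv ?_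
  simp only [Qker, QkerConst, id]
  rw [Real.rpow_sub_one hy.ne']
  generalize ((4 : ℝ) ^ (((d : ℝ) - α) / 2) * Real.pi ^ (((d : ℝ) - 1) / 2) *
    Real.Gamma ((1 - α) / 2))⁻¹ = K
  generalize Real.exp _ = e
  generalize (τ ^ (((d : ℝ) - α) / 2 + 1))⁻¹ = P
  field_simp
  ring

lemma hasDerivAt_Qker_tangential (d : ℕ) (α xd τ : ℝ) (z' : Fin (d - 1) → ℝ)
    (i : Fin (d - 1)) (s : ℝ) :
    HasDerivAt (fun s => Qker d α xd τ (Function.update z' i s))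
      (Qker d α xd τ (Function.update z' i s) * (-s / (2 * τ))) s := by
  have hsum : ∀ s, ∑ j, Function.update z' i s j ^ 2
      = s ^ 2 + ∑ j ∈ Finset.univ.erase i, z' j ^ 2 := fun s => by
    rw [← Finset.add_sum_erase _ _ (Finset.mem_univ i)]
    congr 1
    · simp
    · refine Finset.sum_congr rfl fun j hj => ?_
      rw [Function.update_of_ne (Finset.ne_of_mem_erase hj)]
  simp only [Qker, hsum]
  have h2 : HasDerivAt (fun s : ℝ =>
      -(xd ^ 2 + (s ^ 2 + ∑ j ∈ Finset.univ.erase i, z' j ^ 2)) / (4 * τ)) _ s :=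
    (((((hasDerivAt_id s).pow 2).add_const
      (∑ j ∈ Finset.univ.erase i, z' j ^ 2)).const_add (xd ^ 2)).neg).div_const (4 * τ)
  refine (h2.exp.const_mul _).congr_deriv ?_
  simp only [id]
  field_simp
  ring

lemma deriv_deriv_Qker_normal (d : ℕ) (α τ : ℝ) (z' : Fin (d - 1) → ℝ) {y : ℝ} (hy : 0 < y) :
    deriv (deriv (fun y => Qker d α y τ z')) y
      = Qker d α y τ z' *
        (((1 - α) / y - y / (2 * τ)) ^ 2 - (1 - α) / y ^ 2 - 1 / (2 * τ)) := by
  have heq : deriv (fun y => Qker d α y τ z') =ᶠ[nhds y]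
      fun y => Qker d α y τ z' * ((1 - α) / y - y / (2 * τ)) := by
    filter_upwards [Ioi_mem_nhds hy] with x hx
    exact (hasDerivAt_Qker_normal d α τ z' hx).deriv
  rw [heq.deriv_eq]
  have h1 : HasDerivAt (fun y : ℝ => (1 - α) / y - y / (2 * τ)) _ y :=
    ((hasDerivAt_const y (1 - α)).div (hasDerivAt_id y) hy.ne').sub
      ((hasDerivAt_id y).div_const (2 * τ))
  refine ((hasDerivAt_Qker_normal d α τ z' hy).mul h1).deriv.trans ?_
  simp only [id]
  ring

lemma deriv_deriv_Qker_tangential (d : ℕ) (α xd τ : ℝ) (z' : Fin (d - 1) → ℝ)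
    (i : Fin (d - 1)) :
    deriv (deriv (fun s => Qker d α xd τ (Function.update z' i s))) (z' i)
      = Qker d α xd τ z' * (z' i ^ 2 / (4 * τ ^ 2) - 1 / (2 * τ)) := by
  have heq : deriv (fun s => Qker d α xd τ (Function.update z' i s)) =
      fun s => Qker d α xd τ (Function.update z' i s) * (-s / (2 * τ)) :=
    funext fun s => (hasDerivAt_Qker_tangential d α xd τ z' i s).deriv
  rw [heq]
  have h1 : HasDerivAt (fun s : ℝ => -s / (2 * τ)) _ (z' i) :=
    (hasDerivAt_id (z' i)).neg.div_const (2 * τ)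
  refine ((hasDerivAt_Qker_tangential d α xd τ z' i (z' i)).mul h1).deriv.trans ?_
  rw [Function.update_eq_self]
  ring

lemma Qker_equation {d : ℕ} (hd : 1 ≤ d) (α : ℝ) {τ xd : ℝ} (z' : Fin (d - 1) → ℝ)
    (hτ : 0 < τ) (hx : 0 < xd) :
    deriv (fun t => Qker d α xd t z') τ
      = (∑ i, deriv (deriv (fun s => Qker d α xd τ (Function.update z' i s))) (z' i))
        + deriv (deriv (fun y => Qker d α y τ z')) xd
        + α / xd * deriv (fun y => Qker d α y τ z') xd := by
  rw [(hasDerivAt_Qker_time d α xd z' hτ).deriv, deriv_deriv_Qker_normal d α τ z' hx,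
    (hasDerivAt_Qker_normal d α τ z' hx).deriv]
  simp only [deriv_deriv_Qker_tangential]
  rw [← Finset.mul_sum, Finset.sum_sub_distrib, ← Finset.sum_div, Finset.sum_const,
    Finset.card_univ, Fintype.card_fin, nsmul_eq_mul, Nat.cast_sub hd]
  push_cast
  field_simp
  ring

/-- The Gaussian integral on `ι → ℝ`. -/
lemma lintegral_exp_neg_mul_sum_sq {ι : Type*} [Fintype ι] {b : ℝ} (hb : 0 < b) :
    ∫⁻ z : ι → ℝ, ENNReal.ofReal (Real.exp (-b * ∑ i, z i ^ 2))
      = ENNReal.ofReal ((Real.pi / b) ^ ((Fintype.card ι : ℝ) / 2)) := by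
  have hprod : ∀ z : ι → ℝ, Real.exp (-b * ∑ i, z i ^ 2) = ∏ i, Real.exp (-b * z i ^ 2) :=
    fun z => by rw [Finset.mul_sum, Real.exp_sum]
  simp only [hprod]
  rw [← ofReal_integral_eq_lintegral_ofReal]
  · rw [integral_fintype_prod_volume_eq_prod (fun _ x => Real.exp (-b * x ^ 2))]
    simp only [integral_gaussian, Finset.prod_const, Finset.card_univ]
    rw [Real.sqrt_eq_rpow, ← Real.rpow_natCast, ← Real.rpow_mul (by positivity)]
    congr 2
    ring
  · exact Integrable.fintype_prod (fun _ => integrable_exp_neg_mul_sq hb)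
  · exact ae_of_all _ fun z => Finset.prod_nonneg fun i _ => (Real.exp_pos _).le

lemma lintegral_inverse_gamma {s a : ℝ} (hs : 0 < s) (ha : 0 < a) :
    ∫⁻ τ in Ioi (0 : ℝ), ENNReal.ofReal (τ ^ (-s - 1) * Real.exp (-a / τ))
      = ENNReal.ofReal ((1 / a) ^ s * Real.Gamma s) := by
  have hint : IntegrableOn (fun t : ℝ => t ^ (s - 1) * Real.exp (-(a * t))) (Ioi 0) := by
    simpa [neg_mul] using
      integrableOn_rpow_mul_exp_neg_mul_rpow (p := 1) (s := s - 1) (b := a) (by linarith) one_pos ha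
  have hcongr : EqOn (fun x : ℝ => (|(-1 : ℝ)| * x ^ ((-1 : ℝ) - 1)) •
      ((x ^ (-1 : ℝ)) ^ (s - 1) * Real.exp (-(a * x ^ (-1 : ℝ)))))
      (fun τ => τ ^ (-s - 1) * Real.exp (-a / τ)) (Ioi 0) := fun x hx => by
    have hx' : (0 : ℝ) < x := hx
    simp only [abs_neg, abs_one, one_mul, smul_eq_mul]
    rw [← Real.rpow_mul hx'.le, ← mul_assoc, ← Real.rpow_add hx', Real.rpow_neg_one]
    congr 2
    · ring
    · rw [div_eq_mul_inv, neg_mul]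
  have hint' := (integrableOn_Ioi_comp_rpow_iff
    (fun t : ℝ => t ^ (s - 1) * Real.exp (-(a * t))) (by norm_num : (-1 : ℝ) ≠ 0)).2 hint
  rw [← Real.integral_rpow_mul_exp_neg_mul_Ioi hs ha,
    ← integral_comp_rpow_Ioi (fun t : ℝ => t ^ (s - 1) * Real.exp (-(a * t)))
      (by norm_num : (-1 : ℝ) ≠ 0),
    setIntegral_congr_fun measurableSet_Ioi hcongr, ofReal_integral_eq_lintegral_ofReal]
  · exact hint'.congr_fun hcongr measurableSet_Ioi
  · filter_upwards [ae_restrict_mem measurableSet_Ioi] with τ hτ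
    have : (0 : ℝ) < τ := hτ
    positivity

/-- Integral of `τ ^ (-(s + 1 + n / 2)) exp (-b (c + |z|²) / τ)`, where `n` is the dimension. -/
lemma lintegral_lintegral_rpow_mul_exp {ι : Type*} [Fintype ι] {b c s : ℝ} (hb : 0 < b)
    (hc : 0 < c) (hs : 0 < s) :
    ∫⁻ τ in Ioi (0 : ℝ), ∫⁻ z : ι → ℝ, ENNReal.ofReal
        ((τ ^ (s + 1 + (Fintype.card ι : ℝ) / 2))⁻¹ * Real.exp (-(b * (c + ∑ i, z i ^ 2)) / τ))
      = ENNReal.ofReal ((Real.pi / b) ^ ((Fintype.card ι : ℝ) / 2) *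
          ((1 / (b * c)) ^ s * Real.Gamma s)) := by
  rw [ENNReal.ofReal_mul (by positivity), ← lintegral_inverse_gamma hs (mul_pos hb hc),
    ← lintegral_const_mul' _ _ ENNReal.ofReal_ne_top]
  refine setLIntegral_congr_fun measurableSet_Ioi fun τ hτ => ?_
  have hτ' : (0 : ℝ) < τ := hτ
  have hsplit : ∀ z : ι → ℝ, ENNReal.ofReal
      ((τ ^ (s + 1 + (Fintype.card ι : ℝ) / 2))⁻¹ * Real.exp (-(b * (c + ∑ i, z i ^ 2)) / τ))
      = ENNReal.ofReal ((τ ^ (s + 1 + (Fintype.card ι : ℝ) / 2))⁻¹ * Real.exp (-(b * c) / τ)) *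
        ENNReal.ofReal (Real.exp (-(b / τ) * ∑ i, z i ^ 2)) := fun z => by
    rw [← ENNReal.ofReal_mul (by positivity), mul_assoc, ← Real.exp_add]
    congr 3
    ring
  simp only [hsplit]
  rw [lintegral_const_mul' _ _ ENNReal.ofReal_ne_top, lintegral_exp_neg_mul_sum_sq (by positivity),
    ← ENNReal.ofReal_mul (by positivity), ← ENNReal.ofReal_mul (by positivity)]
  congr 1
  rw [div_div_eq_mul_div, mul_div_right_comm, Real.mul_rpow (by positivity) hτ'.le,
    Real.rpow_add hτ', show -s - 1 = -(s + 1) by ring, Real.rpow_neg hτ'.le]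
  have := (Real.rpow_pos_of_pos hτ' ((Fintype.card ι : ℝ) / 2)).ne'
  field_simp

lemma QkerConst_pos (d : ℕ) {α : ℝ} (hα : α < 1) : 0 < QkerConst d α := by
  have := Real.Gamma_pos_of_pos (show 0 < (1 - α) / 2 by linarith)
  unfold QkerConst
  positivity

lemma rpow_exponent_eq {d : ℕ} (hd : 1 ≤ d) (α : ℝ) :
    ((d : ℝ) - α) / 2 + 1 = (1 - α) / 2 + 1 + (Fintype.card (Fin (d - 1)) : ℝ) / 2 := by
  rw [Fintype.card_fin, Nat.cast_sub hd]
  push_cast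
  ring

lemma lintegral_Qker {d : ℕ} (hd : 1 ≤ d) {α : ℝ} (hα : α < 1) {xd : ℝ} (hx : 0 < xd) :
    ∫⁻ τ in Ioi (0 : ℝ), ∫⁻ z' : Fin (d - 1) → ℝ, ENNReal.ofReal (Qker d α xd τ z') = 1 := by
  have hK := QkerConst_pos d hα
  have hs : 0 < (1 - α) / 2 := by linarith
  have hG := Real.Gamma_pos_of_pos hs
  have hQ : ∀ (τ : ℝ) (z' : Fin (d - 1) → ℝ), ENNReal.ofReal (Qker d α xd τ z')
      = ENNReal.ofReal (QkerConst d α * xd ^ (1 - α)) * ENNReal.ofReal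
        ((τ ^ ((1 - α) / 2 + 1 + (Fintype.card (Fin (d - 1)) : ℝ) / 2))⁻¹ *
          Real.exp (-(1 / 4 * (xd ^ 2 + ∑ i, z' i ^ 2)) / τ)) := fun τ z' => by
    rw [← ENNReal.ofReal_mul (by positivity), ← rpow_exponent_eq hd, Qker, ← QkerConst]
    congr 1
    rw [show -(xd ^ 2 + ∑ i, z' i ^ 2) / (4 * τ) = -(1 / 4 * (xd ^ 2 + ∑ i, z' i ^ 2)) / τ by
      rw [← div_div]; ring]
    ring
  simp only [hQ]
  simp_rw [lintegral_const_mul' _ _ ENNReal.ofReal_ne_top]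
  rw [lintegral_lintegral_rpow_mul_exp (by norm_num) (by positivity) hs,
    ← ENNReal.ofReal_mul (by positivity), ENNReal.ofReal_eq_one, Fintype.card_fin,
    Nat.cast_sub hd]
  have h4 : (4 : ℝ) ^ (((d : ℝ) - α) / 2) =
      4 ^ (((d : ℝ) - 1) / 2) * 4 ^ ((1 - α) / 2) := by
    rw [← Real.rpow_add (by norm_num)]
    congr 1
    ring
  have hxp : (xd ^ 2) ^ ((1 - α) / 2) = xd ^ (1 - α) := by
    rw [← Real.rpow_natCast, ← Real.rpow_mul hx.le]
    congr 1
    push_cast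
    ring
  rw [show Real.pi / (1 / 4) = 4 * Real.pi by ring, Real.mul_rpow (by norm_num) Real.pi_pos.le,
    show 1 / (1 / 4 * xd ^ 2) = 4 / xd ^ 2 by field_simp,
    Real.div_rpow (by norm_num) (by positivity), hxp, QkerConst, h4]
  push_cast
  field_simp

/-- Away from the origin the kernel is at most `xd ^ (1 - α)` times a fixed integrable function. -/
lemma Qker_le {d : ℕ} {α : ℝ} (hα : α < 1) {xd τ δ : ℝ} {z' : Fin (d - 1) → ℝ} (hx : 0 < xd)
    (hτ : 0 < τ) (hδ : 0 < δ) (h : δ ≤ Real.sqrt (∑ i, z' i ^ 2) + τ) :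
    Qker d α xd τ z' ≤ QkerConst d α * Real.exp (δ / 16) * xd ^ (1 - α) *
      ((τ ^ (((d : ℝ) - α) / 2 + 1))⁻¹ *
        Real.exp (-(1 / 8 * (δ ^ 2 / 4 + ∑ i, z' i ^ 2)) / τ)) := by
  have hK := QkerConst_pos d hα
  have hS : 0 ≤ ∑ i, z' i ^ 2 := by positivity
  have hexp : -(xd ^ 2 + ∑ i, z' i ^ 2) / (4 * τ)
      ≤ δ / 16 + -(1 / 8 * (δ ^ 2 / 4 + ∑ i, z' i ^ 2)) / τ := by
    rw [← sub_nonneg, show δ / 16 + -(1 / 8 * (δ ^ 2 / 4 + ∑ i, z' i ^ 2)) / τ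
      - -(xd ^ 2 + ∑ i, z' i ^ 2) / (4 * τ)
      = (2 * δ * τ - δ ^ 2 + 4 * ∑ i, z' i ^ 2 + 8 * xd ^ 2) / (32 * τ) by field_simp; ring]
    refine div_nonneg ?_ (by positivity)
    have hsq := Real.sq_sqrt hS
    rcases le_total (δ / 2) τ with hτδ | hτδ
    · nlinarith [sq_nonneg xd]
    · have : δ / 2 ≤ Real.sqrt (∑ i, z' i ^ 2) := by linarith
      nlinarith [sq_nonneg xd, mul_pos hδ hτ]
  calc Qker d α xd τ z'
      ≤ QkerConst d α * (xd ^ (1 - α) * (τ ^ (((d : ℝ) - α) / 2 + 1))⁻¹) *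
        Real.exp (δ / 16 + -(1 / 8 * (δ ^ 2 / 4 + ∑ i, z' i ^ 2)) / τ) := by
        rw [Qker, ← QkerConst]
        gcongr
    _ = _ := by
        rw [Real.exp_add]
        ring

lemma tendsto_lintegral_Qker {d : ℕ} (hd : 1 ≤ d) {α : ℝ} (hα : α < 1) {δ : ℝ} (hδ : 0 < δ) :
    Tendsto (fun xd => ∫⁻ q : ℝ × (Fin (d - 1) → ℝ) in
        {q | 0 < q.1 ∧ δ ≤ Real.sqrt (∑ i, q.2 i ^ 2) + q.1},
        ENNReal.ofReal (Qker d α xd q.1 q.2))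
      (nhdsWithin 0 (Ioi 0)) (nhds 0) := by
  have hK := QkerConst_pos d hα
  have hs : 0 < (1 - α) / 2 := by linarith
  set G : ℝ × (Fin (d - 1) → ℝ) → ℝ := fun q => (q.1 ^ (((d : ℝ) - α) / 2 + 1))⁻¹ *
    Real.exp (-(1 / 8 * (δ ^ 2 / 4 + ∑ i, q.2 i ^ 2)) / q.1) with hG
  have hGm : Measurable G := by fun_prop
  have hfin : ∫⁻ q in Ioi (0 : ℝ) ×ˢ univ, ENNReal.ofReal (G q) ≠ ⊤ := by
    rw [Measure.volume_eq_prod, ← Measure.prod_restrict, Measure.restrict_univ,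
      lintegral_prod _ hGm.ennreal_ofReal.aemeasurable]
    simp only [hG, rpow_exponent_eq hd]
    rw [lintegral_lintegral_rpow_mul_exp (by norm_num) (by positivity) hs]
    exact ENNReal.ofReal_ne_top
  have hS : MeasurableSet {q : ℝ × (Fin (d - 1) → ℝ) |
      0 < q.1 ∧ δ ≤ Real.sqrt (∑ i, q.2 i ^ 2) + q.1} :=
    (measurableSet_lt measurable_const measurable_fst).inter
      (measurableSet_le (f := fun _ => δ)
        (g := fun q : ℝ × (Fin (d - 1) → ℝ) => Real.sqrt (∑ i, q.2 i ^ 2) + q.1)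
        measurable_const (by fun_prop))
  have hlim : Tendsto (fun xd : ℝ =>
      ENNReal.ofReal (QkerConst d α * Real.exp (δ / 16) * xd ^ (1 - α)) *
        ∫⁻ q in Ioi (0 : ℝ) ×ˢ univ, ENNReal.ofReal (G q)) (nhdsWithin 0 (Ioi 0)) (nhds 0) := by
    have h1 : Tendsto (fun xd : ℝ => QkerConst d α * Real.exp (δ / 16) * xd ^ (1 - α))
        (nhdsWithin 0 (Ioi 0)) (nhds 0) := by
      have h := ((Real.continuousAt_rpow_const 0 (1 - α) (Or.inr (by linarith))).tendsto.const_mul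
        (QkerConst d α * Real.exp (δ / 16))).mono_left (nhdsWithin_le_nhds (s := Ioi 0))
      rwa [Real.zero_rpow (by linarith), mul_zero] at h
    have h2 := ENNReal.Tendsto.mul_const (ENNReal.tendsto_ofReal h1) (Or.inr hfin)
    rwa [ENNReal.ofReal_zero, zero_mul] at h2
  refine tendsto_of_tendsto_of_tendsto_of_le_of_le' tendsto_const_nhds hlim
    (Eventually.of_forall fun _ => zero_le) ?_
  filter_upwards [self_mem_nhdsWithin] with xd hx
  have hx' : (0 : ℝ) < xd := hx
  rw [← lintegral_const_mul' _ _ ENNReal.ofReal_ne_top]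
  refine (setLIntegral_mono' hS fun q hq => ?_).trans
    (lintegral_mono_set fun q hq => ⟨hq.1, mem_univ _⟩)
  rw [← ENNReal.ofReal_mul (by positivity)]
  exact ENNReal.ofReal_le_ofReal (Qker_le hα hx' hq.1 hδ hq.2)

/-- The kernel `Q^α` satisfies the degenerate heat equation, is normalized, and
concentrates at the boundary as `x_d → 0⁺`. -/
theorem Qker_properties (d : ℕ) (hd : 2 ≤ d) (α : ℝ) (hα : α < 1) :
    (∀ (τ xd : ℝ) (z' : Fin (d - 1) → ℝ), 0 < τ → 0 < xd →
      deriv (fun t => Qker d α xd t z') τ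
        = (∑ i, deriv (deriv (fun s => Qker d α xd τ (Function.update z' i s))) (z' i))
          + deriv (deriv (fun y => Qker d α y τ z')) xd
          + α / xd * deriv (fun y => Qker d α y τ z') xd) ∧
    (∀ xd : ℝ, 0 < xd →
      (∫⁻ τ in Ioi (0 : ℝ), ∫⁻ z' : Fin (d - 1) → ℝ,
          ENNReal.ofReal (Qker d α xd τ z')) = 1) ∧
    (∀ δ : ℝ, 0 < δ →
      Tendsto (fun xd => ∫⁻ q : ℝ × (Fin (d - 1) → ℝ) in
          {q | 0 < q.1 ∧ δ ≤ Real.sqrt (∑ i, q.2 i ^ 2) + q.1},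
          ENNReal.ofReal (Qker d α xd q.1 q.2))
        (nhdsWithin 0 (Ioi 0)) (nhds 0)) := by
  have hd' : 1 ≤ d := one_le_two.trans hd
  exact ⟨fun τ xd z' hτ hx => Qker_equation hd' α z' hτ hx,
    fun xd hx => lintegral_Qker hd' hα hx, fun δ hδ => tendsto_lintegral_Qker hd' hα hδ⟩
end

section
/- Let d ≥ 2, α < 1 and 0 < r < min(1−α, 1). Let Q^α_{x_d}(τ, z') = (4^{(d−α)/2} π^{(d−1)/2} Γ((1−α)/2))^{−1} x_d^{1−α} τ^{−(d−α)/2−1} exp(−(x_d² + |z'|²)/(4τ)) for τ > 0, x_d > 0, z' ∈ ℝ^{d-1}, and define L_{x_d}(τ, z') = ( x_d^{1−r} |∇_{(z',x_d)} Q^α_{x_d}(τ,z')| + x_d^{2−r} |∂_τ Q^α_{x_d}(τ,z')| ) · (|z'| + τ^{1/2})^r. Then there exists C = C(d, α, r) > 0 such that: (a) ∫_0^∞ ∫_{ℝ^{d-1}} L_{x_d}(τ, z') dz' dτ ≤ C for all x_d > 0; and (b) ∫_0^∞ L_{x_d}(τ, z') (|z'| + τ^{1/2})^{d+1} x_d^{−1}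 dx_d ≤ C for almost every (τ, z') ∈ (0,∞) × ℝ^{d-1}. -/
open MeasureTheory Set ENNReal Filter

/-- The Euclidean norm of the gradient of `Q^α` in the `d` variables `(z', x_d)`. -/
noncomputable def QkerGradNorm (d : ℕ) (α xd τ : ℝ) (z' : Fin (d - 1) → ℝ) : ℝ :=
  Real.sqrt ((∑ i, (deriv (fun s => Qker d α xd τ (Function.update z' i s)) (z' i)) ^ 2)
    + (deriv (fun y => Qker d α y τ z') xd) ^ 2)

/-- The weighted kernel `L_{x_d}(τ, z')` appearing in the extension estimates. -/
noncomputable def Lker (d : ℕ) (α r xd τ : ℝ) (z' : Fin (d - 1) → ℝ) : ℝ :=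
  (xd ^ (1 - r) * QkerGradNorm d α xd τ z'
      + xd ^ (2 - r) * |deriv (fun t => Qker d α xd t z') τ|) *
    (Real.sqrt (∑ i, z' i ^ 2) + Real.sqrt τ) ^ r

section KernelEstimates

variable {d : ℕ} {α xd τ : ℝ} {z' : Fin (d - 1) → ℝ}

lemma one_add_rpow_le_exp_sq {p b x : ℝ} (hp : 0 ≤ p) (hb : 0 < b) (hx : 0 ≤ x) :
    (1 + x) ^ p ≤ Real.exp (p ^ 2 / (4 * b)) * Real.exp (b * x ^ 2) := by
  rw [Real.rpow_def_of_pos (by linarith), ← Real.exp_add]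
  apply Real.exp_le_exp.mpr
  have h1 : Real.log (1 + x) ≤ x := by
    have := Real.log_le_sub_one_of_pos (show 0 < 1 + x by linarith)
    linarith
  have h2 : p ^ 2 / (4 * b) + b * x ^ 2 - p * x = (p - 2 * b * x) ^ 2 / (4 * b) := by
    field_simp
    ring
  have h3 : 0 ≤ (p - 2 * b * x) ^ 2 / (4 * b) := by positivity
  nlinarith [mul_le_mul_of_nonneg_left h1 hp]

lemma Qker_pos (hα : α < 1) (hy : 0 < xd) (hτ : 0 < τ) : 0 < Qker d α xd τ z' := by
  have : 0 < Real.Gamma ((1 - α) / 2) := Real.Gamma_pos_of_pos (by linarith)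
  unfold Qker
  positivity

lemma hasDerivAt_Qker_update (i : Fin (d - 1)) :
    HasDerivAt (fun s => Qker d α xd τ (Function.update z' i s))
      (-(z' i / (2 * τ)) * Qker d α xd τ z') (z' i) := by
  have hsum (s : ℝ) : ∑ j, Function.update z' i s j ^ 2
      = s ^ 2 + ∑ j ∈ Finset.univ.erase i, z' j ^ 2 := by
    rw [← Finset.add_sum_erase _ _ (Finset.mem_univ i), Function.update_self]
    congr 1
    refine Finset.sum_congr rfl fun j hj => ?_
    rw [Function.update_of_ne (Finset.ne_of_mem_erase hj)]
  have hz := Finset.add_sum_erase Finset.univ (fun j => z' j ^ 2) (Finset.mem_univ i)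
  have h := (((((hasDerivAt_pow 2 (z' i)).add_const
    (∑ j ∈ Finset.univ.erase i, z' j ^ 2)).const_add (xd ^ 2)).neg.div_const (4 * τ)).exp).const_mul
    (((4 : ℝ) ^ (((d : ℝ) - α) / 2) * Real.pi ^ (((d : ℝ) - 1) / 2) *
      Real.Gamma ((1 - α) / 2))⁻¹ * (xd ^ (1 - α) * (τ ^ (((d : ℝ) - α) / 2 + 1))⁻¹))
  simp only [Qker, hsum]
  refine h.congr_deriv ?_
  simp only [Pi.neg_apply, hz]
  field_simp
  ring

lemma hasDerivAt_Qker_xd (hy : 0 < xd) :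
    HasDerivAt (fun y => Qker d α y τ z')
      (((1 - α) / xd - xd / (2 * τ)) * Qker d α xd τ z') xd := by
  have h := (((Real.hasDerivAt_rpow_const (p := 1 - α) (Or.inl hy.ne')).mul_const
    (τ ^ (((d : ℝ) - α) / 2 + 1))⁻¹).const_mul
    ((4 : ℝ) ^ (((d : ℝ) - α) / 2) * Real.pi ^ (((d : ℝ) - 1) / 2) *
      Real.Gamma ((1 - α) / 2))⁻¹).mul
    ((((hasDerivAt_pow 2 xd).add_const (∑ j, z' j ^ 2)).neg.div_const (4 * τ)).exp)
  refine h.congr_deriv ?_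
  rw [Real.rpow_sub_one hy.ne']
  simp only [Qker, Pi.neg_apply]
  field_simp
  ring

lemma hasDerivAt_Qker_tau (hτ : 0 < τ) :
    HasDerivAt (fun t => Qker d α xd t z')
      ((-(((d : ℝ) - α) / 2 + 1) / τ + (xd ^ 2 + ∑ j, z' j ^ 2) / (4 * τ ^ 2)) *
        Qker d α xd τ z') τ := by
  have hp : τ ^ (((d : ℝ) - α) / 2 + 1) ≠ 0 := by positivity
  have h := ((((Real.hasDerivAt_rpow_const (p := ((d : ℝ) - α) / 2 + 1)
    (Or.inl hτ.ne')).fun_inv hp).const_mul (xd ^ (1 - α))).const_mul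
    ((4 : ℝ) ^ (((d : ℝ) - α) / 2) * Real.pi ^ (((d : ℝ) - 1) / 2) *
      Real.Gamma ((1 - α) / 2))⁻¹).mul
    (((hasDerivAt_const τ (-(xd ^ 2 + ∑ j, z' j ^ 2))).fun_div
      ((hasDerivAt_id τ).const_mul 4) (by simpa using hτ.ne')).exp)
  refine h.congr_deriv ?_
  rw [Real.rpow_sub_one hτ.ne']
  simp only [Qker, id]
  generalize τ ^ (((d : ℝ) - α) / 2 + 1) = P at *
  field_simp
  ring

lemma QkerGradNorm_le (hα : α < 1) (hy : 0 < xd) (hτ : 0 < τ) :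
    QkerGradNorm d α xd τ z' ≤
      ((1 - α) / xd + (xd + √(∑ i, z' i ^ 2)) / (2 * τ)) * Qker d α xd τ z' := by
  have hQ := Qker_pos (d := d) (z' := z') hα hy hτ
  have hS : 0 ≤ ∑ i, z' i ^ 2 := Finset.sum_nonneg fun i _ => sq_nonneg _
  have ha : 0 < 1 - α := by linarith
  unfold QkerGradNorm
  apply Real.sqrt_le_iff.mpr ⟨by positivity, ?_⟩
  simp only [(hasDerivAt_Qker_update _).deriv, (hasDerivAt_Qker_xd hy).deriv]
  have h1 : ∑ i, (-(z' i / (2 * τ)) * Qker d α xd τ z') ^ 2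
      = (√(∑ i, z' i ^ 2) / (2 * τ)) ^ 2 * Qker d α xd τ z' ^ 2 := by
    rw [div_pow, Real.sq_sqrt hS, Finset.sum_div, Finset.sum_mul]
    exact Finset.sum_congr rfl fun i _ => by ring
  rw [h1, mul_pow, mul_pow, ← add_mul, add_div]
  refine mul_le_mul_of_nonneg_right ?_ (sq_nonneg _)
  have hA : 0 < (1 - α) / xd := by positivity
  have hB : 0 < xd / (2 * τ) := by positivity
  have hC : 0 ≤ √(∑ i, z' i ^ 2) / (2 * τ) := by positivity
  nlinarith [mul_pos hA hB, mul_nonneg hA.le hC, mul_nonneg hB.le hC]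

lemma abs_deriv_Qker_tau_le (hα : α < 1) (hy : 0 < xd) (hτ : 0 < τ) :
    |deriv (fun t => Qker d α xd t z') τ| ≤
      ((((d : ℝ) - α) / 2 + 1) / τ + (xd ^ 2 + ∑ j, z' j ^ 2) / (4 * τ ^ 2)) *
        Qker d α xd τ z' := by
  have hQ := Qker_pos (d := d) (z' := z') hα hy hτ
  have hS : 0 ≤ ∑ i, z' i ^ 2 := Finset.sum_nonneg fun i _ => sq_nonneg _
  have hd : (0 : ℝ) ≤ d := Nat.cast_nonneg d
  have hβ : 0 ≤ (((d : ℝ) - α) / 2 + 1) / τ := div_nonneg (by linarith) hτ.le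
  have hT : 0 ≤ (xd ^ 2 + ∑ j, z' j ^ 2) / (4 * τ ^ 2) := by positivity
  rw [(hasDerivAt_Qker_tau hτ).deriv, abs_mul, abs_of_pos hQ]
  refine mul_le_mul_of_nonneg_right ?_ hQ.le
  rw [neg_div, abs_le]
  constructor <;> linarith

/-- Gradient and time derivative, rescaled by `u = x_d / √τ` and `v = |z'| / √τ`. -/
lemma weighted_derivatives_le {r : ℝ} (hα : α < 1) (hy : 0 < xd) (hτ : 0 < τ) :
    xd ^ (1 - r) * QkerGradNorm d α xd τ z'
      + xd ^ (2 - r) * |deriv (fun t => Qker d α xd t z') τ| ≤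
    (4 + d - 2 * α) * xd ^ (-r) * Qker d α xd τ z' *
      ((1 + xd / √τ) ^ 4 * (1 + √(∑ i, z' i ^ 2) / √τ) ^ 2) := by
  have hQ := Qker_pos (d := d) (z' := z') hα hy hτ
  have hS : 0 ≤ ∑ i, z' i ^ 2 := Finset.sum_nonneg fun i _ => sq_nonneg _
  have hd : (0 : ℝ) ≤ d := Nat.cast_nonneg d
  have e1 : xd ^ (1 - r) = xd ^ (-r) * xd := by
    rw [← Real.rpow_add_one hy.ne']; ring_nf
  have e2 : xd ^ (2 - r) = xd ^ (-r) * xd ^ 2 := by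
    rw [← Real.rpow_add_natCast hy.ne']; push_cast; ring_nf
  have g1 := mul_le_mul_of_nonneg_left (QkerGradNorm_le (z' := z') hα hy hτ)
    (Real.rpow_nonneg hy.le (1 - r))
  have g2 := mul_le_mul_of_nonneg_left (abs_deriv_Qker_tau_le (z' := z') hα hy hτ)
    (Real.rpow_nonneg hy.le (2 - r))
  refine (add_le_add g1 g2).trans ?_
  rw [e1, e2]
  obtain ⟨w, hw, rfl⟩ : ∃ w, 0 < w ∧ τ = w ^ 2 :=
    ⟨√τ, Real.sqrt_pos.mpr hτ, (Real.sq_sqrt hτ.le).symm⟩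
  rw [Real.sqrt_sq hw.le]
  have hρ := Real.sqrt_nonneg (∑ i, z' i ^ 2)
  have hρS := Real.sq_sqrt hS
  set ρ := √(∑ i, z' i ^ 2)
  rw [← hρS]
  set u := xd / w with hu
  set v := ρ / w with hv
  have hu0 : 0 < u := by positivity
  have hv0 : 0 ≤ v := by positivity
  have key : (1 - α) + (u ^ 2 + u * v) / 2 + ((d - α) / 2 + 1) * u ^ 2
      + (u ^ 2 + v ^ 2) * u ^ 2 / 4 ≤ (4 + d - 2 * α) * ((1 + u) ^ 4 * (1 + v) ^ 2) := by
    have hP1 : 1 ≤ (1 + u) ^ 4 * (1 + v) ^ 2 :=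
      one_le_mul_of_one_le_of_one_le (one_le_pow₀ (by linarith)) (one_le_pow₀ (by linarith))
    have hP2 : u ^ 2 ≤ (1 + u) ^ 4 * (1 + v) ^ 2 := by
      rw [← sub_nonneg]; ring_nf; positivity
    have hP3 : (u ^ 2 + u * v) / 2 + (u ^ 2 + v ^ 2) * u ^ 2 / 4
        ≤ (1 + u) ^ 4 * (1 + v) ^ 2 := by
      rw [← sub_nonneg]; ring_nf; positivity
    have h1 := mul_le_mul_of_nonneg_left hP1 (show 0 ≤ 1 - α by linarith)
    have h2 := mul_le_mul_of_nonneg_left hP2 (show 0 ≤ ((d : ℝ) - α) / 2 + 1 by linarith)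
    nlinarith
  have := mul_le_mul_of_nonneg_left key
    (mul_nonneg (Real.rpow_nonneg hy.le (-r)) hQ.le)
  calc _ = xd ^ (-r) * Qker d α xd (w ^ 2) z' * ((1 - α) + (u ^ 2 + u * v) / 2
        + ((d - α) / 2 + 1) * u ^ 2 + (u ^ 2 + v ^ 2) * u ^ 2 / 4) := by
        rw [hu, hv]; field_simp; ring
    _ ≤ _ := this
    _ = _ := by ring

end KernelEstimates

/-- The Gaussian majorant of `L_{x_d}`. -/
lemma exists_Lker_le (d : ℕ) {α r : ℝ} (hα : α < 1) (hr : 0 < r) :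
    ∃ K : ℝ, 0 < K ∧ ∀ xd τ : ℝ, 0 < xd → 0 < τ → ∀ z' : Fin (d - 1) → ℝ,
      Lker d α r xd τ z' ≤ K * (xd ^ (1 - α - r) * τ ^ (-((1 - α - r + d + 1) / 2)) *
        Real.exp (-(xd ^ 2 / (8 * τ))) * Real.exp (-((∑ i, z' i ^ 2) / (8 * τ)))) := by
  have hd : (0 : ℝ) ≤ d := Nat.cast_nonneg d
  have hG : 0 < Real.Gamma ((1 - α) / 2) := Real.Gamma_pos_of_pos (by linarith)
  have hM : 0 < 4 + d - 2 * α := by linarith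
  set c := ((4 : ℝ) ^ (((d : ℝ) - α) / 2) * Real.pi ^ (((d : ℝ) - 1) / 2) *
      Real.Gamma ((1 - α) / 2))⁻¹ with hc
  have hc0 : 0 < c := by positivity
  refine ⟨(4 + d - 2 * α) * c * Real.exp (4 ^ 2 / (4 * (1 / 8))) *
    Real.exp ((2 + r) ^ 2 / (4 * (1 / 8))), by positivity, fun xd τ hy hτ z' => ?_⟩
  have hS : 0 ≤ ∑ i, z' i ^ 2 := Finset.sum_nonneg fun i _ => sq_nonneg _
  have hw : 0 < √τ := Real.sqrt_pos.mpr hτ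
  have hwt := Real.sq_sqrt hτ.le
  have hρ := Real.sqrt_nonneg (∑ i, z' i ^ 2)
  have hρS := Real.sq_sqrt hS
  have hQ := Qker_pos (d := d) (z' := z') hα hy hτ
  set S := ∑ i, z' i ^ 2 with hSdef
  have hu : 0 ≤ xd / √τ := by positivity
  have hv : 0 ≤ √S / √τ := by positivity
  have hweight : (√S + √τ) ^ r = τ ^ (r / 2) * (1 + √S / √τ) ^ r := by
    have : √S + √τ = √τ * (1 + √S / √τ) := by field_simp; ring
    rw [this, Real.mul_rpow hw.le (by positivity), Real.sqrt_eq_rpow τ, ← Real.rpow_mul hτ.le]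
    ring_nf
  have b1 := one_add_rpow_le_exp_sq (p := 4) (b := 1 / 8) (by norm_num) (by norm_num) hu
  have b2 := one_add_rpow_le_exp_sq (p := 2 + r) (b := 1 / 8) (by linarith) (by norm_num) hv
  rw [div_pow, hwt] at b1
  rw [div_pow, hwt, hρS] at b2
  have b1' : (1 + xd / √τ) ^ (4 : ℝ) = (1 + xd / √τ) ^ 4 := by
    exact_mod_cast Real.rpow_natCast (1 + xd / √τ) 4
  have b2' : (1 + √S / √τ) ^ (2 + r) = (1 + √S / √τ) ^ 2 * (1 + √S / √τ) ^ r := by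
    rw [Real.rpow_add (by positivity)]
    norm_num
  rw [b1'] at b1
  rw [b2'] at b2
  have hQeq : xd ^ (-r) * Qker d α xd τ z' * τ ^ (r / 2) = c * (xd ^ (1 - α - r) *
      τ ^ (-((1 - α - r + d + 1) / 2)) * Real.exp (-((xd ^ 2 + S) / (4 * τ)))) := by
    have e1 : xd ^ (1 - α - r) = xd ^ (-r) * xd ^ (1 - α) := by
      rw [← Real.rpow_add hy]; ring_nf
    have e2 : τ ^ (-((1 - α - r + d + 1) / 2)) =
        τ ^ (r / 2) * (τ ^ (((d : ℝ) - α) / 2 + 1))⁻¹ := by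
      rw [← Real.rpow_neg hτ.le, ← Real.rpow_add hτ]; ring_nf
    rw [e1, e2, Qker, ← hc, ← hSdef, neg_div]
    ring
  unfold Lker
  rw [← hSdef, hweight]
  calc _ ≤ ((4 + d - 2 * α) * xd ^ (-r) * Qker d α xd τ z' *
        ((1 + xd / √τ) ^ 4 * (1 + √S / √τ) ^ 2)) * (τ ^ (r / 2) * (1 + √S / √τ) ^ r) :=
        mul_le_mul_of_nonneg_right (weighted_derivatives_le hα hy hτ) (by positivity)
    _ = (4 + d - 2 * α) * (xd ^ (-r) * Qker d α xd τ z' * τ ^ (r / 2)) *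
        ((1 + xd / √τ) ^ 4 * ((1 + √S / √τ) ^ 2 * (1 + √S / √τ) ^ r)) := by ring
    _ ≤ (4 + d - 2 * α) * (xd ^ (-r) * Qker d α xd τ z' * τ ^ (r / 2)) * _ :=
        mul_le_mul_of_nonneg_left (mul_le_mul b1 b2 (by positivity) (by positivity))
          (by positivity)
    _ = _ := by
      rw [hQeq]
      have e3 : Real.exp (-((xd ^ 2 + S) / (4 * τ))) =
          Real.exp (-(xd ^ 2 / (8 * τ))) * Real.exp (-(S / (8 * τ))) *
          Real.exp (-(1 / 8 * (xd ^ 2 / τ))) * Real.exp (-(1 / 8 * (S / τ))) := by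
        rw [← Real.exp_add, ← Real.exp_add, ← Real.exp_add]
        congr 1
        field_simp
        ring
      rw [e3, Real.exp_neg (1 / 8 * (xd ^ 2 / τ)), Real.exp_neg (1 / 8 * (S / τ))]
      field_simp

lemma lintegral_ofReal_exp_neg_mul_sum_sq (n : ℕ) {b : ℝ} (hb : 0 < b) :
    ∫⁻ z : Fin n → ℝ, ENNReal.ofReal (Real.exp (-(b * ∑ i, z i ^ 2)))
      = ENNReal.ofReal (√(Real.pi / b) ^ n) := by
  have hprod (z : Fin n → ℝ) :
      Real.exp (-(b * ∑ i, z i ^ 2)) = ∏ i, Real.exp (-b * z i ^ 2) := by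
    rw [← Real.exp_sum, Finset.mul_sum, ← Finset.sum_neg_distrib]
    simp only [neg_mul]
  simp only [hprod]
  have hint : Integrable (fun z : Fin n → ℝ => ∏ i, Real.exp (-b * z i ^ 2)) :=
    Integrable.fintype_prod (f := fun _ x => Real.exp (-b * x ^ 2))
      fun _ => integrable_exp_neg_mul_sq hb
  rw [← ofReal_integral_eq_lintegral_ofReal hint
    (Eventually.of_forall fun z => Finset.prod_nonneg fun i _ => (Real.exp_pos _).le),
    integral_fintype_prod_volume_eq_pow (fun x : ℝ => Real.exp (-b * x ^ 2)), integral_gaussian]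
  simp

lemma lintegral_Ioi_rpow_mul_exp_neg_div {s y : ℝ} (hs : 0 < s) (hy : 0 < y) :
    ∫⁻ τ in Ioi (0 : ℝ), ENNReal.ofReal
        (y ^ s * τ ^ (-(s / 2 + 1)) * Real.exp (-(y ^ 2 / (8 * τ))))
      = ENNReal.ofReal (8 ^ (s / 2) * Real.Gamma (s / 2)) := by
  have hb : 0 < y ^ 2 / 8 := by positivity
  set g : ℝ → ℝ := fun u => u ^ (s / 2 - 1) * Real.exp (-(y ^ 2 / 8 * u)) with hg
  have hgi : IntegrableOn g (Ioi 0) := by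
    have := integrableOn_rpow_mul_exp_neg_mul_rpow (p := 1) (s := s / 2 - 1) (b := y ^ 2 / 8)
      (by linarith) one_pos hb
    refine this.congr_fun (fun u _ => ?_) measurableSet_Ioi
    simp [hg]
  have hcomp : EqOn (fun τ : ℝ => y ^ s * ((|(-1 : ℝ)| * τ ^ ((-1 : ℝ) - 1)) • g (τ ^ (-1 : ℝ))))
      (fun τ => y ^ s * τ ^ (-(s / 2 + 1)) * Real.exp (-(y ^ 2 / (8 * τ)))) (Ioi 0) := by
    intro τ hτ
    have hτ : 0 < τ := hτ
    have e : τ ^ (-(s / 2 + 1)) = τ ^ ((-1 : ℝ) - 1) * (τ ^ (-1 : ℝ)) ^ (s / 2 - 1) := by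
      rw [← Real.rpow_mul hτ.le, ← Real.rpow_add hτ]; ring_nf
    have e' : y ^ 2 / 8 * τ ^ (-1 : ℝ) = y ^ 2 / (8 * τ) := by
      rw [Real.rpow_neg_one]; field_simp
    simp only [hg, e, e', smul_eq_mul, abs_neg, abs_one]
    ring
  have hint := ((integrableOn_Ioi_comp_rpow_iff g (by norm_num : (-1 : ℝ) ≠ 0)).mpr
    hgi).const_mul (y ^ s)
  rw [← ofReal_integral_eq_lintegral_ofReal
    (IntegrableOn.congr_fun hint hcomp measurableSet_Ioi)
    ((ae_restrict_iff' measurableSet_Ioi).mpr <| Eventually.of_forall fun τ hτ => by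
      have hτ : 0 < τ := hτ
      simp only [Pi.zero_apply]
      positivity),
    ← setIntegral_congr_fun measurableSet_Ioi hcomp, integral_const_mul,
    integral_comp_rpow_Ioi g (by norm_num : (-1 : ℝ) ≠ 0)]
  simp only [hg]
  rw [Real.integral_rpow_mul_exp_neg_mul_Ioi (by positivity) hb, ← mul_assoc]
  congr 2
  rw [one_div_div, Real.div_rpow (by norm_num) (by positivity), ← Real.rpow_natCast y 2,
    ← Real.rpow_mul hy.le]
  have : ((2 : ℕ) : ℝ) * (s / 2) = s := by push_cast; ring
  rw [this]
  field_simp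

lemma lintegral_Ioi_rpow_mul_exp_neg_sq_div {s τ : ℝ} (hs : 0 < s) (hτ : 0 < τ) :
    ∫⁻ y in Ioi (0 : ℝ), ENNReal.ofReal
        (y ^ (s - 1) * τ ^ (-(s / 2)) * Real.exp (-(y ^ 2 / (8 * τ))))
      = ENNReal.ofReal (8 ^ (s / 2) * Real.Gamma (s / 2) / 2) := by
  have hb : 0 < (8 * τ)⁻¹ := by positivity
  have hcomp : EqOn (fun y : ℝ => τ ^ (-(s / 2)) *
      (y ^ (s - 1) * Real.exp (-(8 * τ)⁻¹ * y ^ (2 : ℝ))))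
      (fun y => y ^ (s - 1) * τ ^ (-(s / 2)) * Real.exp (-(y ^ 2 / (8 * τ)))) (Ioi 0) := by
    intro y _
    have : -(8 * τ)⁻¹ * y ^ (2 : ℝ) = -(y ^ 2 / (8 * τ)) := by
      rw [Real.rpow_two]; ring
    simp only [this]
    ring
  have hint := (integrableOn_rpow_mul_exp_neg_mul_rpow (p := 2) (s := s - 1)
    (by linarith) (by norm_num) hb).const_mul (τ ^ (-(s / 2)))
  rw [← ofReal_integral_eq_lintegral_ofReal
    (IntegrableOn.congr_fun hint hcomp measurableSet_Ioi)
    ((ae_restrict_iff' measurableSet_Ioi).mpr <| Eventually.of_forall fun y hy => by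
      have hy : 0 < y := hy
      simp only [Pi.zero_apply]
      positivity),
    ← setIntegral_congr_fun measurableSet_Ioi hcomp, integral_const_mul,
    integral_rpow_mul_exp_neg_mul_rpow (by norm_num) (by linarith) hb]
  congr 1
  have e : (8 * τ)⁻¹ ^ (-(s - 1 + 1) / 2) = 8 ^ (s / 2) * τ ^ (s / 2) := by
    rw [Real.inv_rpow (by positivity), ← Real.rpow_neg (by positivity),
      Real.mul_rpow (by norm_num) hτ.le]
    ring_nf
  rw [e, Real.rpow_neg hτ.le, sub_add_cancel]
  field_simp

/-- Schur-type bounds for the weighted kernel `L_{x_d}`. -/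
theorem Lker_schur_bounds (d : ℕ) (hd : 2 ≤ d) (α r : ℝ) (hα : α < 1)
    (hr : 0 < r) (hr' : r < min (1 - α) 1) :
    ∃ C : ℝ, 0 < C ∧
      (∀ xd : ℝ, 0 < xd →
        (∫⁻ τ in Ioi (0 : ℝ), ∫⁻ z' : Fin (d - 1) → ℝ,
            ENNReal.ofReal (Lker d α r xd τ z')) ≤ ENNReal.ofReal C) ∧
      (∀ᵐ q : ℝ × (Fin (d - 1) → ℝ)
          ∂((volume : Measure (ℝ × (Fin (d - 1) → ℝ))).restrict {q | 0 < q.1}),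
        (∫⁻ xd in Ioi (0 : ℝ),
            ENNReal.ofReal (Lker d α r xd q.1 q.2 *
              (Real.sqrt (∑ i, q.2 i ^ 2) + Real.sqrt q.1) ^ (d + 1) * xd⁻¹))
          ≤ ENNReal.ofReal C) := by
  have hs : 0 < 1 - α - r := by linarith [lt_min_iff.mp hr']
  obtain ⟨K, hK, hL⟩ := exists_Lker_le d hα hr
  set s := 1 - α - r
  have hd1 : ((d - 1 : ℕ) : ℝ) = d - 1 := by rw [Nat.cast_sub (by omega)]; simp
  have hΓ : 0 < 8 ^ (s / 2) * Real.Gamma (s / 2) := by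
    have := Real.Gamma_pos_of_pos (half_pos hs)
    positivity
  set A := K * √(8 * Real.pi) ^ (d - 1)
  set E := Real.exp (((d : ℝ) + 1) ^ 2 / (4 * (1 / 8)))
  have hA : 0 < A := by positivity
  have hE : 0 < E := Real.exp_pos _
  refine ⟨A * (8 ^ (s / 2) * Real.Gamma (s / 2)) +
    K * E * (8 ^ (s / 2) * Real.Gamma (s / 2) / 2), by positivity, fun xd hy => ?_, ?_⟩
  · calc _ ≤ ∫⁻ τ in Ioi (0 : ℝ), ENNReal.ofReal A * ENNReal.ofReal
          (xd ^ s * τ ^ (-(s / 2 + 1)) * Real.exp (-(xd ^ 2 / (8 * τ)))) := by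
          refine setLIntegral_mono' measurableSet_Ioi fun τ hτ => ?_
          have hτ : 0 < τ := hτ
          set B := K * (xd ^ s * τ ^ (-((s + d + 1) / 2)) * Real.exp (-(xd ^ 2 / (8 * τ))))
          have hB : 0 ≤ B := by positivity
          calc _ ≤ ∫⁻ z' : Fin (d - 1) → ℝ, ENNReal.ofReal B *
                ENNReal.ofReal (Real.exp (-((8 * τ)⁻¹ * ∑ i, z' i ^ 2))) := by
                refine lintegral_mono fun z' => ?_
                rw [← ENNReal.ofReal_mul hB]
                refine ENNReal.ofReal_le_ofReal ((hL xd τ hy hτ z').trans_eq ?_)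
                rw [div_eq_inv_mul (∑ i, z' i ^ 2)]
                simp only [B]
                ring
            _ = ENNReal.ofReal (B * √(Real.pi / (8 * τ)⁻¹) ^ (d - 1)) := by
                rw [lintegral_const_mul' _ _ ENNReal.ofReal_ne_top,
                  lintegral_ofReal_exp_neg_mul_sum_sq _ (by positivity), ENNReal.ofReal_mul hB]
            _ = _ := by
                rw [← ENNReal.ofReal_mul hA.le]
                congr 1
                have e1 : √(Real.pi / (8 * τ)⁻¹) ^ (d - 1)
                    = √(8 * Real.pi) ^ (d - 1) * τ ^ (((d : ℝ) - 1) / 2) := by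
                  rw [show Real.pi / (8 * τ)⁻¹ = 8 * Real.pi * τ by field_simp,
                    Real.sqrt_mul (by positivity), mul_pow, Real.sqrt_eq_rpow τ,
                    ← Real.rpow_natCast (τ ^ (1 / 2 : ℝ)), ← Real.rpow_mul hτ.le, hd1]
                  ring_nf
                have e2 : τ ^ (-(s / 2 + 1)) =
                    τ ^ (-((s + d + 1) / 2)) * τ ^ (((d : ℝ) - 1) / 2) := by
                  rw [← Real.rpow_add hτ]; ring_nf
                rw [e1, e2]
                simp only [A, B]
                ring
      _ = ENNReal.ofReal (A * (8 ^ (s / 2) * Real.Gamma (s / 2))) := by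
          rw [lintegral_const_mul' _ _ ENNReal.ofReal_ne_top,
            lintegral_Ioi_rpow_mul_exp_neg_div hs hy, ENNReal.ofReal_mul hA.le]
      _ ≤ _ := ENNReal.ofReal_le_ofReal (le_add_of_nonneg_right (by positivity))
  · refine (ae_restrict_iff' (measurableSet_lt measurable_const measurable_fst)).mpr
      (Eventually.of_forall ?_)
    rintro ⟨τ, z'⟩ hτ
    have hτ : 0 < τ := hτ
    have hS : 0 ≤ ∑ i, z' i ^ 2 := Finset.sum_nonneg fun i _ => sq_nonneg _
    have hw : 0 < √τ := Real.sqrt_pos.mpr hτ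
    have hweight : (√(∑ i, z' i ^ 2) + √τ) ^ (d + 1) ≤ τ ^ (((d : ℝ) + 1) / 2) *
        (E * Real.exp ((∑ i, z' i ^ 2) / (8 * τ))) := by
      have e1 : √(∑ i, z' i ^ 2) + √τ = √τ * (1 + √(∑ i, z' i ^ 2) / √τ) := by
        field_simp; ring
      have e2 : √τ ^ (d + 1) = τ ^ (((d : ℝ) + 1) / 2) := by
        rw [Real.sqrt_eq_rpow, ← Real.rpow_natCast, ← Real.rpow_mul hτ.le]
        push_cast
        ring_nf
      have b := one_add_rpow_le_exp_sq (p := (d : ℝ) + 1) (b := 1 / 8)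
        (x := √(∑ i, z' i ^ 2) / √τ) (by positivity) (by norm_num) (by positivity)
      rw [div_pow, Real.sq_sqrt hS, Real.sq_sqrt hτ.le,
        show (1 / 8 * ((∑ i, z' i ^ 2) / τ)) = (∑ i, z' i ^ 2) / (8 * τ) by field_simp] at b
      rw [e1, mul_pow, e2]
      refine mul_le_mul_of_nonneg_left ?_ (by positivity)
      rw [← Real.rpow_natCast]
      push_cast
      exact b
    calc _ ≤ ∫⁻ xd in Ioi (0 : ℝ), ENNReal.ofReal (K * E) * ENNReal.ofReal
          (xd ^ (s - 1) * τ ^ (-(s / 2)) * Real.exp (-(xd ^ 2 / (8 * τ)))) := by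
          refine setLIntegral_mono' measurableSet_Ioi fun xd hy => ?_
          have hy : 0 < xd := hy
          rw [← ENNReal.ofReal_mul (by positivity)]
          refine ENNReal.ofReal_le_ofReal ?_
          refine (mul_le_mul_of_nonneg_right (mul_le_mul (hL xd τ hy hτ z') hweight
            (by positivity) (by positivity)) (by positivity)).trans_eq ?_
          have e1 : τ ^ (-(s / 2)) = τ ^ (-((s + d + 1) / 2)) * τ ^ (((d : ℝ) + 1) / 2) := by
            rw [← Real.rpow_add hτ]; ring_nf
          rw [e1, Real.rpow_sub_one hy.ne', Real.exp_neg ((∑ i, z' i ^ 2) / (8 * τ))]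
          field_simp
      _ = ENNReal.ofReal (K * E * (8 ^ (s / 2) * Real.Gamma (s / 2) / 2)) := by
          rw [lintegral_const_mul' _ _ ENNReal.ofReal_ne_top,
            lintegral_Ioi_rpow_mul_exp_neg_sq_div hs hτ, ← ENNReal.ofReal_mul (by positivity)]
      _ ≤ _ := ENNReal.ofReal_le_ofReal (le_add_of_nonneg_left (by positivity))
end

section
/- Let d ≥ 2 and p ∈ (1,∞), and let φ ∈ C_0^∞(ℝ^{d-1}) be a nonzero smooth compactly supported function. Define u(x', x_d) = φ(x') · log(log(1/x_d)) for x' ∈ ℝ^{d-1} and 0 < x_d < 1/2. Then: (a) ∫_{ℝ^{d-1} × (0,1/2)} ( |u(x)|^p + |∇u(x)|^p ) x_d^{p−1} dx < ∞, where ∇u is the full gradient in all d variables; and (b) for every ψ ∈ C_0^∞(ℝ^{d-1}) with ∫_{ℝ^{d-1}} φ ψ dx' ≠ 0, the pairing ∫_{ℝ^{d-1}} u(x', x_d) ψ(x') dx' tends to +∞ or −∞ as x_d → 0⁺; in particular u(·, x_d) does not converge in the space of distributions D'(ℝ^{d-1}) as x_d → 0⁺. -/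
open MeasureTheory Set ENNReal Filter

/-- The derivative of `t ↦ log (log (1 / t))` on `(0, 1)`. -/
theorem hasDerivAt_log_log_one_div {t : ℝ} (h0 : 0 < t) (h1 : t < 1) :
    HasDerivAt (fun t : ℝ => Real.log (Real.log (1 / t))) (-(t * Real.log (1 / t))⁻¹) t := by
  have hs : 0 < Real.log (1 / t) := Real.log_pos (by rw [lt_div_iff₀ h0]; linarith)
  simp only [one_div, Real.log_inv] at hs ⊢
  refine ((Real.hasDerivAt_log h0.ne').fun_neg.log hs.ne').congr_deriv ?_
  field_simp

/-- On `(0, 1/2)`, the function `log (log (1 / t))` is dominated by its derivative. -/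
theorem abs_log_log_one_div_le {t : ℝ} (h0 : 0 < t) (h1 : t < 1 / 2) :
    |Real.log (Real.log (1 / t))| ≤ 4 * (t * Real.log (1 / t))⁻¹ := by
  have hs : 1 / 2 < Real.log (1 / t) := by
    have h2 : Real.log 2 ≤ Real.log (1 / t) :=
      Real.log_le_log (by norm_num) (by rw [le_div_iff₀ h0]; linarith)
    linarith [Real.log_two_gt_d9]
  have ht : t = Real.exp (-Real.log (1 / t)) := by
    rw [one_div, Real.log_inv, neg_neg, Real.exp_log h0]
  set s := Real.log (1 / t)
  have hs0 : 0 < s := by linarith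
  have habs : |Real.log s| ≤ 2 * s := by
    have hinv : s⁻¹ ≤ 2 := by
      rw [inv_le_comm₀ hs0 two_pos]; linarith
    rw [abs_le]
    constructor
    · linarith [Real.one_sub_inv_le_log_of_pos hs0]
    · linarith [Real.log_le_sub_one_of_pos hs0]
  have hts : t * s ^ 2 ≤ 2 := by
    have := Real.quadratic_le_exp_of_nonneg hs0.le
    rw [ht, Real.exp_neg, inv_mul_le_iff₀ (Real.exp_pos s)]
    nlinarith
  refine habs.trans ?_
  rw [← div_eq_mul_inv, le_div_iff₀ (by positivity)]
  nlinarith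

theorem tendsto_log_one_div_nhdsGT_zero :
    Tendsto (fun t : ℝ => Real.log (1 / t)) (nhdsWithin 0 (Ioi 0)) atTop := by
  simp only [one_div]
  exact Real.tendsto_log_atTop.comp tendsto_inv_nhdsGT_zero

theorem integrableOn_inv_mul_log_one_div_rpow {p : ℝ} (hp : 1 < p) :
    IntegrableOn (fun t : ℝ => t⁻¹ * Real.log (1 / t) ^ (-p)) (Ioc 0 (1 / 2)) := by
  have hpos : ∀ t ∈ Ioc (0 : ℝ) (1 / 2), 0 < Real.log (1 / t) := fun t ht =>
    Real.log_pos (by rw [lt_div_iff₀ ht.1]; linarith [ht.2])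
  have hderiv : ∀ t ∈ Ioc (0 : ℝ) (1 / 2),
      HasDerivAt (fun t : ℝ => Real.log (1 / t) ^ (1 - p) / (p - 1))
        (t⁻¹ * Real.log (1 / t) ^ (-p)) t := by
    intro t ht
    have hs := hpos t ht
    simp only [one_div, Real.log_inv] at hs ⊢
    have hp0 : p - 1 ≠ 0 := by linarith
    refine (((Real.hasDerivAt_log ht.1.ne').fun_neg.rpow_const (p := 1 - p)
      (Or.inl hs.ne')).div_const (p - 1)).congr_deriv ?_
    rw [show 1 - p - 1 = -p by ring]
    field_simp
    ring
  refine intervalIntegral.integrableOn_deriv_of_nonneg (fun t ht => ?_)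
    (fun t ht => hderiv t (Ioo_subset_Ioc_self ht)) (fun t ht => ?_)
  · rcases ht.1.eq_or_lt with rfl | h0
    · refine ContinuousWithinAt.mono (t := Ici 0) ?_ Icc_subset_Ici_self
      rw [← continuousWithinAt_Ioi_iff_Ici]
      have h := ((tendsto_rpow_neg_atTop (sub_pos.2 hp)).comp
        tendsto_log_one_div_nhdsGT_zero).div_const (p - 1)
      have hp0 : 1 - p ≠ 0 := by linarith
      simpa [ContinuousWithinAt, Function.comp_def, Real.zero_rpow hp0] using h
    · exact (hderiv t ⟨h0, ht.2⟩).continuousAt.continuousWithinAt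
  · have := hpos t (Ioo_subset_Ioc_self ht)
    have := ht.1
    positivity

/-- Gradient bound for a product of functions of separate variables. -/
theorem norm_fderiv_mul_prod_le {E : Type*} [NormedAddCommGroup E] [NormedSpace ℝ E]
    {f : E → ℝ} {g : ℝ → ℝ} {g' : ℝ} {x : E × ℝ} (hf : DifferentiableAt ℝ f x.1)
    (hg : HasDerivAt g g' x.2) :
    ‖fderiv ℝ (fun y : E × ℝ => f y.1 * g y.2) x‖ ≤
      |f x.1| * |g'| + |g x.2| * ‖fderiv ℝ f x.1‖ := by
  have h1 := hf.hasFDerivAt.comp x (hasFDerivAt_fst (𝕜 := ℝ) (p := x))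
  have h2 := hg.hasFDerivAt.comp x (hasFDerivAt_snd (𝕜 := ℝ) (p := x))
  have h := (h1.mul h2).fderiv
  simp only [Function.comp_def] at h
  change fderiv ℝ (fun y : E × ℝ => f y.1 * g y.2) x = _ at h
  rw [h]
  refine (norm_add_le _ _).trans ?_
  rw [norm_smul, norm_smul, Real.norm_eq_abs, Real.norm_eq_abs]
  gcongr
  · refine (ContinuousLinearMap.opNorm_comp_le _ _).trans ?_
    refine (mul_le_of_le_one_right (norm_nonneg _)
      (ContinuousLinearMap.norm_snd_le (𝕜 := ℝ) (E := E) (F := ℝ))).trans ?_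
    simp
  · refine (ContinuousLinearMap.opNorm_comp_le _ _).trans ?_
    exact mul_le_of_le_one_right (norm_nonneg _)
      (ContinuousLinearMap.norm_fst_le (𝕜 := ℝ) (E := E) (F := ℝ))

/-- The example `u(x', x_d) = φ(x') log log(1/x_d)`: it belongs to the weighted Sobolev
space `W^1_p(ℝ^{d-1} × (0,1/2), x_d^{p−1} dx)` but has no distributional boundary trace,
as its pairing with any test function `ψ` with `∫ φψ ≠ 0` blows up as `x_d → 0⁺`. -/
theorem loglog_example_no_trace (d : ℕ) (hd : 2 ≤ d) (p : ℝ) (hp : 1 < p)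
    (φ : (Fin (d - 1) → ℝ) → ℝ) (hφ_smooth : ContDiff ℝ (⊤ : ℕ∞) φ)
    (hφ_supp : HasCompactSupport φ) (hφ_ne : φ ≠ 0) :
    (∫⁻ x : (Fin (d - 1) → ℝ) × ℝ in {x | 0 < x.2 ∧ x.2 < 1 / 2},
        ENNReal.ofReal
          ((|φ x.1 * Real.log (Real.log (1 / x.2))| ^ p
            + ‖fderiv ℝ (fun y : (Fin (d - 1) → ℝ) × ℝ =>
                φ y.1 * Real.log (Real.log (1 / y.2))) x‖ ^ p)
            * x.2 ^ (p - 1))) < ⊤ ∧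
    ∀ ψ : (Fin (d - 1) → ℝ) → ℝ, ContDiff ℝ (⊤ : ℕ∞) ψ → HasCompactSupport ψ →
      (∫ x' : Fin (d - 1) → ℝ, φ x' * ψ x') ≠ 0 →
      (Tendsto (fun xd : ℝ =>
            ∫ x' : Fin (d - 1) → ℝ, φ x' * Real.log (Real.log (1 / xd)) * ψ x')
          (nhdsWithin 0 (Ioi 0)) atTop ∨
       Tendsto (fun xd : ℝ =>
            ∫ x' : Fin (d - 1) → ℝ, φ x' * Real.log (Real.log (1 / xd)) * ψ x')
          (nhdsWithin 0 (Ioi 0)) atBot) := by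
  constructor
  · set A : (Fin (d - 1) → ℝ) → ℝ := fun y => |φ y| + ‖fderiv ℝ φ y‖
    have hA0 : ∀ y, 0 ≤ A y := fun y => by positivity
    have hA_cont : Continuous A :=
      hφ_smooth.continuous.abs.add (hφ_smooth.continuous_fderiv (by simp)).norm
    have hA_supp : HasCompactSupport A :=
      (hφ_supp.comp_left (g := fun r : ℝ => |r|) abs_zero).add (hφ_supp.fderiv (𝕜 := ℝ)).norm
    have hB : Integrable (fun y => 2 * (5 * A y) ^ p) := by
      refine Continuous.integrable_of_hasCompactSupport ?_ ?_
      · exact continuous_const.mul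
          ((continuous_const.mul hA_cont).rpow_const fun _ => Or.inr (by linarith))
      · refine hA_supp.comp_left (g := fun r : ℝ => 2 * (5 * r) ^ p) ?_
        simp [Real.zero_rpow (by linarith : p ≠ 0)]
    have hH := (integrableOn_inv_mul_log_one_div_rpow hp).mono_set Ioo_subset_Ioc_self
    have hset : {x : (Fin (d - 1) → ℝ) × ℝ | 0 < x.2 ∧ x.2 < 1 / 2} =
        univ ×ˢ Ioo (0 : ℝ) (1 / 2) := by
      ext x; simp
    have hbound : ∀ x ∈ (univ : Set (Fin (d - 1) → ℝ)) ×ˢ Ioo (0 : ℝ) (1 / 2),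
        ENNReal.ofReal
          ((|φ x.1 * Real.log (Real.log (1 / x.2))| ^ p
            + ‖fderiv ℝ (fun y : (Fin (d - 1) → ℝ) × ℝ =>
                φ y.1 * Real.log (Real.log (1 / y.2))) x‖ ^ p)
            * x.2 ^ (p - 1)) ≤
        ENNReal.ofReal (2 * (5 * A x.1) ^ p) *
          ENNReal.ofReal (x.2⁻¹ * Real.log (1 / x.2) ^ (-p)) := by
      rintro x ⟨-, h0, h1⟩
      have hs : 0 < Real.log (1 / x.2) := Real.log_pos (by rw [lt_div_iff₀ h0]; linarith)
      have hL := abs_log_log_one_div_le h0 h1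
      have hD := norm_fderiv_mul_prod_le (x := x)
        (hφ_smooth.differentiable (by simp) x.1)
        (hasDerivAt_log_log_one_div h0 (by linarith))
      rw [abs_neg, abs_of_pos (by positivity : 0 < (x.2 * Real.log (1 / x.2))⁻¹)] at hD
      have hw : ((x.2 * Real.log (1 / x.2))⁻¹) ^ p * x.2 ^ (p - 1) =
          x.2⁻¹ * Real.log (1 / x.2) ^ (-p) := by
        rw [Real.inv_rpow (by positivity), Real.mul_rpow h0.le hs.le, Real.rpow_sub_one h0.ne',
          Real.rpow_neg hs.le]
        field_simp
      set q := (x.2 * Real.log (1 / x.2))⁻¹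
      have hq : 0 < q := by positivity
      have hφ0 := abs_nonneg (φ x.1)
      have hφ1 := norm_nonneg (fderiv ℝ φ x.1)
      have hφL := mul_le_mul_of_nonneg_left hL hφ0
      have hφL' := mul_le_mul_of_nonneg_right hL hφ1
      have hu : |φ x.1 * Real.log (Real.log (1 / x.2))| ≤ 5 * A x.1 * q := by
        rw [abs_mul]
        simp only [A]
        nlinarith [mul_nonneg hφ0 hq.le, mul_nonneg hφ1 hq.le]
      have hDu : ‖fderiv ℝ (fun y : (Fin (d - 1) → ℝ) × ℝ =>
          φ y.1 * Real.log (Real.log (1 / y.2))) x‖ ≤ 5 * A x.1 * q := by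
        refine hD.trans ?_
        simp only [A]
        nlinarith [mul_nonneg hφ0 hq.le, mul_nonneg hφ1 hq.le]
      have hAx := hA0 x.1
      rw [← ENNReal.ofReal_mul (by positivity), ← hw]
      refine ENNReal.ofReal_le_ofReal ?_
      calc _ ≤ ((5 * A x.1 * q) ^ p + (5 * A x.1 * q) ^ p) * x.2 ^ (p - 1) := by gcongr
        _ = _ := by
          rw [Real.mul_rpow (by positivity) hq.le]
          ring
    rw [hset]
    refine (setLIntegral_mono' (MeasurableSet.univ.prod measurableSet_Ioo) hbound).trans_lt ?_
    rw [Measure.volume_eq_prod, ← Measure.prod_restrict, Measure.restrict_univ,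
      lintegral_prod_mul hB.aestronglyMeasurable.aemeasurable.ennreal_ofReal
        hH.aestronglyMeasurable.aemeasurable.ennreal_ofReal]
    exact ENNReal.mul_lt_top hB.lintegral_lt_top hH.lintegral_lt_top
  · intro ψ _ _ hc
    have hL := Real.tendsto_log_atTop.comp tendsto_log_one_div_nhdsGT_zero
    have hint : (fun xd : ℝ =>
        ∫ x' : Fin (d - 1) → ℝ, φ x' * Real.log (Real.log (1 / xd)) * ψ x') =
        fun xd => Real.log (Real.log (1 / xd)) * ∫ x' : Fin (d - 1) → ℝ, φ x' * ψ x' := by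
      ext xd
      rw [← integral_const_mul]
      congr 1 with x'
      ring
    rw [hint]
    rcases hc.lt_or_gt with h | h
    · exact Or.inr (hL.atTop_mul_const_of_neg h)
    · exact Or.inl (hL.atTop_mul_const h)
end

section
/- Let d ≥ 2, p ∈ (1,∞), β > p − 1, and let δ satisfy 0 < δ < (β+1)/p − 1. Let φ ∈ C_0^∞(ℝ^{d-1}) be a nonzero smooth compactly supported function and define u(x', x_d) = φ(x') · x_d^{−δ} for x' ∈ ℝ^{d-1} and 0 < x_d < 1/2. Then: (a) ∫_{ℝ^{d-1} × (0,1/2)} ( |u(x)|^p + |∇u(x)|^p ) x_d^β dx < ∞, where ∇u is the full gradient in all d variables; and (b) for every ψ ∈ C_0^∞(ℝ^{d-1}) with ∫_{ℝ^{d-1}} φ ψ dx' ≠ 0, the pairing ∫_{ℝ^{d-1}} u(x', x_d) ψ(x') dx' tends to +∞ or −∞ as x_d → 0⁺; in particular u(·, x_d) does not converge in the space of distributions D'(ℝ^{d-1}) as x_d → 0⁺. -/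
open MeasureTheory Set ENNReal Filter

/-- A nonzero multiple of a negative power `t ^ (-δ)` diverges to `±∞` as `t → 0⁺`. -/
theorem tendsto_const_mul_rpow_neg_nhdsGT_zero {δ c : ℝ} (hδ : 0 < δ) (hc : c ≠ 0) :
    Tendsto (fun t : ℝ => c * t ^ (-δ)) (nhdsWithin 0 (Ioi 0)) atTop ∨
      Tendsto (fun t : ℝ => c * t ^ (-δ)) (nhdsWithin 0 (Ioi 0)) atBot := by
  have h : Tendsto (fun t : ℝ => t ^ (-δ)) (nhdsWithin 0 (Ioi 0)) atTop :=
    tendsto_rpow_neg_nhdsGT_zero (neg_neg_of_pos hδ)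
  rcases hc.lt_or_gt with hc | hc
  · exact Or.inr (h.const_mul_atTop_of_neg hc)
  · exact Or.inl (h.const_mul_atTop hc)

/-- Gradient bound for a tensor product `φ(x') t ^ (-δ)` with `0 < t ≤ 1`. -/
theorem norm_fderiv_mul_rpow_neg_le {E : Type*} [NormedAddCommGroup E] [NormedSpace ℝ E]
    {φ : E → ℝ} {δ : ℝ} (hδ : 0 ≤ δ) {x : E × ℝ} (hφ : DifferentiableAt ℝ φ x.1)
    (h0 : 0 < x.2) (h1 : x.2 ≤ 1) :
    ‖fderiv ℝ (fun y : E × ℝ => φ y.1 * y.2 ^ (-δ)) x‖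
      ≤ (‖fderiv ℝ φ x.1‖ + δ * |φ x.1|) * x.2 ^ (-δ - 1) := by
  have hfst : HasFDerivAt (fun y : E × ℝ => φ y.1)
      ((fderiv ℝ φ x.1).comp (ContinuousLinearMap.fst ℝ E ℝ)) x :=
    hφ.hasFDerivAt.comp x hasFDerivAt_fst
  have hsnd : HasFDerivAt (fun y : E × ℝ => y.2 ^ (-δ))
      ((-δ * x.2 ^ (-δ - 1)) • ContinuousLinearMap.snd ℝ E ℝ) x :=
    (Real.hasDerivAt_rpow_const (Or.inl h0.ne')).comp_hasFDerivAt x hasFDerivAt_snd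
  have hle : x.2 ^ (-δ) ≤ x.2 ^ (-δ - 1) :=
    Real.rpow_le_rpow_of_exponent_ge h0 h1 (by linarith)
  have hpos : 0 < x.2 ^ (-δ - 1) := Real.rpow_pos_of_pos h0 _
  have hD : ‖(fderiv ℝ φ x.1).comp (ContinuousLinearMap.fst ℝ E ℝ)‖ ≤ ‖fderiv ℝ φ x.1‖ :=
    (ContinuousLinearMap.opNorm_comp_le _ _).trans
      (mul_le_of_le_one_right (norm_nonneg _) (ContinuousLinearMap.norm_fst_le ℝ E ℝ))
  have hS : ‖(-δ * x.2 ^ (-δ - 1)) • ContinuousLinearMap.snd ℝ E ℝ‖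
      ≤ δ * x.2 ^ (-δ - 1) := by
    rw [norm_smul, norm_mul, norm_neg, Real.norm_of_nonneg hδ, Real.norm_of_nonneg hpos.le]
    exact mul_le_of_le_one_right (by positivity) (ContinuousLinearMap.norm_snd_le ℝ E ℝ)
  rw [show fderiv ℝ (fun y : E × ℝ => φ y.1 * y.2 ^ (-δ)) x = _ from (hfst.mul hsnd).fderiv]
  calc _ ≤ |φ x.1| * (δ * x.2 ^ (-δ - 1)) + x.2 ^ (-δ - 1) * ‖fderiv ℝ φ x.1‖ := by
        refine (norm_add_le _ _).trans (add_le_add ?_ ?_)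
        · rw [norm_smul, Real.norm_eq_abs]
          gcongr
        · rw [norm_smul, Real.norm_of_nonneg (Real.rpow_pos_of_pos h0 _).le]
          gcongr
    _ = _ := by ring

/-- The weighted Sobolev integrand of `φ(x') t ^ (-δ)` is dominated by a product function. -/
theorem sobolev_integrand_mul_rpow_neg_le {E : Type*} [NormedAddCommGroup E]
    [NormedSpace ℝ E] {φ : E → ℝ} {δ p : ℝ} (β : ℝ) (hδ : 0 ≤ δ) (hp : 0 ≤ p) {x : E × ℝ}
    (hφ : DifferentiableAt ℝ φ x.1) (h0 : 0 < x.2) (h1 : x.2 ≤ 1) :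
    (|φ x.1 * x.2 ^ (-δ)| ^ p
        + ‖fderiv ℝ (fun y : E × ℝ => φ y.1 * y.2 ^ (-δ)) x‖ ^ p) * x.2 ^ β
      ≤ (|φ x.1| ^ p + (‖fderiv ℝ φ x.1‖ + δ * |φ x.1|) ^ p)
        * x.2 ^ ((-δ - 1) * p + β) := by
  have hle : x.2 ^ (-δ) ≤ x.2 ^ (-δ - 1) :=
    Real.rpow_le_rpow_of_exponent_ge h0 h1 (by linarith)
  have hpos : 0 < x.2 ^ (-δ - 1) := Real.rpow_pos_of_pos h0 _
  have hu : |φ x.1 * x.2 ^ (-δ)| ≤ |φ x.1| * x.2 ^ (-δ - 1) := by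
    rw [abs_mul, abs_of_pos (Real.rpow_pos_of_pos h0 (-δ))]
    gcongr
  have hg := norm_fderiv_mul_rpow_neg_le hδ hφ h0 h1
  calc _ ≤ ((|φ x.1| * x.2 ^ (-δ - 1)) ^ p
          + ((‖fderiv ℝ φ x.1‖ + δ * |φ x.1|) * x.2 ^ (-δ - 1)) ^ p) * x.2 ^ β := by
        gcongr
    _ = _ := by
        rw [Real.mul_rpow (abs_nonneg _) hpos.le, Real.mul_rpow (by positivity) hpos.le,
          ← Real.rpow_mul h0.le, Real.rpow_add h0]
        ring

/-- The `x'`-factor of the dominating function is integrable. -/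
theorem integrable_rpow_abs_add_rpow_norm_fderiv {E : Type*} [NormedAddCommGroup E]
    [NormedSpace ℝ E] [MeasurableSpace E] [OpensMeasurableSpace E] {μ : Measure E}
    [IsFiniteMeasureOnCompacts μ] {φ : E → ℝ} {p : ℝ} (δ : ℝ) (hp : 0 < p)
    (hφ : ContDiff ℝ 1 φ) (hφ_supp : HasCompactSupport φ) :
    Integrable (fun x => |φ x| ^ p + (‖fderiv ℝ φ x‖ + δ * |φ x|) ^ p) μ := by
  have hD : Continuous (fderiv ℝ φ) := hφ.continuous_fderiv one_ne_zero
  have hc := hφ.continuous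
  refine Continuous.integrable_of_hasCompactSupport ?_ ?_
  · exact (hc.abs.rpow_const fun _ => Or.inr hp.le).add
      ((hD.norm.add (hc.abs.const_mul δ)).rpow_const fun _ => Or.inr hp.le)
  · have habs : HasCompactSupport fun x => |φ x| := hφ_supp.norm
    have hsum : HasCompactSupport fun x => ‖fderiv ℝ φ x‖ + δ * |φ x| :=
      (hφ_supp.fderiv (𝕜 := ℝ)).norm.add habs.mul_left
    have hpow : (0 : ℝ) ^ p = 0 := Real.zero_rpow hp.ne'
    exact (habs.comp_left (g := fun t : ℝ => t ^ p) hpow).add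
      (hsum.comp_left (g := fun t : ℝ => t ^ p) hpow)

/-- The example `u(x', x_d) = φ(x') x_d^{−δ}` with `0 < δ < (β+1)/p − 1`: it belongs to
the weighted Sobolev space `W^1_p(ℝ^{d-1} × (0,1/2), x_d^β dx)` for `β > p − 1` but has
no distributional boundary trace, as its pairing with any test function `ψ` with
`∫ φψ ≠ 0` blows up as `x_d → 0⁺`. -/
theorem power_blowup_example_no_trace (d : ℕ) (hd : 2 ≤ d) (p β δ : ℝ) (hp : 1 < p)
    (hβ : p - 1 < β) (hδ0 : 0 < δ) (hδ1 : δ < (β + 1) / p - 1)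
    (φ : (Fin (d - 1) → ℝ) → ℝ) (hφ_smooth : ContDiff ℝ (⊤ : ℕ∞) φ)
    (hφ_supp : HasCompactSupport φ) (hφ_ne : φ ≠ 0) :
    (∫⁻ x : (Fin (d - 1) → ℝ) × ℝ in {x | 0 < x.2 ∧ x.2 < 1 / 2},
        ENNReal.ofReal
          ((|φ x.1 * x.2 ^ (-δ)| ^ p
            + ‖fderiv ℝ (fun y : (Fin (d - 1) → ℝ) × ℝ => φ y.1 * y.2 ^ (-δ)) x‖ ^ p)
            * x.2 ^ β)) < ⊤ ∧
    ∀ ψ : (Fin (d - 1) → ℝ) → ℝ, ContDiff ℝ (⊤ : ℕ∞) ψ → HasCompactSupport ψ →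
      (∫ x' : Fin (d - 1) → ℝ, φ x' * ψ x') ≠ 0 →
      (Tendsto (fun xd : ℝ => ∫ x' : Fin (d - 1) → ℝ, φ x' * xd ^ (-δ) * ψ x')
          (nhdsWithin 0 (Ioi 0)) atTop ∨
       Tendsto (fun xd : ℝ => ∫ x' : Fin (d - 1) → ℝ, φ x' * xd ^ (-δ) * ψ x')
          (nhdsWithin 0 (Ioi 0)) atBot) := by
  have hp0 : 0 < p := one_pos.trans hp
  have hφ1 : ContDiff ℝ 1 φ := hφ_smooth.of_le (by exact_mod_cast le_top)
  constructor
  · have hexp : -1 < (-δ - 1) * p + β := by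
      have := (lt_div_iff₀ hp0).1 (show δ + 1 < (β + 1) / p by linarith)
      linarith
    have hset : {x : (Fin (d - 1) → ℝ) × ℝ | 0 < x.2 ∧ x.2 < 1 / 2}
        = univ ×ˢ Ioo (0 : ℝ) (1 / 2) := by
      ext x
      simp
    have hint := (integrable_rpow_abs_add_rpow_norm_fderiv (μ := volume) δ hp0 hφ1
      hφ_supp).mul_prod ((intervalIntegral.integrableOn_Ioo_rpow_iff
        (show (0 : ℝ) < 1 / 2 by norm_num)).2 hexp)
    rw [hset]
    refine (setLIntegral_mono' (MeasurableSet.univ.prod measurableSet_Ioo)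
      fun x hx => ENNReal.ofReal_le_ofReal (sobolev_integrand_mul_rpow_neg_le β hδ0.le hp0.le
        (hφ1.differentiable one_ne_zero x.1) hx.2.1 (by linarith [hx.2.2]))).trans_lt ?_
    rw [Measure.volume_eq_prod, ← Measure.prod_restrict, Measure.restrict_univ]
    exact hint.lintegral_lt_top
  · intro ψ _ _ hne
    have hpair : (fun xd : ℝ => ∫ x' : Fin (d - 1) → ℝ, φ x' * xd ^ (-δ) * ψ x')
        = fun xd => (∫ x' : Fin (d - 1) → ℝ, φ x' * ψ x') * xd ^ (-δ) := by
      funext xd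
      rw [← integral_mul_const]
      exact integral_congr_ae (.of_forall fun x' => by ring)
    rw [hpair]
    exact tendsto_const_mul_rpow_neg_nhdsGT_zero hδ0 hne
end
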